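/- arXiv:2402.06834 — 2 statements merged into one kernel-verified Lean document; each statement's English description precedes it below -/
import Mathlib

section
/- Let f:(R,m) → (S,n) be a flat local homomorphism of noetherian local rings, where both R and S are complete with respect to their maximal-ideal-adic topologies and the closed fiber S/mS is a Gorenstein ring, and let M be a finitely generated S-module. Then Gfd_S(M) ≤ Gfd_R(M) + depth(n/mS, S/mS). -/
/- ## Preliminary definitions -/

universe u

open IsLocalRing

noncomputable section

/-- The embedding dimension of a local ring: `dim_k (m/m²)`. -/
def embDim (R : Type u) [CommRing R] [IsLocalRing R] : ℕ :=
  Module.finrank (ResidueField R) (CotangentSpace R)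

/-- Witness that `Q` is a Gorenstein flat `R`-module: a two-sided exact complex `F` of
flat modules, which stays exact after applying `I ⊗ᵣ -` for every injective module `I`,
with `Q` isomorphic to the image of the differential `F₁ → F₀`. -/
structure GorensteinFlatWitness (R : Type u) [CommRing R] (Q : Type u) [AddCommGroup Q]
    [Module R Q] where
  F : ℤ → Type u
  [instAdd : ∀ i, AddCommGroup (F i)]
  [instMod : ∀ i, Module R (F i)]
  d : (i : ℤ) → F (i + 1) →ₗ[R] F i
  flat : ∀ i, Module.Flat R (F i)
  exact : ∀ i : ℤ, Function.Exact (d (i + 1)) (d i)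
  exact_tensor : ∀ (I : Type u) [AddCommGroup I] [Module R I], Module.Injective R I →
    ∀ i : ℤ, Function.Exact (LinearMap.lTensor I (d (i + 1))) (LinearMap.lTensor I (d i))
  iso : Nonempty (Q ≃ₗ[R] LinearMap.range (d 0))

/-- `Q` is a Gorenstein flat `R`-module. -/
def IsGorensteinFlat (R : Type u) [CommRing R] (Q : Type u) [AddCommGroup Q]
    [Module R Q] : Prop :=
  Nonempty (GorensteinFlatWitness R Q)

/-- Witness that `J` is a Gorenstein injective `R`-module: a two-sided exact complex `I` of
injective modules, which stays exact after applying `Hom_R(E, -)` for every injective module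
`E`, with `J` isomorphic to the image of the differential `I₁ → I₀`. -/
structure GorensteinInjectiveWitness (R : Type u) [CommRing R] (J : Type u) [AddCommGroup J]
    [Module R J] where
  I : ℤ → Type u
  [instAdd : ∀ i, AddCommGroup (I i)]
  [instMod : ∀ i, Module R (I i)]
  d : (i : ℤ) → I (i + 1) →ₗ[R] I i
  injective : ∀ i, Module.Injective R (I i)
  exact : ∀ i : ℤ, Function.Exact (d (i + 1)) (d i)
  exact_hom : ∀ (E : Type u) [AddCommGroup E] [Module R E], Module.Injective R E →
    ∀ i : ℤ, Function.Exact (LinearMap.llcomp (σ₁₂ := RingHom.id R) R E (I (i + 1 + 1)) (I (i + 1)) (d (i + 1)))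
      (LinearMap.llcomp (σ₁₂ := RingHom.id R) R E (I (i + 1)) (I i) (d i))
  iso : Nonempty (J ≃ₗ[R] LinearMap.range (d 0))

/-- `J` is a Gorenstein injective `R`-module. -/
def IsGorensteinInjective (R : Type u) [CommRing R] (J : Type u) [AddCommGroup J]
    [Module R J] : Prop :=
  Nonempty (GorensteinInjectiveWitness R J)

/-- A surjection onto `M` whose source is Gorenstein flat. -/
structure GorensteinFlatCover (R : Type u) [CommRing R] (M : Type u) [AddCommGroup M]
    [Module R M] where
  Q : Type u
  [instAdd : AddCommGroup Q]
  [instMod : Module R Q]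
  π : Q →ₗ[R] M
  gflat : IsGorensteinFlat R Q
  surj : Function.Surjective π

attribute [instance] GorensteinFlatCover.instAdd GorensteinFlatCover.instMod

/-- `M` admits an exact sequence `0 → Qₙ → ⋯ → Q₀ → M → 0` with all `Qᵢ` Gorenstein flat;
equivalently (by splicing), defined by recursion on `n`. -/
def gfdLE (R : Type u) [CommRing R] :
    (n : ℕ) → (M : Type u) → [AddCommGroup M] → [Module R M] → Prop
  | 0, M, _, _ => IsGorensteinFlat R M
  | n + 1, M, _, _ => ∃ c : GorensteinFlatCover R M, gfdLE R n (LinearMap.ker c.π)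

/-- The Gorenstein flat dimension of `M` over `R`, as an element of `ℕ∞`
(the zero module has Gorenstein flat dimension `0` here, and `⊤` means infinite). -/
def gfd (R : Type u) [CommRing R] (M : Type u) [AddCommGroup M] [Module R M] : ℕ∞ :=
  sInf ((↑) '' { n : ℕ | gfdLE R n M })

/-- A flat cover of `M`. -/
structure FlatCover (R : Type u) [CommRing R] (M : Type u) [AddCommGroup M]
    [Module R M] where
  Q : Type u
  [instAdd : AddCommGroup Q]
  [instMod : Module R Q]
  π : Q →ₗ[R] M
  flat : Module.Flat R Q
  surj : Function.Surjective π

attribute [instance] FlatCover.instAdd FlatCover.instMod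

/-- `M` admits a flat resolution of length `≤ n`. -/
def fdLE (R : Type u) [CommRing R] :
    (n : ℕ) → (M : Type u) → [AddCommGroup M] → [Module R M] → Prop
  | 0, M, _, _ => Module.Flat R M
  | n + 1, M, _, _ => ∃ c : FlatCover R M, fdLE R n (LinearMap.ker c.π)

/-- The flat dimension of `M` over `R`, as an element of `ℕ∞`. -/
def flatDim (R : Type u) [CommRing R] (M : Type u) [AddCommGroup M] [Module R M] : ℕ∞ :=
  sInf ((↑) '' { n : ℕ | fdLE R n M })

/-- An embedding of `M` into a Gorenstein injective module. -/
structure GorensteinInjectiveHull (R : Type u) [CommRing R] (M : Type u) [AddCommGroup M]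
    [Module R M] where
  J : Type u
  [instAdd : AddCommGroup J]
  [instMod : Module R J]
  ι : M →ₗ[R] J
  ginj : IsGorensteinInjective R J
  inj : Function.Injective ι

attribute [instance] GorensteinInjectiveHull.instAdd GorensteinInjectiveHull.instMod

/-- `M` admits an exact sequence `0 → M → J₀ → ⋯ → J₋ₙ → 0` with all `Jᵢ`
Gorenstein injective. -/
def gidLE (R : Type u) [CommRing R] :
    (n : ℕ) → (M : Type u) → [AddCommGroup M] → [Module R M] → Prop
  | 0, M, _, _ => IsGorensteinInjective R M
  | n + 1, M, _, _ => ∃ c : GorensteinInjectiveHull R M,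
      gidLE R n (c.J ⧸ LinearMap.range c.ι)

/-- The Gorenstein injective dimension of `M` over `R`, as an element of `ℕ∞`. -/
def gid (R : Type u) [CommRing R] (M : Type u) [AddCommGroup M] [Module R M] : ℕ∞ :=
  sInf ((↑) '' { n : ℕ | gidLE R n M })

/-- An embedding of `M` into an injective module. -/
structure InjectiveHullStep (R : Type u) [CommRing R] (M : Type u) [AddCommGroup M]
    [Module R M] where
  J : Type u
  [instAdd : AddCommGroup J]
  [instMod : Module R J]
  ι : M →ₗ[R] J
  injective : Module.Injective R J
  inj : Function.Injective ι

attribute [instance] InjectiveHullStep.instAdd InjectiveHullStep.instMod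

/-- `M` admits an injective resolution of length `≤ n`. -/
def idLE (R : Type u) [CommRing R] :
    (n : ℕ) → (M : Type u) → [AddCommGroup M] → [Module R M] → Prop
  | 0, M, _, _ => Module.Injective R M
  | n + 1, M, _, _ => ∃ c : InjectiveHullStep R M, idLE R n (c.J ⧸ LinearMap.range c.ι)

/-- The injective dimension of `M` over `R`, as an element of `ℕ∞`. -/
def injDim (R : Type u) [CommRing R] (M : Type u) [AddCommGroup M] [Module R M] : ℕ∞ :=
  sInf ((↑) '' { n : ℕ | idLE R n M })

/-- The `i`-th Ext module `Ext_R^i(N, M)`. -/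
def extModule (R : Type u) [CommRing R] (i : ℕ) (N M : Type u) [AddCommGroup N] [Module R N]
    [AddCommGroup M] [Module R M] : ModuleCat.{u} R :=
  ((Ext R (ModuleCat.{u} R) i).obj (Opposite.op (ModuleCat.of R N))).obj (ModuleCat.of R M)

/-- The depth of `M` with respect to the ideal `I`: the least `i` such that
`Ext_R^i(R/I, M) ≠ 0` (with value `⊤ : ℕ∞` if no such `i` exists). -/
def idealDepth (R : Type u) [CommRing R] (I : Ideal R) (M : Type u) [AddCommGroup M]
    [Module R M] : ℕ∞ :=
  sInf ((↑) '' { i : ℕ | ¬ Subsingleton (extModule R i (R ⧸ I) M) })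

/-- A finitely generated `S`-module `M` is totally reflexive if the biduality map
`M → Hom_S(Hom_S(M,S),S)` is bijective and `Ext_S^i(M,S) = 0 = Ext_S^i(M^*,S)`
for all `i ≥ 1`. -/
def IsTotallyReflexive (S : Type u) [CommRing S] (M : Type u) [AddCommGroup M]
    [Module S M] : Prop :=
  Module.Finite S M ∧ Function.Bijective (Module.Dual.eval S M) ∧
    ∀ i : ℕ, 1 ≤ i → Subsingleton (extModule S i M S) ∧
      Subsingleton (extModule S i (Module.Dual S M) S)

/-- A noetherian local ring is G-regular if every totally reflexive module is free. -/
def IsGRegular (S : Type u) [CommRing S] : Prop :=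
  ∀ (M : Type u) [AddCommGroup M] [Module S M], IsTotallyReflexive S M → Module.Free S M

/-- A commutative ring is a regular local ring if it is a noetherian local ring whose
maximal ideal is generated by a regular sequence. -/
def IsRegularLocal (A : Type u) [CommRing A] : Prop :=
  IsNoetherianRing A ∧ ∃ h : IsLocalRing A, ∃ rs : List A,
    RingTheory.Sequence.IsRegular A rs ∧
      Ideal.span { x | x ∈ rs } = @IsLocalRing.maximalIdeal A _ h

/-- A Gorenstein local ring: a noetherian local ring of finite self-injective dimension. -/
def IsGorensteinLocal (A : Type u) [CommRing A] : Prop :=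
  IsNoetherianRing A ∧ IsLocalRing A ∧ injDim A A < ⊤

/-- `E` is an injective envelope (injective hull) of the residue field of the local
ring `S`: an injective module containing the residue field as an essential submodule. -/
def IsInjEnvResidueField (S : Type u) [CommRing S] [IsLocalRing S] (E : Type u)
    [AddCommGroup E] [Module S E] : Prop :=
  Module.Injective S E ∧ ∃ ι : ResidueField S →ₗ[S] E, Function.Injective ι ∧
    ∀ N : Submodule S E, N ≠ ⊥ → N ⊓ LinearMap.range ι ≠ ⊥

end
/- ## Homological dimensions along a ring homomorphism -/

noncomputable section

variable {R S : Type u} [CommRing R] [CommRing S]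

/-- The flat dimension `fd_R S` of `S` as an `R`-module along `f : R → S`. -/
def flatDimAlong (f : R →+* S) : ℕ∞ :=
  letI := f.toModule; flatDim R S

/-- The Gorenstein flat dimension over `R` of an `S`-module `M`, viewed as an
`R`-module along `f : R → S`. -/
def gfdAlong (f : R →+* S) (M : Type u) [AddCommGroup M] [Module S M] : ℕ∞ :=
  letI := Module.compHom M f; gfd R M

/-- The Gorenstein injective dimension over `R` of an `S`-module `M`, viewed as an
`R`-module along `f : R → S`. -/
def gidAlong (f : R →+* S) (M : Type u) [AddCommGroup M] [Module S M] : ℕ∞ :=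
  letI := Module.compHom M f; gid R M

/-- `M` is Gorenstein flat as an `R`-module along `f : R → S`. -/
def IsGorensteinFlatAlong (f : R →+* S) (M : Type u) [AddCommGroup M] [Module S M] : Prop :=
  letI := Module.compHom M f; IsGorensteinFlat R M

/-- `M` is Gorenstein injective as an `R`-module along `f : R → S`. -/
def IsGorensteinInjectiveAlong (f : R →+* S) (M : Type u) [AddCommGroup M]
    [Module S M] : Prop :=
  letI := Module.compHom M f; IsGorensteinInjective R M

end

open scoped TensorProduct

section ExtVan

open CategoryTheory

/-- `Ext_R^i(X, Y) = 0`. -/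
def ExtVan (R : Type u) [CommRing R] (i : ℕ) (X Y : Type u) [AddCommGroup X] [Module R X]
    [AddCommGroup Y] [Module R Y] : Prop :=
  Subsingleton (Abelian.Ext (ModuleCat.of R X) (ModuleCat.of R Y) i)

/-- `0 → X → Y → Z → 0` is a short exact sequence. -/
structure IsSES {R : Type*} [CommRing R] {X Y Z : Type*} [AddCommGroup X] [Module R X]
    [AddCommGroup Y] [Module R Y] [AddCommGroup Z] [Module R Z]
    (f : X →ₗ[R] Y) (g : Y →ₗ[R] Z) : Prop where
  inj : Function.Injective f
  surj : Function.Surjective g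
  exact : Function.Exact f g

variable {R : Type u} [CommRing R] {X Y Z A B C : Type u}
  [AddCommGroup X] [Module R X] [AddCommGroup Y] [Module R Y] [AddCommGroup Z] [Module R Z]
  [AddCommGroup A] [Module R A] [AddCommGroup B] [Module R B] [AddCommGroup C] [Module R C]

theorem IsSES.comp_eq_zero {f : X →ₗ[R] Y} {g : Y →ₗ[R] Z} (h : IsSES f g) : g ∘ₗ f = 0 :=
  h.exact.linearMap_comp_eq_zero

theorem IsSES.apply_apply {f : X →ₗ[R] Y} {g : Y →ₗ[R] Z} (h : IsSES f g) (x : X) :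
    g (f x) = 0 :=
  h.exact.apply_apply_eq_zero x

theorem IsSES.of_ker {g : Y →ₗ[R] Z} (hg : Function.Surjective g) :
    IsSES (LinearMap.ker g).subtype g :=
  ⟨Subtype.val_injective, hg, LinearMap.exact_subtype_ker_map g⟩

theorem IsSES.of_range {f : X →ₗ[R] Y} (hf : Function.Injective f) :
    IsSES f (LinearMap.range f).mkQ :=
  ⟨hf, Submodule.mkQ_surjective _, LinearMap.exact_map_mkQ_range f⟩

/-- The short complex of modules attached to a short exact sequence of linear maps. -/
noncomputable abbrev IsSES.toShortComplex {f : X →ₗ[R] Y} {g : Y →ₗ[R] Z} (h : IsSES f g) :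
    ShortComplex (ModuleCat.{u} R) :=
  ShortComplex.mk (ModuleCat.ofHom f) (ModuleCat.ofHom g) (by
    rw [← ModuleCat.ofHom_comp, h.comp_eq_zero]; rfl)

theorem IsSES.shortExact {f : X →ₗ[R] Y} {g : Y →ₗ[R] Z} (h : IsSES f g) :
    h.toShortComplex.ShortExact where
  exact := (ShortComplex.ShortExact.moduleCat_exact_iff_function_exact _).mpr h.exact
  mono_f := (ModuleCat.mono_iff_injective _).mpr h.inj
  epi_g := (ModuleCat.epi_iff_surjective _).mpr h.surj

open Abelian in
theorem IsSES.ext_mid_left {f : X →ₗ[R] Y} {g : Y →ₗ[R] Z} (h : IsSES f g) {i : ℕ}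
    (hX : ExtVan R i X A) (hZ : ExtVan R i Z A) : ExtVan R i Y A := by
  refine subsingleton_of_forall_eq 0 fun e => ?_
  obtain ⟨e', rfl⟩ := Ext.contravariant_sequence_exact₂ h.shortExact (ModuleCat.of R A) e
    (hX.elim _ _)
  rw [show e' = 0 from hZ.elim _ _]; simp

open Abelian in
theorem IsSES.ext_sub_left {f : X →ₗ[R] Y} {g : Y →ₗ[R] Z} (h : IsSES f g) {i : ℕ}
    (hY : ExtVan R i Y A) (hZ : ExtVan R (i + 1) Z A) : ExtVan R i X A := by
  refine subsingleton_of_forall_eq 0 fun e => ?_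
  obtain ⟨e', rfl⟩ := Ext.contravariant_sequence_exact₁ h.shortExact (ModuleCat.of R A) e
    (add_comm 1 i) (hZ.elim _ _)
  rw [show e' = 0 from hY.elim _ _]; simp

open Abelian in
theorem IsSES.ext_quot_left {f : X →ₗ[R] Y} {g : Y →ₗ[R] Z} (h : IsSES f g) {i : ℕ}
    (hX : ExtVan R i X A) (hY : ExtVan R (i + 1) Y A) : ExtVan R (i + 1) Z A := by
  refine subsingleton_of_forall_eq 0 fun e => ?_
  obtain ⟨e', rfl⟩ := Ext.contravariant_sequence_exact₃ h.shortExact (ModuleCat.of R A) e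
    (hY.elim _ _) (add_comm 1 i)
  rw [show e' = 0 from hX.elim _ _]; simp

open Abelian in
theorem IsSES.ext_mid_right {f : X →ₗ[R] Y} {g : Y →ₗ[R] Z} (h : IsSES f g) {i : ℕ}
    (hX : ExtVan R i A X) (hZ : ExtVan R i A Z) : ExtVan R i A Y := by
  refine subsingleton_of_forall_eq 0 fun e => ?_
  obtain ⟨e', rfl⟩ := Ext.covariant_sequence_exact₂ (ModuleCat.of R A) h.shortExact e
    (hZ.elim _ _)
  rw [show e' = 0 from hX.elim _ _]; simp

open Abelian in
theorem IsSES.ext_sub_right {f : X →ₗ[R] Y} {g : Y →ₗ[R] Z} (h : IsSES f g) {i : ℕ}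
    (hZ : ExtVan R i A Z) (hY : ExtVan R (i + 1) A Y) : ExtVan R (i + 1) A X := by
  refine subsingleton_of_forall_eq 0 fun e => ?_
  obtain ⟨e', rfl⟩ := Ext.covariant_sequence_exact₁ (ModuleCat.of R A) h.shortExact e
    (hY.elim _ _) rfl
  rw [show e' = 0 from hZ.elim _ _]; simp

open Abelian in
theorem IsSES.ext_quot_right {f : X →ₗ[R] Y} {g : Y →ₗ[R] Z} (h : IsSES f g) {i : ℕ}
    (hY : ExtVan R i A Y) (hX : ExtVan R (i + 1) A X) : ExtVan R i A Z := by
  refine subsingleton_of_forall_eq 0 fun e => ?_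
  obtain ⟨e', rfl⟩ := Ext.covariant_sequence_exact₃ (ModuleCat.of R A) h.shortExact e rfl
    (hX.elim _ _)
  rw [show e' = 0 from hY.elim _ _]; simp

theorem extVan_zero_iff : ExtVan R 0 X Y ↔ Subsingleton (X →ₗ[R] Y) :=
  (Abelian.Ext.addEquiv₀.toEquiv.trans ModuleCat.homEquiv).subsingleton_congr

theorem extVan_of_projective [Module.Projective R X] (i : ℕ) : ExtVan R (i + 1) X Y :=
  have := (IsProjective.iff_projective (R := R) X).mp inferInstance
  subsingleton_of_forall_eq 0 fun e => Abelian.Ext.eq_zero_of_projective e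

theorem extVan_of_injective [Module.Injective R Y] (i : ℕ) : ExtVan R (i + 1) X Y :=
  have := Module.injective_object_of_injective_module R Y
  subsingleton_of_forall_eq 0 fun e => Abelian.Ext.eq_zero_of_injective e

theorem ExtVan.of_subsingleton_left [Subsingleton X] (i : ℕ) : ExtVan R i X Y := by
  cases i with
  | zero => exact extVan_zero_iff.mpr ⟨fun f g => LinearMap.ext fun x => by
      rw [Subsingleton.elim x 0, map_zero, map_zero]⟩
  | succ i =>
    have : Module.Free R X := Module.Free.of_subsingleton R X
    exact extVan_of_projective i

theorem ExtVan.congr_left {i : ℕ} (e : X ≃ₗ[R] Y) (h : ExtVan R i X A) : ExtVan R i Y A := by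
  have hs : IsSES (e : X →ₗ[R] Y) (0 : Y →ₗ[R] PUnit.{u + 1}) :=
    ⟨e.injective, fun _ => ⟨0, rfl⟩, fun y => ⟨fun _ => ⟨e.symm y, by simp⟩, fun _ => rfl⟩⟩
  exact hs.ext_mid_left h (ExtVan.of_subsingleton_left i)

theorem ExtVan.congr_right {i : ℕ} (e : X ≃ₗ[R] Y) (h : ExtVan R i A X) : ExtVan R i A Y := by
  have hs : IsSES (e : X →ₗ[R] Y) (0 : Y →ₗ[R] PUnit.{u + 1}) :=
    ⟨e.injective, fun _ => ⟨0, rfl⟩, fun y => ⟨fun _ => ⟨e.symm y, by simp⟩, fun _ => rfl⟩⟩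
  refine hs.ext_mid_right h ?_
  cases i with
  | zero => exact extVan_zero_iff.mpr ⟨fun f g => LinearMap.ext fun x => Subsingleton.elim _ _⟩
  | succ i =>
    have : Module.Injective R PUnit.{u + 1} := ⟨fun _ _ _ _ _ _ _ _ _ => ⟨0, fun _ => rfl⟩⟩
    exact extVan_of_injective i

open Abelian in
/-- If `Ext¹(Z, A) = 0`, maps `X → A` extend along `0 → X → Y → Z → 0`. -/
theorem IsSES.exists_extend {f : X →ₗ[R] Y} {g : Y →ₗ[R] Z} (h : IsSES f g)
    (hZ : ExtVan R 1 Z A) (φ : X →ₗ[R] A) : ∃ ψ : Y →ₗ[R] A, ψ ∘ₗ f = φ := by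
  obtain ⟨e, he⟩ := Ext.contravariant_sequence_exact₁ h.shortExact (ModuleCat.of R A)
    (Ext.mk₀ (ModuleCat.ofHom φ)) (add_comm 1 0) (hZ.elim _ _)
  obtain ⟨ψ, rfl⟩ := Ext.addEquiv₀.symm.surjective e
  refine ⟨ψ.hom, ?_⟩
  simp only [Ext.addEquiv₀_symm_apply, Ext.mk₀_comp_mk₀] at he
  have := congrArg ModuleCat.Hom.hom ((Ext.mk₀_bijective _ _).1 he)
  simpa using this

open Abelian in
theorem IsSES.ext_one_of_extend {f : X →ₗ[R] Y} {g : Y →ₗ[R] Z} (h : IsSES f g)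
    (hY : ExtVan R 1 Y A) (H : ∀ φ : X →ₗ[R] A, ∃ ψ : Y →ₗ[R] A, ψ ∘ₗ f = φ) :
    ExtVan R 1 Z A := by
  refine subsingleton_of_forall_eq 0 fun e => ?_
  obtain ⟨e', rfl⟩ := Ext.contravariant_sequence_exact₃ h.shortExact (ModuleCat.of R A) e
    (hY.elim _ _) (add_comm 1 0)
  obtain ⟨φ, rfl⟩ := Ext.addEquiv₀.symm.surjective e'
  obtain ⟨ψ, hψ⟩ := H φ.hom
  have : φ = ModuleCat.ofHom f ≫ ModuleCat.ofHom ψ := by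
    ext x; simp [← hψ]
  rw [this, Ext.addEquiv₀_symm_apply, ← Ext.mk₀_comp_mk₀]
  exact h.shortExact.extClass_comp_assoc _

open Abelian in
/-- If `Ext¹(A, X) = 0`, maps `A → Z` lift along `0 → X → Y → Z → 0`. -/
theorem IsSES.exists_lift {f : X →ₗ[R] Y} {g : Y →ₗ[R] Z} (h : IsSES f g)
    (hX : ExtVan R 1 A X) (φ : A →ₗ[R] Z) : ∃ ψ : A →ₗ[R] Y, g ∘ₗ ψ = φ := by
  obtain ⟨e, he⟩ := Ext.covariant_sequence_exact₃ (ModuleCat.of R A) h.shortExact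
    (Ext.mk₀ (ModuleCat.ofHom φ)) (zero_add 1) (hX.elim _ _)
  obtain ⟨ψ, rfl⟩ := Ext.addEquiv₀.symm.surjective e
  refine ⟨ψ.hom, ?_⟩
  simp only [Ext.addEquiv₀_symm_apply, Ext.mk₀_comp_mk₀] at he
  have := congrArg ModuleCat.Hom.hom ((Ext.mk₀_bijective _ _).1 he)
  simpa using this

open Abelian in
theorem IsSES.ext_one_of_lift {f : X →ₗ[R] Y} {g : Y →ₗ[R] Z} (h : IsSES f g)
    (hY : ExtVan R 1 A Y) (H : ∀ φ : A →ₗ[R] Z, ∃ ψ : A →ₗ[R] Y, g ∘ₗ ψ = φ) :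
    ExtVan R 1 A X := by
  refine subsingleton_of_forall_eq 0 fun e => ?_
  obtain ⟨e', rfl⟩ := Ext.covariant_sequence_exact₁ (ModuleCat.of R A) h.shortExact e
    (hY.elim _ _) (zero_add 1)
  obtain ⟨φ, rfl⟩ := Ext.addEquiv₀.symm.surjective e'
  obtain ⟨ψ, hψ⟩ := H φ.hom
  have : φ = ModuleCat.ofHom ψ ≫ ModuleCat.ofHom g := by
    ext x; simp [← hψ]
  rw [this, Ext.addEquiv₀_symm_apply, ← Ext.mk₀_comp_mk₀]
  rw [Ext.comp_assoc_of_second_deg_zero]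
  have : (Ext.mk₀ (ModuleCat.ofHom g)).comp h.shortExact.extClass (zero_add 1) = 0 :=
    h.shortExact.comp_extClass
  rw [this, Ext.comp_zero]

variable (R) in
/-- Every module is a quotient of a free module. -/
theorem exists_free_isSES (X : Type u) [AddCommGroup X] [Module R X] :
    ∃ (F K : Type u) (_ : AddCommGroup F) (_ : Module R F) (_ : AddCommGroup K) (_ : Module R K)
      (f : K →ₗ[R] F) (g : F →ₗ[R] X), Module.Free R F ∧ IsSES f g :=
  ⟨X →₀ R, _, inferInstance, inferInstance, inferInstance, inferInstance, _,
    Finsupp.linearCombination R id, inferInstance,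
    IsSES.of_ker (Finsupp.linearCombination_id_surjective R X)⟩

variable (R) in
/-- Every finite module is a quotient of a finite free module. -/
theorem exists_finite_free_isSES (X : Type u) [AddCommGroup X] [Module R X] [Module.Finite R X] :
    ∃ (F K : Type u) (_ : AddCommGroup F) (_ : Module R F) (_ : AddCommGroup K) (_ : Module R K)
      (f : K →ₗ[R] F) (g : F →ₗ[R] X), Module.Free R F ∧ Module.Finite R F ∧ IsSES f g := by
  obtain ⟨n, g, hg⟩ := Module.Finite.exists_fin' R X
  exact ⟨Fin n → R, _, inferInstance, inferInstance, inferInstance, inferInstance, _,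
    g, inferInstance, inferInstance, IsSES.of_ker hg⟩

variable (R) in
/-- Every module embeds in an injective module. -/
theorem exists_injective_isSES (X : Type u) [AddCommGroup X] [Module R X] :
    ∃ (J C : Type u) (_ : AddCommGroup J) (_ : Module R J) (_ : AddCommGroup C) (_ : Module R C)
      (f : X →ₗ[R] J) (g : J →ₗ[R] C), Module.Injective R J ∧ IsSES f g := by
  have : EnoughInjectives (ModuleCat.{u} R) := inferInstance
  obtain ⟨p⟩ := this.presentation (ModuleCat.of R X)
  have hJ : Module.Injective R p.J :=
    have := p.injective
    Module.injective_module_of_injective_object R p.J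
  refine ⟨p.J, _, inferInstance, inferInstance, inferInstance, inferInstance, p.f.hom, _, hJ,
    IsSES.of_range ((ModuleCat.mono_iff_injective p.f).mp p.mono)⟩

end ExtVan

section Torsion

variable {R : Type*} [CommRing R]

/-- The elements of `M` killed by some power of `J`. -/
def powTorsion (J : Ideal R) (M : Type*) [AddCommGroup M] [Module R M] : Submodule R M where
  carrier := {x | ∃ k : ℕ, ∀ r ∈ J ^ k, r • x = 0}
  zero_mem' := ⟨0, fun r _ => smul_zero r⟩
  add_mem' := by
    rintro x y ⟨k, hk⟩ ⟨l, hl⟩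
    refine ⟨k + l, fun r hr => ?_⟩
    rw [smul_add, hk r (Ideal.pow_le_pow_right (Nat.le_add_right k l) hr),
      hl r (Ideal.pow_le_pow_right (Nat.le_add_left l k) hr), add_zero]
  smul_mem' := by
    rintro c x ⟨k, hk⟩
    exact ⟨k, fun r hr => by rw [smul_comm, hk r hr, smul_zero]⟩

/-- Every element of `M` is killed by a power of `J`. -/
def IsPowTorsion (J : Ideal R) (M : Type*) [AddCommGroup M] [Module R M] : Prop :=
  ∀ x : M, ∃ k : ℕ, ∀ r ∈ J ^ k, r • x = 0

theorem isPowTorsion_powTorsion (J : Ideal R) (M : Type*) [AddCommGroup M] [Module R M] :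
    IsPowTorsion J (powTorsion J M) := by
  rintro ⟨x, k, hk⟩
  exact ⟨k, fun r hr => Subtype.ext (hk r hr)⟩

theorem IsPowTorsion.of_surjective {J : Ideal R} {M N : Type*} [AddCommGroup M] [Module R M]
    [AddCommGroup N] [Module R N] (h : IsPowTorsion J M) {f : M →ₗ[R] N}
    (hf : Function.Surjective f) : IsPowTorsion J N := by
  intro y
  obtain ⟨x, rfl⟩ := hf y
  obtain ⟨k, hk⟩ := h x
  exact ⟨k, fun r hr => by rw [← map_smul, hk r hr, map_zero]⟩

/-- A uniform exponent for the elements of a finitely generated submodule. -/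
theorem IsPowTorsion.exists_uniform {J : Ideal R} {M N : Type*} [AddCommGroup M] [Module R M]
    [AddCommGroup N] [Module R N] [Module.Finite R N] (h : IsPowTorsion J M) (g : N →ₗ[R] M) :
    ∃ k : ℕ, ∀ r ∈ J ^ k, ∀ x, r • g x = 0 := by
  obtain ⟨s, hs⟩ := Module.Finite.fg_top (R := R) (M := N)
  choose k hk using fun x : N => h (g x)
  refine ⟨s.sup k, fun r hr x => ?_⟩
  have hx : x ∈ Submodule.span R (s : Set N) := hs ▸ Submodule.mem_top
  induction hx using Submodule.span_induction with
  | mem x hx => exact hk x r (Ideal.pow_le_pow_right (Finset.le_sup hx) hr)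
  | zero => simp
  | add x y _ _ hx hy => rw [map_add, smul_add, hx, hy, add_zero]
  | smul c x _ hx => rw [map_smul, smul_comm, hx, smul_zero]

/-- For a `J`-power torsion module over a noetherian ring, Baer's criterion only has to be
checked on ideals containing a power of `J`. -/
theorem IsPowTorsion.baer [IsNoetherianRing R] {J : Ideal R} {Z : Type*} [AddCommGroup Z]
    [Module R Z] (hZ : IsPowTorsion J Z)
    (H : ∀ (b : Ideal R) (k : ℕ), J ^ k ≤ b → ∀ g : b →ₗ[R] Z,
      ∃ g' : R →ₗ[R] Z, ∀ (x : R) (mem : x ∈ b), g' x = g ⟨x, mem⟩) : Module.Baer R Z := by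
  intro a g
  obtain ⟨k, hk⟩ := hZ.exists_uniform g
  obtain ⟨n, hn⟩ := Ideal.exists_pow_inf_eq_pow_smul J (N := a)
  have key : ∀ x (hx : x ∈ a), x ∈ J ^ (n + k) → g ⟨x, hx⟩ = 0 := by
    intro x hx hxJ
    have h1 : x ∈ J ^ k • a := by
      have : x ∈ (J ^ (n + k) • ⊤ : Submodule R R) ⊓ a := ⟨by simpa using hxJ, hx⟩
      rw [hn (n + k) (Nat.le_add_right _ _), Nat.add_sub_cancel_left] at this
      exact smul_mono_right (J ^ k) (inf_le_right : _ ⊓ a ≤ a) this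
    have h2 : ∀ y ∈ J ^ k • a, ∀ hy : y ∈ a, g ⟨y, hy⟩ = 0 := by
      intro y hy
      induction hy using Submodule.smul_induction_on' with
      | smul r hr b hb =>
        intro hy
        have : (⟨r • b, hy⟩ : a) = r • ⟨b, hb⟩ := rfl
        rw [this, map_smul]
        exact hk r hr _
      | add x hx y hy hx' hy' =>
        intro h
        have hxa : x ∈ a := Submodule.smul_le_right hx
        have hya : y ∈ a := Submodule.smul_le_right hy
        have : (⟨x + y, h⟩ : a) = ⟨x, hxa⟩ + ⟨y, hya⟩ := rfl
        rw [this, map_add, hx' hxa, hy' hya, add_zero]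
    exact h2 x h1 hx
  let p : R →ₗ.[R] Z := ⟨a, g⟩
  let q : R →ₗ.[R] Z := ⟨J ^ (n + k), 0⟩
  have hpq : ∀ (x : p.domain) (y : q.domain), (x : R) = y → p x = q y := by
    rintro ⟨x, hx⟩ ⟨y, hy⟩ (rfl : x = y)
    exact key x hx hy
  obtain ⟨g', hg'⟩ := H (p.sup q hpq).domain (n + k) le_sup_right (p.sup q hpq).toFun
  refine ⟨g', fun x hx => ?_⟩
  rw [hg' x (Submodule.mem_sup_left hx)]
  exact (LinearPMap.left_le_sup p q hpq).2 (x := ⟨x, hx⟩) rfl |>.symm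

theorem IsPowTorsion.injective_of_ext {R : Type u} [CommRing R] [IsNoetherianRing R] {J : Ideal R}
    {Z : Type u} [AddCommGroup Z] [Module R Z] (hZ : IsPowTorsion J Z)
    (H : ∀ (b : Ideal R) (k : ℕ), J ^ k ≤ b → ExtVan R 1 (R ⧸ b) Z) : Module.Injective R Z := by
  refine Module.Baer.injective (hZ.baer fun b k hb g => ?_)
  have hs : IsSES b.subtype (Submodule.mkQ b) :=
    ⟨Subtype.val_injective, Submodule.mkQ_surjective _, LinearMap.exact_subtype_mkQ b⟩
  obtain ⟨g', hg'⟩ := hs.exists_extend (H b k hb) g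
  exact ⟨g', fun x hx => LinearMap.congr_fun hg' ⟨x, hx⟩⟩

theorem powTorsion_injective {R : Type u} [CommRing R] [IsNoetherianRing R] (J : Ideal R)
    {I : Type u} [AddCommGroup I] [Module R I] [Module.Injective R I] :
    Module.Injective R (powTorsion J I) := by
  refine Module.Baer.injective ((isPowTorsion_powTorsion J I).baer fun b k hb g => ?_)
  obtain ⟨g', hg'⟩ := Module.Injective.out b.subtype Subtype.val_injective
    ((powTorsion J I).subtype ∘ₗ g)
  obtain ⟨l, hl⟩ := (isPowTorsion_powTorsion J I).exists_uniform g
  have h1 : g' 1 ∈ powTorsion J I := by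
    refine ⟨l + k, fun r hr => ?_⟩
    rw [pow_add] at hr
    induction hr using Submodule.mul_induction_on' with
    | mem_mul_mem r hr s hs =>
      have := hg' ⟨s, hb hs⟩
      rw [mul_smul, ← map_smul, smul_eq_mul, mul_one]
      erw [this]
      exact congrArg Subtype.val (hl r hr ⟨s, hb hs⟩)
    | add x _ y _ hx hy => rw [add_smul, hx, hy, add_zero]
  refine ⟨LinearMap.toSpanSingleton R _ ⟨g' 1, h1⟩, fun x hx => Subtype.ext ?_⟩
  have := hg' ⟨x, hx⟩
  simp only [Submodule.subtype_apply, LinearMap.comp_apply] at this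
  rw [← this]
  simp [← map_smul]

end Torsion

section Matlis

/-- `E` is an injective hull of the residue field of the noetherian local ring `R`. -/
structure IsMatlis (R : Type u) [CommRing R] [IsLocalRing R] (E : Type u) [AddCommGroup E]
    [Module R E] : Prop where
  injective : Module.Injective R E
  torsion : IsPowTorsion (maximalIdeal R) E
  socle : ∃ e₀ : E, (∀ r : R, r • e₀ = 0 ↔ r ∈ maximalIdeal R) ∧
    ∀ e : E, (∀ r ∈ maximalIdeal R, r • e = 0) → ∃ r : R, e = r • e₀

variable {R : Type u} [CommRing R]

theorem exists_maximal_disjoint {T : Type*} [AddCommGroup T] [Module R T] (E : Submodule R T) :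
    ∃ C : Submodule R T, Disjoint E C ∧ ∀ D, C ≤ D → Disjoint E D → D = C := by
  obtain ⟨C, -, hC⟩ := zorn_le_nonempty₀ {C : Submodule R T | Disjoint E C} (fun c hc hch y hy =>
    ⟨sSup c, (DirectedOn.disjoint_sSup_right hch.directedOn).mpr fun D hD => hc hD,
      fun z hz => le_sSup hz⟩) ⊥ disjoint_bot_right
  exact ⟨C, hC.1, fun D h1 h2 => le_antisymm (hC.2 h2 h1) h1⟩

/-- A submodule of an injective module has a maximal essential extension, which is a retract. -/
theorem exists_essential_retract {T : Type u} [AddCommGroup T] [Module R T]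
    [Module.Injective R T] (L : Submodule R T) :
    ∃ E : Submodule R T, L ≤ E ∧ (∀ D ≤ E, Disjoint D L → D = ⊥) ∧ Module.Injective R E := by
  obtain ⟨E, hLE, hE⟩ := zorn_le_nonempty₀
    {E : Submodule R T | ∀ D ≤ E, Disjoint D L → D = ⊥} (fun c hc hch y hy => by
      refine ⟨sSup c, fun D hD hDL => ?_, fun z hz => le_sSup hz⟩
      have h1 : D = D ⊓ sSup c := (inf_eq_left.mpr hD).symm
      rw [hch.directedOn.inf_sSup_eq] at h1
      rw [h1, eq_bot_iff]
      refine iSup₂_le fun E' hE' => ?_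
      exact (hc hE' _ inf_le_right (hDL.mono_left inf_le_left)).le) L
    (fun D hD hDL => hDL.eq_bot_of_le hD)
  obtain ⟨C, hEC, hC⟩ := exists_maximal_disjoint E
  have hinj : Function.Injective (C.mkQ ∘ₗ E.subtype) := by
    rw [← LinearMap.ker_eq_bot, eq_bot_iff]
    intro x hx
    have : (x : T) ∈ C := by simpa using hx
    exact Subtype.ext (Submodule.disjoint_def.mp hEC x x.2 this)
  obtain ⟨h, hh⟩ := Module.Injective.out _ hinj E.subtype
  let ρ : T →ₗ[R] T := h ∘ₗ C.mkQ
  have hρ : ∀ x ∈ E, ρ x = x := fun x hx => hh ⟨x, hx⟩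
  have hρC : ∀ x ∈ C, ρ x = 0 := fun x hx => by
    change h (C.mkQ x) = 0
    rw [Submodule.mkQ_apply, (Submodule.Quotient.mk_eq_zero C).mpr hx, map_zero]
  have hess : ∀ D ≤ LinearMap.range ρ, Disjoint D L → D = ⊥ := by
    intro D hD hDL
    have h1 : D ⊓ E = ⊥ := hE.1 _ inf_le_right (hDL.mono_left inf_le_left)
    have h2 : D.comap ρ = C := by
      refine hC _ (fun x hx => by simp [hρC x hx]) ?_
      rw [Submodule.disjoint_def]
      intro x hxE hxD
      have : x ∈ D ⊓ E := ⟨by simpa [hρ x hxE] using hxD, hxE⟩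
      simpa [h1] using this
    rw [eq_bot_iff]
    intro d hd
    obtain ⟨x, rfl⟩ := hD hd
    have : x ∈ C := by rw [← h2]; exact hd
    simp [hρC x this]
  have hle : LinearMap.range ρ ≤ E := hE.2 hess fun x hx => ⟨x, hρ x hx⟩
  refine ⟨E, hLE, hE.1, ⟨fun X Y _ _ _ _ f hf g => ?_⟩⟩
  obtain ⟨k, hk⟩ := Module.Injective.out f hf (E.subtype ∘ₗ g)
  refine ⟨(ρ ∘ₗ k).codRestrict E fun y => hle ⟨_, rfl⟩, fun x => Subtype.ext ?_⟩
  simp [hk, hρ]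

variable (R) in
theorem exists_isMatlis [IsLocalRing R] [IsNoetherianRing R] :
    ∃ (E : Type u) (_ : AddCommGroup E) (_ : Module R E), IsMatlis R E := by
  obtain ⟨I, C, _, _, _, _, ι, π, hI, hι⟩ := exists_injective_isSES R (ResidueField R)
  let T := powTorsion (maximalIdeal R) I
  have hT : Module.Injective R T := powTorsion_injective _
  have hann : ∀ r : R, r • ι 1 = 0 ↔ r ∈ maximalIdeal R := by
    intro r
    rw [← map_smul, map_eq_zero_iff _ hι.inj, ← Ideal.Quotient.eq_zero_iff_mem,
      Algebra.smul_def, mul_one]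
    rfl
  let t₀ : T := ⟨ι 1, 1, fun r hr => (hann r).mpr (by simpa using hr)⟩
  have ht₀ : ∀ r : R, r • t₀ = 0 ↔ r ∈ maximalIdeal R := fun r => by
    rw [← hann r, ← Submodule.coe_eq_zero]; rfl
  obtain ⟨E, hLE, hess, hE⟩ := exists_essential_retract (R ∙ t₀)
  have h0 : t₀ ∈ E := hLE (Submodule.mem_span_singleton_self t₀)
  refine ⟨E, inferInstance, inferInstance, hE, fun x => ?_, ⟨t₀, h0⟩, fun r => ?_, fun e he => ?_⟩
  · obtain ⟨k, hk⟩ := isPowTorsion_powTorsion (maximalIdeal R) I x.1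
    exact ⟨k, fun r hr => Subtype.ext (hk r hr)⟩
  · rw [← ht₀ r, ← Submodule.coe_eq_zero]; rfl
  · by_cases h : e = 0
    · exact ⟨0, by simp [h]⟩
    have hnd : ¬ Disjoint (R ∙ (e : T)) (R ∙ t₀) := by
      intro hd
      have := hess _ ((Submodule.span_singleton_le_iff_mem _ _).mpr e.2) hd
      rw [Submodule.span_singleton_eq_bot] at this
      exact h (Subtype.ext this)
    rw [Submodule.disjoint_def] at hnd
    push Not at hnd
    obtain ⟨x, hx1, hx2, hx0⟩ := hnd
    obtain ⟨r, rfl⟩ := Submodule.mem_span_singleton.mp hx1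
    obtain ⟨s, hs⟩ := Submodule.mem_span_singleton.mp hx2
    have hr : IsUnit r := by
      by_contra hr
      exact hx0 (congrArg Subtype.val (he r ((mem_maximalIdeal r).mpr hr)))
    obtain ⟨u, rfl⟩ := hr
    refine ⟨(↑u⁻¹ : R) * s, Subtype.ext ?_⟩
    change (e : T) = ((↑u⁻¹ : R) * s) • t₀
    rw [mul_smul, hs, smul_smul, Units.inv_mul, one_smul]

end Matlis

/-- The elements of `M` killed by the ideal `a`. -/
def killedBy {R : Type*} [CommRing R] (a : Ideal R) (M : Type*) [AddCommGroup M] [Module R M] :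
    Submodule R M where
  carrier := {x | ∀ r ∈ a, r • x = 0}
  zero_mem' r _ := smul_zero r
  add_mem' := by
    intro x y hx hy r hr
    rw [smul_add, hx r hr, hy r hr, add_zero]
  smul_mem' := by
    intro c x hx r hr
    rw [smul_comm, hx r hr, smul_zero]

section FlatTensor

variable {R : Type*} [CommRing R] {F M : Type*} [AddCommGroup F] [Module R F]
  [AddCommGroup M] [Module R M]

theorem piRight_lTensor_pi {ι : Type*} [Fintype ι] [DecidableEq ι] {N : Type*} [AddCommGroup N]
    [Module R N] (α : ι → M →ₗ[R] N) (w : F ⊗[R] M) (i : ι) :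
    TensorProduct.piRight R R F (fun _ : ι => N) (LinearMap.lTensor F (LinearMap.pi α) w) i =
      LinearMap.lTensor F (α i) w := by
  induction w with
  | zero => simp
  | tmul f m => simp
  | add x y hx hy => simp only [map_add, Pi.add_apply, hx, hy]

/-- The linear map `M^ι → M` given by a row of coefficients. -/
noncomputable def rowMap {ι : Type*} [Fintype ι] (c : ι → R) (M : Type*) [AddCommGroup M]
    [Module R M] : (ι → M) →ₗ[R] M :=
  ∑ i, c i • LinearMap.proj i

theorem rowMap_apply {ι : Type*} [Fintype ι] (c : ι → R) (x : ι → M) :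
    rowMap c M x = ∑ i, c i • x i := by
  simp [rowMap]

theorem lTensor_rowMap {ι : Type*} [Fintype ι] [DecidableEq ι] (c : ι → R) (w : F ⊗[R] (ι → M)) :
    LinearMap.lTensor F (rowMap c M) w =
      rowMap c (F ⊗[R] M) (TensorProduct.piRight R R F (fun _ : ι => M) w) := by
  induction w with
  | zero => simp
  | tmul f m => simp [rowMap_apply, TensorProduct.tmul_sum]
  | add x y hx hy => simp only [map_add, hx, hy]

theorem lTensor_smul_id_apply (r : R) (w : F ⊗[R] M) :
    LinearMap.lTensor F (r • (LinearMap.id : M →ₗ[R] M)) w = r • w := by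
  rw [LinearMap.lTensor_smul, LinearMap.lTensor_id]; rfl

/-- Over a noetherian ring, tensoring with a flat module commutes with `Hom(R/a, -)`. -/
theorem exists_lTensor_killedBy [IsNoetherianRing R] [Module.Flat R F] (a : Ideal R)
    (w : F ⊗[R] M) (hw : ∀ r ∈ a, r • w = 0) :
    ∃ w', LinearMap.lTensor F (killedBy a M).subtype w' = w := by
  obtain ⟨n, s, hs⟩ := Submodule.fg_iff_exists_fin_generating_family.mp
    (IsNoetherian.noetherian a)
  have hex : Function.Exact (killedBy a M).subtype
      (LinearMap.pi fun i : Fin n => s i • (LinearMap.id : M →ₗ[R] M)) := by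
    intro x
    constructor
    · intro hx
      refine ⟨⟨x, fun r hr => ?_⟩, rfl⟩
      rw [← hs] at hr
      induction hr using Submodule.span_induction with
      | mem r hr =>
        obtain ⟨i, rfl⟩ := hr
        exact congrFun hx i
      | zero => simp
      | add r t _ _ hr ht => rw [add_smul, hr, ht, add_zero]
      | smul c r _ hr => rw [smul_assoc, hr, smul_zero]
    · rintro ⟨⟨x, hx⟩, rfl⟩
      ext i
      exact hx _ (hs ▸ Submodule.subset_span ⟨i, rfl⟩)
  refine (Module.Flat.lTensor_exact F hex w).mp ?_
  apply (TensorProduct.piRight R R F (fun _ : Fin n => M)).injective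
  ext i
  rw [piRight_lTensor_pi, lTensor_smul_id_apply, map_zero]
  exact hw _ (hs ▸ Submodule.subset_span ⟨i, rfl⟩)

/-- Over a noetherian ring, flat tensor injective is injective. -/
theorem injective_flat_tensor {R F E : Type u} [CommRing R] [IsNoetherianRing R]
    [AddCommGroup F] [Module R F] [AddCommGroup E] [Module R E] [Module.Flat R F]
    [Module.Injective R E] : Module.Injective R (F ⊗[R] E) := by
  refine Module.Baer.injective fun a g => ?_
  obtain ⟨n, s, hs⟩ := Submodule.fg_iff_exists_fin_generating_family.mp
    (IsNoetherian.noetherian a)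
  let p : (Fin n → R) →ₗ[R] R := Fintype.linearCombination R s
  obtain ⟨q, ρ, hρ⟩ := Submodule.fg_iff_exists_fin_generating_family.mp
    (IsNoetherian.noetherian (LinearMap.ker p))
  have hρ0 : ∀ j, ∑ i, ρ j i • s i = 0 := fun j => by
    have : ρ j ∈ LinearMap.ker p := hρ ▸ Submodule.subset_span ⟨j, rfl⟩
    simpa [p, Fintype.linearCombination_apply] using this
  have hsa : ∀ i, s i ∈ a := fun i => hs ▸ Submodule.subset_span ⟨i, rfl⟩
  have hex : Function.Exact (LinearMap.pi fun i : Fin n => s i • (LinearMap.id : E →ₗ[R] E))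
      (LinearMap.pi fun j : Fin q => rowMap (ρ j) E) := by
    intro x
    constructor
    · intro hx
      let φ : (Fin n → R) →ₗ[R] E := Fintype.linearCombination R x
      have hker : LinearMap.ker p ≤ LinearMap.ker φ := by
        rw [← hρ, Submodule.span_le]
        rintro _ ⟨j, rfl⟩
        have := congrFun hx j
        simpa [φ, Fintype.linearCombination_apply, rowMap_apply] using this
      have hinj : Function.Injective ((LinearMap.ker p).liftQ p le_rfl) := by
        rw [← LinearMap.ker_eq_bot]
        exact Submodule.ker_liftQ_eq_bot _ _ _ le_rfl
      obtain ⟨h, hh⟩ := Module.Injective.out _ hinj ((LinearMap.ker p).liftQ φ hker)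
      refine ⟨h 1, funext fun i => ?_⟩
      have := hh (Submodule.Quotient.mk (Pi.single i 1))
      simp only [Submodule.liftQ_apply, p, φ, Fintype.linearCombination_apply_single,
        one_smul] at this
      simp [← this, ← map_smul]
    · rintro ⟨e, rfl⟩
      ext j
      simp only [LinearMap.pi_apply, rowMap_apply, LinearMap.smul_apply, LinearMap.id_apply,
        smul_smul, ← Finset.sum_smul, Pi.zero_apply]
      have := hρ0 j
      simp only [smul_eq_mul] at this
      rw [this, zero_smul]
  let w := (TensorProduct.piRight R R F (fun _ : Fin n => E)).symm fun i => g ⟨s i, hsa i⟩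
  obtain ⟨w₀, hw₀⟩ := (Module.Flat.lTensor_exact F hex w).mp (by
    apply (TensorProduct.piRight R R F (fun _ : Fin q => E)).injective
    ext j
    rw [piRight_lTensor_pi, lTensor_rowMap, LinearEquiv.apply_symm_apply, rowMap_apply, map_zero]
    simp only [← map_smul, ← map_sum, Pi.zero_apply]
    convert map_zero g
    rw [← Submodule.coe_eq_zero]
    simpa using hρ0 j)
  have hw1 : ∀ i, s i • w₀ = g ⟨s i, hsa i⟩ := fun i => by
    have := congrFun (congrArg (TensorProduct.piRight R R F (fun _ : Fin n => E)) hw₀) i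
    rwa [piRight_lTensor_pi, lTensor_smul_id_apply, LinearEquiv.apply_symm_apply] at this
  refine ⟨LinearMap.toSpanSingleton R _ w₀, ?_⟩
  have key : ∀ x ∈ Submodule.span R (Set.range s), ∀ hx' : x ∈ a, x • w₀ = g ⟨x, hx'⟩ := by
    intro x hx
    induction hx using Submodule.span_induction with
    | mem r hr =>
      obtain ⟨i, rfl⟩ := hr
      exact fun _ => hw1 i
    | zero => exact fun h => by rw [zero_smul]; exact (map_zero g).symm
    | add r t hr ht ihr iht =>
      intro h
      rw [add_smul, ihr (hs ▸ hr), iht (hs ▸ ht), ← map_add]; rfl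
    | smul c r hr ihr =>
      intro h
      rw [smul_assoc, ihr (hs ▸ hr), ← map_smul]; rfl
  exact fun x hx => key x (hs.symm ▸ hx) hx

/-- In a flat module, `y u ∈ J F` implies `u ∈ (J : y) F`. -/
theorem mem_colon_smul_of_flat [Module.Flat R F] (J : Ideal R) (y : R) (u : F)
    (h : y • u ∈ J • (⊤ : Submodule R F)) :
    u ∈ (Submodule.comap (LinearMap.mulLeft R y) J : Ideal R) • (⊤ : Submodule R F) := by
  let K : Ideal R := Submodule.comap (LinearMap.mulLeft R y) J
  have hex : Function.Exact (Submodule.subtype K) (Submodule.mkQ J ∘ₗ LinearMap.mulLeft R y) := by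
    intro x
    rw [Submodule.coe_subtype, Subtype.range_coe]
    exact Submodule.Quotient.mk_eq_zero J
  have hJ : LinearMap.lTensor F (Submodule.mkQ J) (LinearMap.lTensor F (LinearMap.mulLeft R y)
      (u ⊗ₜ (1 : R))) = 0 := by
    have hmem : ∀ v ∈ J • (⊤ : Submodule R F), v ⊗ₜ[R] (J.mkQ 1) = (0 : F ⊗[R] (R ⧸ J)) := by
      intro v hv
      induction hv using Submodule.smul_induction_on' with
      | smul r hr b hb =>
        rw [TensorProduct.smul_tmul, ← map_smul, smul_eq_mul, mul_one, Submodule.mkQ_apply,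
          (Submodule.Quotient.mk_eq_zero J).mpr hr, TensorProduct.tmul_zero]
      | add x _ y _ hx hy => rw [TensorProduct.add_tmul, hx, hy, add_zero]
    have h2 := hmem _ h
    rw [TensorProduct.smul_tmul, ← map_smul] at h2
    simpa using h2
  obtain ⟨w, hw⟩ := (Module.Flat.lTensor_exact F hex (u ⊗ₜ 1)).mp (by
    rw [LinearMap.lTensor_comp]; exact hJ)
  have hr : ∀ w : F ⊗[R] K, TensorProduct.rid R F (LinearMap.lTensor F (Submodule.subtype K) w) ∈
      K • (⊤ : Submodule R F) := by
    intro w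
    induction w with
    | zero => simp
    | tmul f k => simpa using Submodule.smul_mem_smul k.2 (Submodule.mem_top (x := f))
    | add x y hx hy => rw [map_add, map_add]; exact add_mem hx hy
  have := hr w
  rw [hw] at this
  simpa using this

end FlatTensor

section Matlis

variable {R : Type u} [CommRing R] [IsLocalRing R]
  {E : Type u} [AddCommGroup E] [Module R E] {F : Type u} [AddCommGroup F] [Module R F]

/-- `E` cogenerates the category of modules. -/
theorem IsMatlis.exists_apply_ne_zero (hE : IsMatlis R E) {X : Type u} [AddCommGroup X]
    [Module R X] {x : X} (hx : x ≠ 0) : ∃ φ : X →ₗ[R] E, φ x ≠ 0 := by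
  obtain ⟨e₀, he₀, -⟩ := hE.socle
  have := hE.injective
  have H : ∀ c : R, c • x = 0 → c • e₀ = 0 := by
    intro c hc
    rw [he₀]
    by_contra hu
    have : IsUnit c := by simpa using hu
    exact hx ((this.smul_eq_zero).mp hc)
  let p := LinearPMap.mkSpanSingleton' (σ := RingHom.id R) x e₀ H
  obtain ⟨φ, hφ⟩ := Module.Injective.out p.domain.subtype Subtype.val_injective p.toFun
  refine ⟨φ, ?_⟩
  have h1 : x ∈ p.domain := Submodule.mem_span_singleton_self x
  have h2 := hφ ⟨x, h1⟩
  have h3 : p.toFun ⟨x, h1⟩ = e₀ := by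
    have := LinearPMap.mkSpanSingleton'_apply_self (σ := RingHom.id R) x e₀ H h1
    exact this
  rw [h3] at h2
  intro h0
  have : (1 : R) ∈ maximalIdeal R := (he₀ 1).mp (by rw [one_smul, ← h2]; exact h0)
  exact (Ideal.ne_top_iff_one _).mp (maximalIdeal.isMaximal R).ne_top this

theorem IsMatlis.mem_of_forall_smul_eq_zero (hE : IsMatlis R E) (a : Ideal R) (r : R)
    (h : ∀ e ∈ killedBy a E, r • e = 0) : r ∈ a := by
  by_contra hr
  have : (Submodule.mkQ a r) ≠ 0 := fun h => hr ((Submodule.Quotient.mk_eq_zero a).mp h)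
  obtain ⟨φ, hφ⟩ := hE.exists_apply_ne_zero this
  apply hφ
  have h1 : a.mkQ r = r • a.mkQ 1 := by rw [← map_smul]; simp
  rw [h1, map_smul]
  apply h
  intro s hs
  rw [← map_smul, ← map_smul, smul_eq_mul, mul_one, Submodule.mkQ_apply,
    (Submodule.Quotient.mk_eq_zero a).mpr hs, map_zero]

variable [IsNoetherianRing R]

theorem isArtinian_quotient_maximalIdeal_pow (n : ℕ) :
    IsArtinian R (R ⧸ (maximalIdeal R ^ n)) := by
  by_cases hn : n = 0
  · subst hn
    rw [pow_zero, Ideal.one_eq_top]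
    have : Subsingleton (R ⧸ (⊤ : Ideal R)) := Ideal.Quotient.subsingleton_iff.mpr rfl
    infer_instance
  have : IsArtinianRing (R ⧸ (maximalIdeal R ^ n)) := by
    apply quotient_artinian_of_mem_minimalPrimes_of_isLocalRing
    refine ⟨⟨inferInstance, Ideal.pow_le_self hn⟩, fun p hp _ => ?_⟩
    have := hp.1
    exact this.le_of_pow_le hp.2
  exact isArtinian_of_surjective_algebraMap (Ideal.Quotient.mk_surjective (I := maximalIdeal R ^ n))

theorem IsMatlis.exists_finset (hE : IsMatlis R E) (n : ℕ) :
    ∃ s : Finset (killedBy (maximalIdeal R ^ n) E), ∀ r : R, (∀ e ∈ s, r • e = 0) →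
      r ∈ maximalIdeal R ^ n := by
  classical
  set a := maximalIdeal R ^ n
  have := isArtinian_quotient_maximalIdeal_pow (R := R) n
  let N : Finset (killedBy a E) → Submodule R (R ⧸ a) := fun s =>
    { carrier := {x | ∀ e ∈ s, ∃ r : R, a.mkQ r = x ∧ r • e = 0}
      zero_mem' := fun e _ => ⟨0, by simp⟩
      add_mem' := by
        intro x y hx hy e he
        obtain ⟨r, rfl, h1⟩ := hx e he
        obtain ⟨t, rfl, h2⟩ := hy e he
        exact ⟨r + t, by simp, by rw [add_smul, h1, h2, add_zero]⟩
      smul_mem' := by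
        intro c x hx e he
        obtain ⟨r, rfl, h1⟩ := hx e he
        exact ⟨c • r, map_smul _ _ _, by rw [smul_assoc, h1, smul_zero]⟩ }
  have hN : ∀ s r, a.mkQ r ∈ N s ↔ ∀ e ∈ s, r • e = 0 := by
    intro s r
    refine forall₂_congr fun e he => ⟨?_, fun h => ⟨r, rfl, h⟩⟩
    rintro ⟨t, ht, h⟩
    rw [Submodule.mkQ_apply, Submodule.mkQ_apply, Submodule.Quotient.eq] at ht
    have h2 : (t - r) • e = 0 := Subtype.ext (e.2 _ ht)
    rw [sub_smul, h, zero_sub, neg_eq_zero] at h2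
    exact h2
  obtain ⟨_, ⟨s, rfl⟩, hs⟩ := IsArtinian.set_has_minimal (Set.range N) ⟨_, ∅, rfl⟩
  refine ⟨s, fun r hr => hE.mem_of_forall_smul_eq_zero a r fun e he => ?_⟩
  have h1 : N (insert ⟨e, he⟩ s) = N s := by
    have h2 : N (insert ⟨e, he⟩ s) ≤ N s := fun x hx e' he' => hx e' (Finset.mem_insert_of_mem he')
    exact h2.eq_of_not_lt (hs _ ⟨_, rfl⟩)
  have h3 := (hN s r).mpr hr
  rw [← h1, hN] at h3
  exact congrArg Subtype.val (h3 ⟨e, he⟩ (Finset.mem_insert_self _ _))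

/-- An element of a flat module annihilated by tensoring with `E[mⁿ]` lies in `mⁿ F`. -/
theorem IsMatlis.mem_smul_of_tmul_eq_zero (hE : IsMatlis R E) [Module.Flat R F] (n : ℕ) (f : F)
    (h : ∀ e ∈ killedBy (maximalIdeal R ^ n) E, f ⊗ₜ[R] e = 0) :
    f ∈ maximalIdeal R ^ n • (⊤ : Submodule R F) := by
  classical
  set a := maximalIdeal R ^ n
  obtain ⟨s, hs⟩ := hE.exists_finset n
  have hex : Function.Exact (Submodule.subtype a)
      (LinearMap.pi fun e : s => LinearMap.toSpanSingleton R E e.1.1) := by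
    intro x
    constructor
    · intro hx
      have : x ∈ a := hs x fun e he => Subtype.ext (congrFun hx ⟨e, he⟩)
      exact ⟨⟨x, this⟩, rfl⟩
    · rintro ⟨⟨x, hx⟩, rfl⟩
      ext e
      exact e.1.2 x hx
  obtain ⟨w, hw⟩ := (Module.Flat.lTensor_exact F hex (f ⊗ₜ 1)).mp (by
    apply (TensorProduct.piRight R R F (fun _ : s => E)).injective
    ext e
    rw [piRight_lTensor_pi]
    simpa using h e.1.1 e.1.2)
  have hr : ∀ w : F ⊗[R] a, TensorProduct.rid R F (LinearMap.lTensor F (Submodule.subtype a) w) ∈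
      a • (⊤ : Submodule R F) := by
    intro w
    induction w with
    | zero => simp
    | tmul f k => simpa using Submodule.smul_mem_smul k.2 (Submodule.mem_top (x := f))
    | add x y hx hy => rw [map_add, map_add]; exact add_mem hx hy
  have := hr w
  rw [hw] at this
  simpa using this

/-- The socle of `F ⊗ E` for flat `F`. -/
theorem IsMatlis.exists_eq_tmul_of_socle {e₀ : E}
    (he : ∀ e : E, (∀ r ∈ maximalIdeal R, r • e = 0) → ∃ r : R, e = r • e₀)
    [Module.Flat R F] (w : F ⊗[R] E)
    (hw : ∀ r ∈ maximalIdeal R, r • w = 0) : ∃ f : F, w = f ⊗ₜ e₀ := by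
  obtain ⟨w', rfl⟩ := exists_lTensor_killedBy _ w hw
  clear hw
  induction w' with
  | zero => exact ⟨0, by simp⟩
  | tmul f e =>
    obtain ⟨r, hr⟩ := he e.1 e.2
    exact ⟨r • f, by simp [hr, TensorProduct.smul_tmul]⟩
  | add x y hx hy =>
    obtain ⟨f, hf⟩ := hx
    obtain ⟨g, hg⟩ := hy
    exact ⟨f + g, by rw [map_add, hf, hg, TensorProduct.add_tmul]⟩

/-- Every map `E[mⁿ] → F ⊗ E` with `F` flat is tensoring with an element of `F`. -/
theorem IsMatlis.exists_eq_tmul (hE : IsMatlis R E) [Module.Flat R F] (n : ℕ)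
    (φ : killedBy (maximalIdeal R ^ n) E →ₗ[R] F ⊗[R] E) :
    ∃ f : F, ∀ e, φ e = f ⊗ₜ (e : E) := by
  classical
  have := hE.injective
  obtain ⟨e₀, he₀, he⟩ := hE.socle
  induction n with
  | zero =>
    refine ⟨0, fun e => ?_⟩
    have : e = 0 := Subtype.ext (by simpa using e.2 1 (by simp))
    simp [this]
  | succ n ih =>
    have hle : killedBy (maximalIdeal R ^ n) E ≤ killedBy (maximalIdeal R ^ (n + 1)) E :=
      fun x hx r hr => hx r (Ideal.pow_le_pow_right (Nat.le_succ n) hr)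
    obtain ⟨f, hf⟩ := ih (φ ∘ₗ Submodule.inclusion hle)
    let φ' : killedBy (maximalIdeal R ^ (n + 1)) E →ₗ[R] F ⊗[R] E :=
      φ - TensorProduct.mk R F E f ∘ₗ (killedBy (maximalIdeal R ^ (n + 1)) E).subtype
    have hφ' : ∀ e : killedBy (maximalIdeal R ^ (n + 1)) E,
        (e : E) ∈ killedBy (maximalIdeal R ^ n) E → φ' e = 0 := by
      intro e he
      have := hf ⟨e, he⟩
      simp only [LinearMap.comp_apply] at this
      have h2 : Submodule.inclusion hle ⟨e, he⟩ = e := rfl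
      rw [h2] at this
      simp [φ', this]
    obtain ⟨t, r, hr⟩ := Submodule.fg_iff_exists_fin_generating_family.mp
      (IsNoetherian.noetherian (maximalIdeal R ^ n))
    have hrm : ∀ a, r a ∈ maximalIdeal R ^ n := fun a => hr ▸ Submodule.subset_span ⟨a, rfl⟩
    let θ : killedBy (maximalIdeal R ^ (n + 1)) E →ₗ[R] (Fin t → E) :=
      LinearMap.pi fun a => r a • (killedBy (maximalIdeal R ^ (n + 1)) E).subtype
    have hθ : LinearMap.ker θ ≤ LinearMap.ker φ' := by
      intro e h
      apply hφ'
      intro s hs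
      rw [← hr] at hs
      induction hs using Submodule.span_induction with
      | mem s hs =>
        obtain ⟨a, rfl⟩ := hs
        exact congrFun h a
      | zero => simp
      | add x y _ _ hx hy => rw [add_smul, hx, hy, add_zero]
      | smul c x _ hx => rw [smul_assoc, hx, smul_zero]
    have hinj : Function.Injective ((LinearMap.ker θ).liftQ θ le_rfl) := by
      rw [← LinearMap.ker_eq_bot]
      exact Submodule.ker_liftQ_eq_bot _ _ _ le_rfl
    have hI : Module.Injective R (F ⊗[R] E) := injective_flat_tensor
    obtain ⟨ψ, hψ⟩ := Module.Injective.out _ hinj ((LinearMap.ker θ).liftQ φ' hθ)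
    have hψ' : ∀ e, ψ (θ e) = φ' e := fun e => by
      simpa using hψ (Submodule.Quotient.mk e)
    have hfa : ∀ a, ∃ fa : F, ψ (Pi.single a e₀) = fa ⊗ₜ e₀ := by
      intro a
      refine IsMatlis.exists_eq_tmul_of_socle he _ fun s hs => ?_
      rw [← map_smul, ← Pi.single_smul, (he₀ s).mpr hs, Pi.single_zero, map_zero]
    choose fa hfa using hfa
    refine ⟨f + ∑ a, r a • fa a, fun e => ?_⟩
    have h1 : φ e = f ⊗ₜ (e : E) + φ' e := by simp [φ']
    rw [h1, TensorProduct.add_tmul, add_right_inj, ← hψ' e]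
    have h2 : ∀ a, ∃ c : R, r a • (e : E) = c • e₀ := by
      intro a
      refine he _ fun s hs => ?_
      rw [smul_smul]
      refine e.2 _ ?_
      rw [pow_succ']
      exact Ideal.mul_mem_mul hs (hrm a)
    choose c hc using h2
    have h3 : θ e = ∑ a, Pi.single a (c a • e₀) := by
      rw [Finset.univ_sum_single]
      ext a
      simp [θ, hc]
    rw [h3, map_sum, TensorProduct.sum_tmul]
    refine Finset.sum_congr rfl fun a _ => ?_
    rw [Pi.single_smul, map_smul, hfa, ← TensorProduct.tmul_smul, ← hc, TensorProduct.smul_tmul]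

/-- If `F` is flat and `m`-adically complete, then `F ≃ Hom(E, F ⊗ E)`. -/
theorem IsMatlis.bijective_mk (hE : IsMatlis R E) [Module.Flat R F]
    [IsAdicComplete (maximalIdeal R) F] :
    Function.Bijective (TensorProduct.mk R F E) := by
  constructor
  · rw [injective_iff_map_eq_zero]
    intro f hf
    refine IsHausdorff.haus (I := maximalIdeal R) inferInstance f fun n => ?_
    rw [SModEq.zero]
    exact hE.mem_smul_of_tmul_eq_zero n f fun e _ => LinearMap.congr_fun hf e
  · intro φ
    choose f hf using fun n =>
      hE.exists_eq_tmul n (φ ∘ₗ (killedBy (maximalIdeal R ^ n) E).subtype)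
    have hk : ∀ n (e : E), e ∈ killedBy (maximalIdeal R ^ n) E →
        ∀ v ∈ maximalIdeal R ^ n • (⊤ : Submodule R F), v ⊗ₜ[R] e = 0 := by
      intro n e he v hv
      induction hv using Submodule.smul_induction_on' with
      | smul r hr b hb => rw [TensorProduct.smul_tmul, he r hr, TensorProduct.tmul_zero]
      | add x _ y _ hx hy => rw [TensorProduct.add_tmul, hx, hy, add_zero]
    obtain ⟨L, hL⟩ := IsPrecomplete.prec (I := maximalIdeal R) inferInstance (f := f) (by
      intro a b hab
      rw [SModEq.sub_mem]
      refine hE.mem_smul_of_tmul_eq_zero a _ fun e he => ?_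
      have h1 := hf a ⟨e, he⟩
      have h2 := hf b ⟨e, fun r hr => he r (Ideal.pow_le_pow_right hab hr)⟩
      rw [TensorProduct.sub_tmul, sub_eq_zero]
      exact h1.symm.trans h2)
    refine ⟨L, LinearMap.ext fun e => ?_⟩
    obtain ⟨n, hn⟩ := hE.torsion e
    have h1 := hf n ⟨e, hn⟩
    have h2 := hk n e hn _ (SModEq.sub_mem.mp (hL n))
    rw [TensorProduct.sub_tmul, sub_eq_zero] at h2
    exact h2.symm.trans h1.symm

end Matlis

section Cores

variable (R : Type u) [CommRing R] (E : Type u) [AddCommGroup E] [Module R E]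

/-- A class of modules in which every member embeds in a flat module with cokernel in the class
and with the embedding preserved by `- ⊗ E`. -/
structure IsCoresClass (𝒞 : (X : Type u) → [AddCommGroup X] → [Module R X] → Prop) : Prop where
  step : ∀ (X : Type u) [AddCommGroup X] [Module R X], 𝒞 X →
    ∃ (F X' : Type u) (_ : AddCommGroup F) (_ : Module R F) (_ : AddCommGroup X')
      (_ : Module R X') (f : X →ₗ[R] F) (g : F →ₗ[R] X'), Module.Flat R F ∧ 𝒞 X' ∧ IsSES f g ∧
      Function.Injective (LinearMap.rTensor E f)

/-- `X` has a right resolution by flat modules which stays exact after `- ⊗ E`. -/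
def Cores (X : Type u) [AddCommGroup X] [Module R X] : Prop :=
  ∃ 𝒞 : (X : Type u) → [AddCommGroup X] → [Module R X] → Prop, IsCoresClass R E 𝒞 ∧ 𝒞 X

variable {R E} {X Y F : Type u} [AddCommGroup X] [Module R X] [AddCommGroup Y] [Module R Y]
  [AddCommGroup F] [Module R F]

theorem Cores.of_isSES {f : Y →ₗ[R] F} {g : F →ₗ[R] X} (h : IsSES f g) [Module.Flat R F]
    (hf : Function.Injective (LinearMap.rTensor E f)) (hX : Cores R E X) : Cores R E Y := by
  obtain ⟨𝒞, h𝒞, hX⟩ := hX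
  refine ⟨fun Z _ _ => 𝒞 Z ∨ ∃ (F X' : Type u) (_ : AddCommGroup F) (_ : Module R F)
      (_ : AddCommGroup X') (_ : Module R X') (f : Z →ₗ[R] F) (g : F →ₗ[R] X'),
      Module.Flat R F ∧ 𝒞 X' ∧ IsSES f g ∧ Function.Injective (LinearMap.rTensor E f),
    ⟨fun Z _ _ hZ => ?_⟩, Or.inr ⟨F, X, _, _, _, _, f, g, inferInstance, hX, h, hf⟩⟩
  obtain ⟨F, X', _, _, _, _, f, g, h1, h2, h3, h4⟩ := hZ.elim (h𝒞.step Z) id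
  exact ⟨F, X', _, _, _, _, f, g, h1, Or.inl h2, h3, h4⟩

theorem IsSES.rTensor {Z : Type u} [AddCommGroup Z] [Module R Z] {f : X →ₗ[R] Y} {g : Y →ₗ[R] Z}
    (h : IsSES f g) (hf : Function.Injective (f.rTensor E)) : IsSES (f.rTensor E) (g.rTensor E) :=
  ⟨hf, LinearMap.rTensor_surjective E h.surj, rTensor_exact E h.exact h.surj⟩

attribute [local instance] GorensteinFlatWitness.instAdd GorensteinFlatWitness.instMod

theorem GorensteinFlatWitness.isSES (w : GorensteinFlatWitness R X) (i : ℤ) :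
    IsSES (LinearMap.range (w.d (i + 1))).subtype (w.d i).rangeRestrict := by
  refine ⟨Subtype.val_injective, LinearMap.surjective_rangeRestrict _, fun y => ?_⟩
  rw [← Submodule.coe_eq_zero]
  refine (w.exact i y).trans ⟨?_, ?_⟩
  · rintro ⟨z, rfl⟩
    exact ⟨⟨_, z, rfl⟩, rfl⟩
  · rintro ⟨z, rfl⟩
    exact z.2

theorem GorensteinFlatWitness.rTensor_injective (hE : Module.Injective R E)
    (w : GorensteinFlatWitness R X) (i : ℤ) :
    Function.Injective ((LinearMap.range (w.d (i + 1))).subtype.rTensor E) := by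
  rw [injective_iff_map_eq_zero]
  intro y hy
  obtain ⟨z, rfl⟩ := LinearMap.rTensor_surjective E
    (LinearMap.surjective_rangeRestrict (w.d (i + 1))) y
  rw [← LinearMap.comp_apply, ← LinearMap.rTensor_comp, LinearMap.subtype_comp_codRestrict,
    ← LinearMap.comm_comp_lTensor_comp_comm_eq] at hy
  have hy' : LinearMap.lTensor E (w.d (i + 1)) (TensorProduct.comm R _ _ z) = 0 := by
    simpa using hy
  obtain ⟨z', hz'⟩ := (w.exact_tensor E hE (i + 1) _).mp hy'
  have hz : z = LinearMap.rTensor E (w.d (i + 1 + 1)) (TensorProduct.comm R _ _ z') := by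
    apply (TensorProduct.comm R _ _).injective
    rw [← hz', ← LinearMap.comm_comp_lTensor_comp_comm_eq]
    simp
  rw [hz, ← LinearMap.comp_apply, ← LinearMap.rTensor_comp]
  have : (w.d (i + 1)).rangeRestrict ∘ₗ w.d (i + 1 + 1) = 0 := by
    ext x
    exact (w.exact (i + 1)).apply_apply_eq_zero x
  rw [this]
  simp

theorem IsGorensteinFlat.cores (hE : Module.Injective R E) (hX : IsGorensteinFlat R X) :
    Cores R E X := by
  obtain ⟨w⟩ := hX
  refine ⟨fun Z _ _ => ∃ i, Nonempty (Z ≃ₗ[R] LinearMap.range (w.d i)), ⟨fun Z _ _ hZ => ?_⟩,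
    0, w.iso⟩
  obtain ⟨i, ⟨e⟩⟩ := hZ
  obtain ⟨i, rfl⟩ : ∃ j, i = j + 1 := ⟨i - 1, by ring⟩
  refine ⟨w.F (i + 1), LinearMap.range (w.d i), inferInstance, inferInstance, inferInstance,
    inferInstance, (LinearMap.range (w.d (i + 1))).subtype ∘ₗ e.toLinearMap,
    (w.d i).rangeRestrict, w.flat _, ⟨i, ⟨LinearEquiv.refl _ _⟩⟩,
    ⟨Subtype.val_injective.comp e.injective, (w.isSES i).surj, ?_⟩, ?_⟩
  · exact (Function.Surjective.comp_exact_iff_exact e.surjective).mpr (w.isSES i).exact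
  · rw [LinearMap.rTensor_comp, LinearMap.coe_comp]
    exact (w.rTensor_injective hE i).comp (LinearEquiv.rTensor E e).injective

/-- A uniform Artin–Rees property for the embeddings of a class of modules closed under
cosyzygies. -/
theorem IsCoresClass.artinRees [IsNoetherianRing R]
    {𝒞 : (X : Type u) → [AddCommGroup X] → [Module R X] → Prop} (h𝒞 : IsCoresClass R E 𝒞)
    (a : Ideal R) (n : ℕ) :
    ∃ n' : ℕ, ∀ (X F X' : Type u) [AddCommGroup X] [Module R X] [AddCommGroup F] [Module R F]
      [AddCommGroup X'] [Module R X'] (f : X →ₗ[R] F) (g : F →ₗ[R] X'), IsSES f g → 𝒞 X' →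
      ∀ x, f x ∈ a ^ n' • (⊤ : Submodule R F) → x ∈ a ^ n • (⊤ : Submodule R X) := by
  classical
  obtain ⟨s, rfl⟩ := IsNoetherian.noetherian a
  change ∃ n' : ℕ, ∀ (X F X' : Type u) [AddCommGroup X] [Module R X] [AddCommGroup F] [Module R F]
      [AddCommGroup X'] [Module R X'] (f : X →ₗ[R] F) (g : F →ₗ[R] X'), IsSES f g → 𝒞 X' →
      ∀ x, f x ∈ Ideal.span (s : Set R) ^ n' • (⊤ : Submodule R F) →
        x ∈ Ideal.span (s : Set R) ^ n • (⊤ : Submodule R X)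
  induction s using Finset.induction generalizing n with
  | empty =>
    refine ⟨1, fun X F X' _ _ _ _ _ _ f g h _ x hx => ?_⟩
    have : f x = 0 := by simpa using hx
    rw [(map_eq_zero_iff f h.inj).mp this]
    exact zero_mem _
  | insert x₀ s _ ih =>
    set b := Ideal.span (s : Set R)
    have ha : Ideal.span ((insert x₀ s : Finset R) : Set R) = b ⊔ Ideal.span {x₀} := by
      rw [Finset.coe_insert, Ideal.span_insert, sup_comm]
    rw [ha]
    set a := b ⊔ Ideal.span {x₀}
    have hxa : ∀ k, x₀ ^ k ∈ a ^ k := fun k =>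
      Ideal.pow_mem_pow (Ideal.mem_sup_right (Ideal.mem_span_singleton_self x₀)) k
    obtain ⟨p', hp'⟩ := ih n
    obtain ⟨p'', hp''⟩ := ih p'
    let p := max p' p''
    let chain : ℕ →o Ideal R :=
      { toFun := fun j => Submodule.comap (LinearMap.mulLeft R (x₀ ^ j)) (b ^ p)
        monotone' := by
          intro i j hij r hr
          obtain ⟨k, rfl⟩ := Nat.exists_eq_add_of_le hij
          simp only [Submodule.mem_comap, LinearMap.mulLeft_apply] at hr ⊢
          rw [pow_add, mul_comm (x₀ ^ i), mul_assoc]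
          exact Ideal.mul_mem_left _ _ hr }
    obtain ⟨N, hN⟩ := monotone_stabilizes_iff_noetherian.mpr ‹IsNoetherianRing R› chain
    refine ⟨p + (N + n), fun X F X' _ _ _ _ _ _ f g h hX' x hx => ?_⟩
    obtain ⟨F', X'', _, _, _, _, f', g', _, hX'', h', -⟩ := h𝒞.step X' hX'
    have hx1 : f x ∈ (b ^ p ⊔ Ideal.span {x₀} ^ (N + n)) • (⊤ : Submodule R F) :=
      Submodule.smul_mono_left Ideal.sup_pow_add_le_pow_sup_pow hx
    rw [Submodule.sup_smul, Ideal.span_singleton_pow, Submodule.ideal_span_singleton_smul] at hx1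
    obtain ⟨β, hβ, γ, hγ, hsum⟩ := Submodule.mem_sup.mp hx1
    obtain ⟨w, -, rfl⟩ := (Submodule.mem_smul_pointwise_iff_exists _ _ _).mp hγ
    have hmap : ∀ {Y Z : Type u} [AddCommGroup Y] [Module R Y] [AddCommGroup Z] [Module R Z]
        (l : Y →ₗ[R] Z) (c : Ideal R) (y : Y), y ∈ c • (⊤ : Submodule R Y) →
        l y ∈ c • (⊤ : Submodule R Z) := by
      intro Y Z _ _ _ _ l c y hy
      have := Submodule.mem_map_of_mem (f := l) hy
      rw [Submodule.map_smul''] at this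
      exact (smul_mono_right c le_top : _ ≤ c • (⊤ : Submodule R Z)) this
    have h1 : x₀ ^ (N + n) • f' (g w) ∈ b ^ p • (⊤ : Submodule R F') := by
      have : x₀ ^ (N + n) • g w = - g β := by
        rw [← map_smul, eq_neg_iff_add_eq_zero, add_comm, ← map_add, hsum, h.apply_apply]
      rw [← map_smul, this]
      exact hmap f' _ _ (neg_mem (hmap g _ _ hβ))
    have h2 : f' (x₀ ^ N • g w) ∈ b ^ p'' • (⊤ : Submodule R F') := by
      have h3 := mem_colon_smul_of_flat _ _ _ h1
      have h4 : Submodule.comap (LinearMap.mulLeft R (x₀ ^ (N + n))) (b ^ p) =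
        Submodule.comap (LinearMap.mulLeft R (x₀ ^ N)) (b ^ p) := (hN _ (Nat.le_add_right N n)).symm
      rw [h4] at h3
      rw [map_smul]
      refine Submodule.smul_mono_left (Ideal.pow_le_pow_right (le_max_right p' p'')) ?_
      change x₀ ^ N • f' (g w) ∈ b ^ p • (⊤ : Submodule R F')
      generalize f' (g w) = v at h3
      induction h3 using Submodule.smul_induction_on' with
      | smul r hr y hy =>
        rw [smul_smul]
        exact Submodule.smul_mem_smul hr hy
      | add y _ z _ hy hz => rw [smul_add]; exact add_mem hy hz
    have h3 := hp'' _ _ _ f' g' h' hX'' _ h2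
    have h4 : ∃ β' ∈ b ^ p' • (⊤ : Submodule R F), g β' = x₀ ^ N • g w := by
      have : (b ^ p' • (⊤ : Submodule R X')) = (b ^ p' • (⊤ : Submodule R F)).map g := by
        rw [Submodule.map_smul'', Submodule.map_top, LinearMap.range_eq_top.mpr h.surj]
      rw [this] at h3
      exact h3
    obtain ⟨β', hβ', hgβ'⟩ := h4
    obtain ⟨v, hv⟩ := (h.exact (x₀ ^ N • w - β')).mp (by rw [map_sub, map_smul, hgβ', sub_self])
    have h5 : f (x - x₀ ^ n • v) = β + x₀ ^ n • β' := by
      rw [map_sub, map_smul, hv, ← hsum, smul_sub, smul_smul, ← pow_add, add_comm n N]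
      abel
    have h6 : x - x₀ ^ n • v ∈ b ^ n • (⊤ : Submodule R X) := by
      refine hp' _ _ _ f g h hX' _ ?_
      rw [h5]
      exact add_mem (Submodule.smul_mono_left (Ideal.pow_le_pow_right (le_max_left p' p'')) hβ)
        (Submodule.smul_mem _ _ hβ')
    rw [← sub_add_cancel x (x₀ ^ n • v)]
    exact add_mem (Submodule.smul_mono_left (Ideal.pow_right_mono le_sup_left n) h6)
      (Submodule.smul_mem_smul (hxa n) Submodule.mem_top)

end Cores

section Lifting

variable {R : Type u} [CommRing R]
  {E : Type u} [AddCommGroup E] [Module R E]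

theorem tmul_eq_zero_of_mem_smul {a : Ideal R} {X : Type u} [AddCommGroup X] [Module R X]
    {x : X} (hx : x ∈ a • (⊤ : Submodule R X)) {e : E} (he : e ∈ killedBy a E) :
    x ⊗ₜ[R] e = 0 := by
  induction hx using Submodule.smul_induction_on' with
  | smul r hr b hb => rw [TensorProduct.smul_tmul, he r hr, TensorProduct.tmul_zero]
  | add x _ y _ hx hy => rw [TensorProduct.add_tmul, hx, hy, add_zero]

theorem killedBy_pow_mono {a : Ideal R} {i j : ℕ} (h : i ≤ j) :
    killedBy (a ^ i) E ≤ killedBy (a ^ j) E :=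
  fun _ hx r hr => hx r (Ideal.pow_le_pow_right h hr)

variable [IsLocalRing R] [IsNoetherianRing R]

/-- Maps `E → X ⊗ E` are locally given by elements of `X`. -/
theorem IsCoresClass.exists_approx (hE : IsMatlis R E)
    {𝒞 : (X : Type u) → [AddCommGroup X] → [Module R X] → Prop} (h𝒞 : IsCoresClass R E 𝒞)
    {X : Type u} [AddCommGroup X] [Module R X] (hX : 𝒞 X) (φ : E →ₗ[R] X ⊗[R] E) (k : ℕ) :
    ∃ x : X, ∀ e ∈ killedBy (maximalIdeal R ^ k) E, φ e = x ⊗ₜ e := by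
  obtain ⟨F, X', _, _, _, _, f, g, _, hX', h, hf⟩ := h𝒞.step X hX
  obtain ⟨F', X'', _, _, _, _, f', g', _, hX'', h', -⟩ := h𝒞.step X' hX'
  obtain ⟨n, hn⟩ := h𝒞.artinRees (maximalIdeal R) k
  let p := max n k
  obtain ⟨y, hy⟩ := hE.exists_eq_tmul p
    ((f.rTensor E ∘ₗ φ) ∘ₗ (killedBy (maximalIdeal R ^ p) E).subtype)
  have hy' : ∀ e ∈ killedBy (maximalIdeal R ^ p) E, f.rTensor E (φ e) = y ⊗ₜ e :=
    fun e he => hy ⟨e, he⟩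
  have h1 : f' (g y) ∈ maximalIdeal R ^ n • (⊤ : Submodule R F') := by
    refine hE.mem_smul_of_tmul_eq_zero n _ fun e he => ?_
    have h2 := hy' e (killedBy_pow_mono (le_max_left n k) he)
    have h3 := congrArg (f'.rTensor E) (congrArg (g.rTensor E) h2)
    rw [← LinearMap.comp_apply (LinearMap.rTensor E g), ← LinearMap.rTensor_comp,
      h.comp_eq_zero] at h3
    simpa using h3.symm
  have h2 := hn _ _ _ f' g' h' hX'' _ h1
  have : (maximalIdeal R ^ k • (⊤ : Submodule R X')) =
      (maximalIdeal R ^ k • (⊤ : Submodule R F)).map g := by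
    rw [Submodule.map_smul'', Submodule.map_top, LinearMap.range_eq_top.mpr h.surj]
  rw [this] at h2
  obtain ⟨β, hβ, hgβ⟩ := h2
  obtain ⟨x, hx⟩ := (h.exact (y - β)).mp (by rw [map_sub, hgβ, sub_self])
  refine ⟨x, fun e he => hf ?_⟩
  rw [hy' e (killedBy_pow_mono (le_max_right n k) he), LinearMap.rTensor_tmul, hx,
    TensorProduct.sub_tmul, tmul_eq_zero_of_mem_smul hβ he, sub_zero]

theorem IsCoresClass.exists_lift (hE : IsMatlis R E)
    {𝒞 : (X : Type u) → [AddCommGroup X] → [Module R X] → Prop} (h𝒞 : IsCoresClass R E 𝒞)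
    {X F₀ : Type u} [AddCommGroup X] [Module R X] [AddCommGroup F₀] [Module R F₀] (hX : 𝒞 X)
    {h : F₀ →ₗ[R] X} (hh : Function.Surjective h) (φ : E →ₗ[R] X ⊗[R] E) :
    ∃ ψ : E →ₗ[R] F₀ ⊗[R] E, h.rTensor E ∘ₗ ψ = φ := by
  obtain ⟨F, X', _, _, _, _, f, g, _, hX', hfg, hf⟩ := h𝒞.step X hX
  choose x hx using h𝒞.exists_approx hE hX φ
  choose n hn using h𝒞.artinRees (maximalIdeal R)
  let N : ℕ → ℕ := fun j => j + ∑ i ∈ Finset.range (j + 1), n i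
  have hNn : ∀ j, n j ≤ N j := fun j =>
    (Finset.single_le_sum (f := n) (fun _ _ => Nat.zero_le _)
      (Finset.self_mem_range_succ j)).trans (Nat.le_add_left _ _)
  have hNj : ∀ j, j ≤ N j := fun j => Nat.le_add_right _ _
  have hNs : ∀ j, N j ≤ N (j + 1) := fun j => by
    simp only [N]
    rw [Finset.sum_range_succ _ (j + 1)]
    omega
  have hd : ∀ j, x (N (j + 1)) - x (N j) ∈ maximalIdeal R ^ j • (⊤ : Submodule R X) := by
    intro j
    refine hn j _ _ _ f g hfg hX' _ ?_
    refine hE.mem_smul_of_tmul_eq_zero (n j) _ fun e he => ?_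
    have he1 := killedBy_pow_mono (hNn j) he
    have h1 := hx (N j) e he1
    have h2 := hx (N (j + 1)) e (killedBy_pow_mono (hNs j) he1)
    have h3 : (x (N (j + 1)) - x (N j)) ⊗ₜ[R] e = 0 := by
      rw [TensorProduct.sub_tmul, ← h1, ← h2, sub_self]
    simpa using congrArg (f.rTensor E) h3
  have hmap : ∀ k, (maximalIdeal R ^ k • (⊤ : Submodule R X)) =
      (maximalIdeal R ^ k • (⊤ : Submodule R F₀)).map h := fun k => by
    rw [Submodule.map_smul'', Submodule.map_top, LinearMap.range_eq_top.mpr hh]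
  have hd' : ∀ j, ∃ d ∈ maximalIdeal R ^ j • (⊤ : Submodule R F₀),
      h d = x (N (j + 1)) - x (N j) := fun j => by
    have := hd j
    rw [hmap] at this
    exact this
  choose d hdm hdh using hd'
  obtain ⟨z₀, hz₀⟩ := hh (x (N 0))
  let z : ℕ → F₀ := fun j => z₀ + ∑ i ∈ Finset.range j, d i
  have hz : ∀ j, h (z j) = x (N j) := by
    intro j
    induction j with
    | zero => simpa [z] using hz₀
    | succ j ih =>
      have : z (j + 1) = z j + d j := by simp only [z, Finset.sum_range_succ, add_assoc]
      rw [this, map_add, ih, hdh]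
      abel
  have hstab : ∀ j l, j ≤ l → ∀ e ∈ killedBy (maximalIdeal R ^ j) E,
      z l ⊗ₜ[R] e = z j ⊗ₜ[R] e := by
    intro j l hjl e he
    induction l, hjl using Nat.le_induction with
    | base => rfl
    | succ l hl ih =>
      have : z (l + 1) = z l + d l := by simp only [z, Finset.sum_range_succ, add_assoc]
      rw [this, TensorProduct.add_tmul, ih,
        tmul_eq_zero_of_mem_smul (hdm l) (killedBy_pow_mono hl he), add_zero]
  choose k hk using hE.torsion
  have hval : ∀ e j, e ∈ killedBy (maximalIdeal R ^ j) E → z (k e) ⊗ₜ[R] e = z j ⊗ₜ e := by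
    intro e j he
    rcases le_total j (k e) with h1 | h1
    · exact hstab j _ h1 e he
    · exact (hstab (k e) j h1 e (hk e)).symm
  refine ⟨⟨⟨fun e => z (k e) ⊗ₜ e, fun e e' => ?_⟩, fun c e => ?_⟩, LinearMap.ext fun e => ?_⟩
  · have h1 : e ∈ killedBy (maximalIdeal R ^ (max (k e) (k e'))) E :=
      killedBy_pow_mono (le_max_left _ _) (hk e)
    have h2 : e' ∈ killedBy (maximalIdeal R ^ (max (k e) (k e'))) E :=
      killedBy_pow_mono (le_max_right _ _) (hk e')
    rw [hval _ _ (add_mem h1 h2), hval _ _ h1, hval _ _ h2, TensorProduct.tmul_add]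
  · have h1 : e ∈ killedBy (maximalIdeal R ^ (k e)) E := hk e
    change z (k (c • e)) ⊗ₜ[R] (c • e) = c • (z (k e) ⊗ₜ[R] e)
    rw [hval _ _ (Submodule.smul_mem _ c h1), TensorProduct.tmul_smul]
  · change h.rTensor E (z (k e) ⊗ₜ e) = φ e
    rw [LinearMap.rTensor_tmul, hz]
    exact (hx _ e (killedBy_pow_mono (hNj _) (hk e))).symm

theorem Cores.extVan (hE : IsMatlis R E) {X : Type u} [AddCommGroup X] [Module R X]
    (hX : Cores R E X) (j : ℕ) : ExtVan R (j + 1) E (X ⊗[R] E) := by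
  obtain ⟨𝒞, h𝒞, hX⟩ := hX
  have := hE.injective
  induction j generalizing X with
  | zero =>
    obtain ⟨F, X', _, _, _, _, f, g, _, hX', h, hf⟩ := h𝒞.step X hX
    have : Module.Injective R (F ⊗[R] E) := injective_flat_tensor
    exact (h.rTensor hf).ext_one_of_lift (extVan_of_injective 0) fun φ =>
      h𝒞.exists_lift hE hX' h.surj φ
  | succ j ih =>
    obtain ⟨F, X', _, _, _, _, f, g, _, hX', h, hf⟩ := h𝒞.step X hX
    have : Module.Injective R (F ⊗[R] E) := injective_flat_tensor
    exact (h.rTensor hf).ext_sub_right (ih hX') (extVan_of_injective _)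

end Lifting

section TorVanishing

variable {R : Type u} [CommRing R] {E : Type u} [AddCommGroup E] [Module R E]
  {X Y Z F : Type u} [AddCommGroup X] [Module R X] [AddCommGroup Y] [Module R Y]
  [AddCommGroup Z] [Module R Z] [AddCommGroup F] [Module R F]

theorem IsSES.rTensor_injective_of_ext {f : X →ₗ[R] Y} {g : Y →ₗ[R] Z} (h : IsSES f g)
    (hZ : ExtVan R 1 Z (CharacterModule E)) : Function.Injective (f.rTensor E) :=
  rTensor_injective_iff_lcomp_surjective.mpr fun φ => h.exists_extend hZ φ

theorem IsSES.ext_one_characterModule {f : X →ₗ[R] Y} {g : Y →ₗ[R] Z} (h : IsSES f g)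
    (hY : ExtVan R 1 Y (CharacterModule E)) (hf : Function.Injective (f.rTensor E)) :
    ExtVan R 1 Z (CharacterModule E) :=
  h.ext_one_of_extend hY fun φ => rTensor_injective_iff_lcomp_surjective.mp hf φ

theorem IsSES.rTensor_injective_of_flat {f : X →ₗ[R] Y} {g : Y →ₗ[R] Z} (h : IsSES f g)
    [Module.Flat R Z] : Function.Injective (f.rTensor E) := by
  rw [← LinearMap.lTensor_inj_iff_rTensor_inj]
  exact LinearMap.lTensor_injective_of_exact_of_flat g h.surj f h.inj h.exact E

theorem IsSES.flat_left {f : X →ₗ[R] Y} {g : Y →ₗ[R] Z} (h : IsSES f g)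
    [Module.Flat R Y] [Module.Flat R Z] : Module.Flat R X := by
  rw [Module.Flat.iff_lTensor_preserves_injective_linearMap]
  intro A B _ _ _ _ i hi
  have h1 : Function.Injective (f.rTensor B ∘ₗ i.lTensor X) := by
    rw [LinearMap.rTensor_comp_lTensor, ← LinearMap.lTensor_comp_rTensor]
    exact (Module.Flat.lTensor_preserves_injective_linearMap i hi).comp h.rTensor_injective_of_flat
  exact Function.Injective.of_comp h1

theorem IsSES.flat_mid {f : X →ₗ[R] Y} {g : Y →ₗ[R] Z} (h : IsSES f g)
    [Module.Flat R X] [Module.Flat R Z] : Module.Flat R Y := by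
  rw [Module.Flat.iff_lTensor_preserves_injective_linearMap]
  intro A B _ _ _ _ i hi
  rw [injective_iff_map_eq_zero]
  intro y hy
  have h1 : g.rTensor A y = 0 := by
    apply Module.Flat.lTensor_preserves_injective_linearMap (M := Z) i hi
    rw [← LinearMap.comp_apply, LinearMap.lTensor_comp_rTensor, ← LinearMap.rTensor_comp_lTensor,
      LinearMap.comp_apply, hy, map_zero, map_zero]
  obtain ⟨x, rfl⟩ := (rTensor_exact A h.exact h.surj y).mp h1
  rw [← LinearMap.comp_apply, LinearMap.lTensor_comp_rTensor,
    ← LinearMap.rTensor_comp_lTensor] at hy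
  have h2 : f.rTensor B (i.lTensor X x) = f.rTensor B 0 := by rw [map_zero]; exact hy
  have h3 : i.lTensor X x = i.lTensor X 0 := by
    rw [map_zero]; exact h.rTensor_injective_of_flat h2
  rw [Module.Flat.lTensor_preserves_injective_linearMap (M := X) i hi h3, map_zero]

theorem extVan_characterModule_of_flat [hF : Module.Flat R F] (i : ℕ) :
    ExtVan R (i + 1) F (CharacterModule E) := by
  obtain ⟨G, K, _, _, _, _, f, g, _, h⟩ := exists_free_isSES R F
  induction i generalizing F G K with
  | zero => exact h.ext_one_characterModule (extVan_of_projective 0) h.rTensor_injective_of_flat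
  | succ i ih =>
    have := h.flat_left
    obtain ⟨G', K', _, _, _, _, f', g', _, h'⟩ := exists_free_isSES R K
    exact h.ext_quot_left (ih G' K' _ _ _ _ f' g' ‹_› h') (extVan_of_projective _)

attribute [local instance] GorensteinFlatWitness.instAdd GorensteinFlatWitness.instMod

theorem IsGorensteinFlat.extVan_characterModule (hE : Module.Injective R E)
    (hX : IsGorensteinFlat R X) (j : ℕ) : ExtVan R (j + 1) X (CharacterModule E) := by
  obtain ⟨w⟩ := hX
  obtain ⟨e⟩ := w.iso
  refine ExtVan.congr_left e.symm ?_
  generalize (0 : ℤ) = i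
  have := w.flat
  induction j generalizing i with
  | zero =>
    exact (w.isSES i).ext_one_characterModule (extVan_characterModule_of_flat 0)
      (w.rTensor_injective hE i)
  | succ j ih => exact (w.isSES i).ext_quot_left (ih (i + 1)) (extVan_characterModule_of_flat _)

variable (R E) in
/-- `Torᵢ(X, E) = 0` and `Extⁱ(E, X ⊗ E) = 0` for all `i ≥ 1`. -/
structure TensorAcyclic (X : Type u) [AddCommGroup X] [Module R X] : Prop where
  tor : ∀ i, ExtVan R (i + 1) X (CharacterModule E)
  ext : ∀ i, ExtVan R (i + 1) E (X ⊗[R] E)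

variable (R E) in
/-- The first `k` iterated syzygies of `X`, in any resolution by flat modules, are acyclic. -/
def SyzygyAcyclic : ℕ → (X : Type u) → [AddCommGroup X] → [Module R X] → Prop
  | 0, X, _, _ => TensorAcyclic R E X
  | k + 1, X, _, _ => TensorAcyclic R E X ∧
      ∀ (F Y : Type u) [AddCommGroup F] [Module R F] [AddCommGroup Y] [Module R Y]
        (f : Y →ₗ[R] F) (g : F →ₗ[R] X), Module.Flat R F → IsSES f g → SyzygyAcyclic k Y

variable (R E) in
/-- All iterated syzygies of `X` of order at least `n`, in any resolution by flat modules,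
are acyclic. -/
def EventuallyAcyclic : ℕ → (X : Type u) → [AddCommGroup X] → [Module R X] → Prop
  | 0, X, _, _ => ∀ k, SyzygyAcyclic R E k X
  | n + 1, X, _, _ =>
      ∀ (F Y : Type u) [AddCommGroup F] [Module R F] [AddCommGroup Y] [Module R Y]
        (f : Y →ₗ[R] F) (g : F →ₗ[R] X), Module.Flat R F → IsSES f g → EventuallyAcyclic n Y

theorem SyzygyAcyclic.tensorAcyclic {k : ℕ} (h : SyzygyAcyclic R E k X) : TensorAcyclic R E X := by
  cases k with
  | zero => exact h
  | succ k => exact h.1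

theorem EventuallyAcyclic.tensorAcyclic (h : EventuallyAcyclic R E 0 X) : TensorAcyclic R E X :=
  h 0

theorem EventuallyAcyclic.syzygy_zero (h : EventuallyAcyclic R E 0 X) {f : Y →ₗ[R] F}
    {g : F →ₗ[R] X} [Module.Flat R F] (hs : IsSES f g) : EventuallyAcyclic R E 0 Y :=
  fun k => (h (k + 1)).2 F Y f g inferInstance hs

theorem IsGorensteinFlat.eventuallyAcyclic [IsLocalRing R] [IsNoetherianRing R]
    (hE : IsMatlis R E) (hX : IsGorensteinFlat R X) : EventuallyAcyclic R E 0 X := by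
  intro k
  have h1 := hX.extVan_characterModule hE.injective
  have h2 := hX.cores hE.injective
  clear hX
  induction k generalizing X with
  | zero => exact ⟨h1, h2.extVan hE⟩
  | succ k ih =>
    refine ⟨⟨h1, h2.extVan hE⟩, fun F Y _ _ _ _ f g _ h => ih (fun j => ?_) ?_⟩
    · exact h.ext_sub_left (extVan_characterModule_of_flat _) (h1 (j + 1))
    · exact Cores.of_isSES h (h.rTensor_injective_of_ext (h1 0)) h2

/-- Compatible flat covers of the terms of a short exact sequence. -/
theorem IsSES.exists_horseshoe {Q G Y' : Type u} [AddCommGroup Q] [Module R Q] [AddCommGroup G]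
    [Module R G] [AddCommGroup Y'] [Module R Y'] [Module.Flat R G] {u : Y →ₗ[R] Z} {v : Z →ₗ[R] Q}
    (h : IsSES u v) {a : Y' →ₗ[R] G} {b : G →ₗ[R] Y} (hab : IsSES a b) :
    ∃ (H Z' L Q' : Type u) (_ : AddCommGroup H) (_ : Module R H) (_ : AddCommGroup Z')
      (_ : Module R Z') (_ : AddCommGroup L) (_ : Module R L) (_ : AddCommGroup Q')
      (_ : Module R Q') (f : Z' →ₗ[R] H) (g : H →ₗ[R] Z) (f' : Q' →ₗ[R] L) (g' : L →ₗ[R] Q)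
      (u' : Y' →ₗ[R] Z') (v' : Z' →ₗ[R] Q'), Module.Flat R H ∧ Module.Free R L ∧ IsSES f g ∧
        IsSES f' g' ∧ IsSES u' v' ∧ ∃ s : L →ₗ[R] Z, v ∘ₗ s = g' := by
  obtain ⟨L, Q', _, _, _, _, f', g', _, h'⟩ := exists_free_isSES R Q
  obtain ⟨s, hs⟩ := Module.projective_lifting_property v g' h.surj
  have hs' : ∀ l, v (s l) = g' l := fun l => LinearMap.congr_fun hs l
  let p : G × L →ₗ[R] Z := (u ∘ₗ b).coprod s
  have hvp : ∀ x, v (p x) = g' x.2 := fun x => by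
    simp [p, h.apply_apply, hs']
  have hp : Function.Surjective p := fun z => by
    obtain ⟨l, hl⟩ := h'.surj (v z)
    obtain ⟨y, hy⟩ := (h.exact (z - s l)).mp (by rw [map_sub, hs', hl, sub_self])
    obtain ⟨x, rfl⟩ := hab.surj y
    exact ⟨(x, l), by simp [p, hy]⟩
  refine ⟨G × L, LinearMap.ker p, L, LinearMap.ker g', inferInstance, inferInstance, inferInstance,
    inferInstance, inferInstance, inferInstance, inferInstance, inferInstance, _, p, _, g',
    (LinearMap.inl R G L ∘ₗ a).codRestrict _ fun y => ?_,
    (LinearMap.snd R G L ∘ₗ (LinearMap.ker p).subtype).codRestrict _ fun x => ?_,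
    IsSES.flat_mid (f := LinearMap.inl R G L) (g := LinearMap.snd R G L)
      ⟨LinearMap.inl_injective, LinearMap.snd_surjective, .inl_snd⟩,
    inferInstance, IsSES.of_ker hp, IsSES.of_ker h'.surj, ⟨?_, ?_, ?_⟩, s, hs⟩
  · simp [p, hab.apply_apply]
  · rw [LinearMap.mem_ker, LinearMap.comp_apply, LinearMap.snd_apply, ← hvp,
      Submodule.subtype_apply, LinearMap.mem_ker.mp x.2, map_zero]
  · intro x y hxy
    exact hab.inj (congrArg (fun z => z.1.1) hxy)
  · rintro ⟨l, hl⟩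
    obtain ⟨y, hy⟩ := (h.exact (s l)).mp (by rw [hs', hl])
    obtain ⟨x, rfl⟩ := hab.surj y
    exact ⟨⟨(-x, l), by simp [p, hy]⟩, rfl⟩
  · rintro ⟨⟨x, l⟩, hx⟩
    constructor
    · intro h0
      have hl : l = 0 := congrArg Subtype.val h0
      subst hl
      have : u (b x) = 0 := by simpa [p] using hx
      obtain ⟨y, rfl⟩ := (hab.exact x).mp ((map_eq_zero_iff u h.inj).mp this)
      exact ⟨y, rfl⟩
    · rintro ⟨y, hy⟩
      refine Subtype.ext ?_
      exact (congrArg (fun z => z.1.2) hy).symm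

theorem SyzygyAcyclic.of_isSES {Q : Type u}
    [AddCommGroup Q] [Module R Q]
    {u : Y →ₗ[R] Z} {v : Z →ₗ[R] Q} (h : IsSES u v) (hZ : EventuallyAcyclic R E 0 Z)
    (hQ : EventuallyAcyclic R E 0 Q) (k : ℕ) : SyzygyAcyclic R E k Y := by
  induction k generalizing Y Z Q with
  | zero =>
    refine ⟨fun i => h.ext_sub_left (hZ.tensorAcyclic.tor i) (hQ.tensorAcyclic.tor (i + 1)),
      fun i => ?_⟩
    have hs := h.rTensor (h.rTensor_injective_of_ext (hQ.tensorAcyclic.tor 0))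
    cases i with
    | succ i =>
      exact hs.ext_sub_right (hQ.tensorAcyclic.ext i) (hZ.tensorAcyclic.ext (i + 1))
    | zero =>
      refine hs.ext_one_of_lift (hZ.tensorAcyclic.ext 0) fun φ => ?_
      obtain ⟨G, K, _, _, _, _, f, g, _, hG⟩ := exists_free_isSES R Y
      obtain ⟨H, Z', L, Q', _, _, _, _, _, _, _, _, f, g, f', g', u', v', -, _, -, hL, -, s, hs⟩ :=
        h.exists_horseshoe hG
      obtain ⟨ψ, hψ⟩ := (hL.rTensor (hL.rTensor_injective_of_ext
        (hQ.tensorAcyclic.tor 0))).exists_lift ((hQ.syzygy_zero hL).tensorAcyclic.ext 0) φ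
      refine ⟨s.rTensor E ∘ₗ ψ, ?_⟩
      rw [← LinearMap.comp_assoc, ← LinearMap.rTensor_comp, hs, hψ]
  | succ k ih =>
    refine ⟨(ih h hZ hQ).tensorAcyclic, fun G Y' _ _ _ _ a b _ hab => ?_⟩
    obtain ⟨H, Z', L, Q', _, _, _, _, _, _, _, _, f, g, f', g', u', v', _, _, hH, hL, h', -⟩ :=
      h.exists_horseshoe hab
    exact ih h' (hZ.syzygy_zero hH) (hQ.syzygy_zero hL)

theorem EventuallyAcyclic.of_isSES {Q : Type u}
    [AddCommGroup Q] [Module R Q] {n : ℕ}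
    {u : Y →ₗ[R] Z} {v : Z →ₗ[R] Q} (h : IsSES u v) (hZ : EventuallyAcyclic R E n Z)
    (hQ : EventuallyAcyclic R E 0 Q) : EventuallyAcyclic R E n Y := by
  induction n generalizing Y Z Q with
  | zero => exact SyzygyAcyclic.of_isSES h hZ hQ
  | succ n ih =>
    intro G Y' _ _ _ _ a b _ hab
    obtain ⟨H, Z', L, Q', _, _, _, _, _, _, _, _, f, g, f', g', u', v', hH', _, hH, hL, h', -⟩ :=
      h.exists_horseshoe hab
    exact ih h' (hZ H Z' f g hH' hH) (hQ.syzygy_zero hL)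

/-- Syzygies of an extension of a flat module by `X` are syzygies of `X`. -/
theorem IsSES.exists_flat_cover_left {G Z' : Type u} [AddCommGroup G] [Module R G]
    [AddCommGroup Z'] [Module R Z'] [Module.Flat R G] [Module.Flat R F] {u : X →ₗ[R] Z}
    {v : Z →ₗ[R] F} (h : IsSES u v) {a : Z' →ₗ[R] G} {b : G →ₗ[R] Z} (hab : IsSES a b) :
    ∃ (F' : Type u) (_ : AddCommGroup F') (_ : Module R F') (f : Z' →ₗ[R] F') (g : F' →ₗ[R] X),
      Module.Flat R F' ∧ IsSES f g := by
  have hvb : Function.Surjective (v ∘ₗ b) := h.surj.comp hab.surj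
  have hK : ∀ x : LinearMap.ker (v ∘ₗ b), b x ∈ LinearMap.range u := fun x =>
    (h.exact _).mp x.2
  let g : LinearMap.ker (v ∘ₗ b) →ₗ[R] X := (LinearEquiv.ofInjective u h.inj).symm.toLinearMap ∘ₗ
    (b ∘ₗ (LinearMap.ker (v ∘ₗ b)).subtype).codRestrict _ hK
  have hg : ∀ x, u (g x) = b x := fun x => by
    exact congrArg Subtype.val ((LinearEquiv.ofInjective u h.inj).apply_symm_apply ⟨b x, hK x⟩)
  refine ⟨LinearMap.ker (v ∘ₗ b), inferInstance, inferInstance,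
    a.codRestrict _ fun z => by simp [hab.apply_apply], g, (IsSES.of_ker hvb).flat_left,
    ⟨fun x y hxy => hab.inj (congrArg Subtype.val hxy), fun x => ?_, fun x => ?_⟩⟩
  · obtain ⟨y, hy⟩ := hab.surj (u x)
    exact ⟨⟨y, by simp [hy, h.apply_apply]⟩, h.inj ((hg _).trans hy)⟩
  · rw [← map_eq_zero_iff u h.inj, hg, hab.exact]
    exact ⟨fun ⟨z, hz⟩ => ⟨z, Subtype.ext hz⟩, fun ⟨z, hz⟩ => ⟨z, congrArg Subtype.val hz⟩⟩

theorem EventuallyAcyclic.extension [IsNoetherianRing R] (hE : Module.Injective R E)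
    [Module.Flat R F] {n : ℕ} {u : X →ₗ[R] Z} {v : Z →ₗ[R] F} (h : IsSES u v)
    (hX : EventuallyAcyclic R E n X) : EventuallyAcyclic R E n Z := by
  cases n with
  | zero =>
    have h0 : TensorAcyclic R E Z := by
      have : Module.Injective R (F ⊗[R] E) := injective_flat_tensor
      exact ⟨fun i => h.ext_mid_left (hX.tensorAcyclic.tor i) (extVan_characterModule_of_flat i),
        fun i => (h.rTensor h.rTensor_injective_of_flat).ext_mid_right (hX.tensorAcyclic.ext i)
          (extVan_of_injective i)⟩
    intro k
    cases k with
    | zero => exact h0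
    | succ k =>
      refine ⟨h0, fun G Z' _ _ _ _ a b _ hab => ?_⟩
      obtain ⟨F', _, _, f, g, _, hfg⟩ := h.exists_flat_cover_left hab
      exact hX.syzygy_zero hfg k
  | succ n =>
    intro G Z' _ _ _ _ a b _ hab
    obtain ⟨F', _, _, f, g, hF', hfg⟩ := h.exists_flat_cover_left hab
    exact hX F' Z' f g hF' hfg

theorem gfdLE.eventuallyAcyclic [IsLocalRing R] [IsNoetherianRing R] (hE : IsMatlis R E) {n : ℕ}
    (hX : gfdLE R n X) : EventuallyAcyclic R E n X := by
  induction n generalizing X with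
  | zero => exact IsGorensteinFlat.eventuallyAcyclic hE hX
  | succ n ih =>
    obtain ⟨c, hc⟩ := hX
    intro F Y _ _ _ _ f g _ h
    let p : c.Q × F →ₗ[R] X := c.π ∘ₗ LinearMap.fst R c.Q F - g ∘ₗ LinearMap.snd R c.Q F
    have hp : ∀ x : LinearMap.ker p, c.π x.1.1 = g x.1.2 := fun x => sub_eq_zero.mp x.2
    have h1 : IsSES ((LinearMap.inl R c.Q F ∘ₗ (LinearMap.ker c.π).subtype).codRestrict
        (LinearMap.ker p) fun x => by simp [p])
        (LinearMap.snd R c.Q F ∘ₗ (LinearMap.ker p).subtype) := by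
      refine ⟨fun x y hxy => Subtype.ext (congrArg (fun z => z.1.1) hxy), fun y => ?_, ?_⟩
      · obtain ⟨q, hq⟩ := c.surj (g y)
        exact ⟨⟨(q, y), by simp [p, hq]⟩, rfl⟩
      · rintro ⟨⟨q, y⟩, hx⟩
        have := hp ⟨_, hx⟩
        constructor
        · rintro rfl
          exact ⟨⟨q, by simpa using this⟩, rfl⟩
        · rintro ⟨z, hz⟩
          exact (congrArg (fun z => z.1.2) hz).symm
    have h2 : IsSES ((LinearMap.inr R c.Q F ∘ₗ f).codRestrict
        (LinearMap.ker p) fun x => by simp [p, h.apply_apply])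
        (LinearMap.fst R c.Q F ∘ₗ (LinearMap.ker p).subtype) := by
      refine ⟨fun x y hxy => h.inj (congrArg (fun z => z.1.2) hxy), fun q => ?_, ?_⟩
      · obtain ⟨y, hy⟩ := h.surj (c.π q)
        exact ⟨⟨(q, y), by simp [p, hy]⟩, rfl⟩
      · rintro ⟨⟨q, y⟩, hx⟩
        have := hp ⟨_, hx⟩
        constructor
        · rintro rfl
          obtain ⟨z, rfl⟩ := (h.exact y).mp (by simpa using this.symm)
          exact ⟨z, rfl⟩
        · rintro ⟨z, hz⟩
          exact (congrArg (fun z => z.1.1) hz).symm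
    exact EventuallyAcyclic.of_isSES h2
      (EventuallyAcyclic.extension hE.injective h1 (ih hc))
      (IsGorensteinFlat.eventuallyAcyclic hE c.gflat)

end TorVanishing

section Bridge
open CategoryTheory

variable {R : Type u} [CommRing R] {X Y : Type u} [AddCommGroup X] [Module R X]
  [AddCommGroup Y] [Module R Y]

theorem ExtVan.subsingleton_extModule {i : ℕ} (h : ExtVan R i X Y) :
    Subsingleton (extModule R i X Y) := by
  let P := projectiveResolution (ModuleCat.of R X)
  have key : ∀ f : P.complex.X i ⟶ ModuleCat.of R Y, P.complex.d (i + 1) i ≫ f = 0 →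
      ∃ g : (P.complex.linearYonedaObj R (ModuleCat.of R Y)).X ((ComplexShape.up ℕ).prev i),
        ((P.complex.linearYonedaObj R (ModuleCat.of R Y)).d _ i) g = f := by
    intro f hf
    cases i with
    | zero =>
      have h0 : f = 0 := by
        have hex := P.exact₀
        have : f = P.π.f 0 ≫ hex.desc f hf := (hex.g_desc f hf).symm
        rw [this]
        have h1 := extVan_zero_iff.mp h
        rw [show hex.desc f hf = 0 from
          ModuleCat.hom_ext (h1.elim (hex.desc f hf).hom 0), Limits.comp_zero]
      exact ⟨0, by rw [h0]; exact map_zero _⟩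
    | succ n =>
      obtain ⟨g, hg⟩ := (P.extMk_eq_zero_iff f (n + 2) rfl hf n rfl).mp (h.elim _ _)
      have hp : (ComplexShape.up ℕ).prev (n + 1) = n := by simp
      rw [hp]
      exact ⟨g, hg⟩
  have hz : Limits.IsZero ((P.complex.linearYonedaObj R (ModuleCat.of R Y)).homology i) := by
    rw [← HomologicalComplex.exactAt_iff_isZero_homology,
      HomologicalComplex.exactAt_iff' _ _ i (i + 1) rfl (by simp), ShortComplex.moduleCat_exact_iff]
    exact fun f hf => key f hf
  exact ModuleCat.subsingleton_of_isZero (hz.of_iso (P.isoExt i (ModuleCat.of R Y)))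

end Bridge

section Bass
open CategoryTheory Abelian

variable {R : Type u} [CommRing R]

theorem idLE.extVan {n : ℕ} {Y : Type u} [AddCommGroup Y] [Module R Y] (h : idLE R n Y) (i : ℕ)
    (X : Type u) [AddCommGroup X] [Module R X] : ExtVan R (n + i + 1) X Y := by
  induction n generalizing Y with
  | zero =>
    have : Module.Injective R Y := h
    exact extVan_of_injective _
  | succ n ih =>
    obtain ⟨c, hc⟩ := h
    have := c.injective
    have h1 := (IsSES.of_range c.inj).ext_sub_right (ih hc) (extVan_of_injective _ (X := X))
    rwa [show n + 1 + i + 1 = n + i + 1 + 1 by ring]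

theorem IsSES.ext_of_smul {K Y Z : Type u} [AddCommGroup K] [Module R K] [AddCommGroup Y]
    [Module R Y] [AddCommGroup Z] [Module R Z] {x : R} {g : Y →ₗ[R] Z}
    (h : IsSES (LinearMap.lsmul R Y x) g) (hx : ∀ a : K, x • a = 0) {i : ℕ}
    (hZ : ExtVan R i K Z) : ExtVan R (i + 1) K Y := by
  refine subsingleton_of_forall_eq 0 fun e => ?_
  obtain ⟨e', rfl⟩ := Ext.covariant_sequence_exact₁ (ModuleCat.of R K) h.shortExact e (by
    have h1 : ModuleCat.ofHom (LinearMap.lsmul R Y x) = x • 𝟙 (ModuleCat.of R Y) := rfl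
    have h2 : x • 𝟙 (ModuleCat.of R K) = 0 := by ext a; exact hx a
    have h3 : e.comp (Ext.mk₀ (x • 𝟙 (ModuleCat.of R Y))) (add_zero (i + 1)) =
        (Ext.mk₀ (x • 𝟙 (ModuleCat.of R K))).comp e (zero_add (i + 1)) := by
      simp [Ext.mk₀_smul]
    change e.comp (Ext.mk₀ (ModuleCat.ofHom (LinearMap.lsmul R Y x))) _ = 0
    rw [h1, h3, h2]; simp) rfl
  rw [show e' = 0 from hZ.elim _ _]; simp

/-- Multiplication by `x` is surjective on `Ext^n(Y, A)` if `Ext^{n+1}(Y/xY, A) = 0`. -/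
theorem IsSES.ext_eq_zero_of_smul [IsLocalRing R] [IsNoetherianRing R] {Y Z A : Type u}
    [AddCommGroup Y] [Module R Y] [AddCommGroup Z] [Module R Z] [AddCommGroup A] [Module R A]
    [Module.Finite R Y] [Module.Finite R A]
    {x : R} (hx : x ∈ maximalIdeal R) {g : Y →ₗ[R] Z} (h : IsSES (LinearMap.lsmul R Y x) g)
    {i : ℕ} (hZ : ExtVan R (i + 1) Z A) : ExtVan R i Y A := by
  have hsurj : ∀ e : Ext (ModuleCat.of R Y) (ModuleCat.of R A) i, ∃ e', x • e' = e := by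
    intro e
    obtain ⟨e', rfl⟩ := Ext.contravariant_sequence_exact₁ h.shortExact (ModuleCat.of R A) e
      (add_comm 1 i) (hZ.elim _ _)
    refine ⟨e', ?_⟩
    have h1 : ModuleCat.ofHom (LinearMap.lsmul R Y x) = x • 𝟙 (ModuleCat.of R Y) := rfl
    change _ = (Ext.mk₀ (ModuleCat.ofHom (LinearMap.lsmul R Y x))).comp e' _
    rw [h1]; simp [Ext.mk₀_smul]
  have hfin : Module.Finite R (Ext (ModuleCat.of R Y) (ModuleCat.of R A) i) :=
    have : Module.Finite R (ModuleCat.of R Y) := ‹Module.Finite R Y›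
    have : Module.Finite R (ModuleCat.of R A) := ‹Module.Finite R A›
    inferInstance
  have := Submodule.eq_bot_of_le_smul_of_le_jacobson_bot (maximalIdeal R)
    (⊤ : Submodule R (Ext (ModuleCat.of R Y) (ModuleCat.of R A) i)) hfin.1 (by
      intro e _
      obtain ⟨e', rfl⟩ := hsurj e
      exact Submodule.smul_mem_smul hx trivial) (maximalIdeal_le_jacobson _)
  exact (Submodule.subsingleton_iff R).mp (subsingleton_of_bot_eq_top this.symm)

variable [IsLocalRing R] [IsNoetherianRing R]

/-- A module `Y` of depth `t` degenerates, by dividing out a regular sequence, to a module of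
depth zero. -/
theorem exists_residue_embedding {B : Type u} [AddCommGroup B] [Module R B] (t j : ℕ)
    (Y : Type u) [AddCommGroup Y] [Module R Y] [Module.Finite R Y]
    (hlt : ∀ i < t, ExtVan R i (R ⧸ maximalIdeal R) Y)
    (ht : ¬ ExtVan R t (R ⧸ maximalIdeal R) Y) (hB : ∀ i > j, ExtVan R i Y B) :
    ∃ (Y' : Type u) (_ : AddCommGroup Y') (_ : Module R Y') (_ : Module.Finite R Y')
      (φ : (R ⧸ maximalIdeal R) →ₗ[R] Y'), Function.Injective φ ∧
      ∀ i > j + t, ExtVan R i Y' B := by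
  induction t generalizing Y j with
  | zero =>
    rw [extVan_zero_iff, not_subsingleton_iff_nontrivial] at ht
    obtain ⟨φ, hφ⟩ := exists_ne (0 : (R ⧸ maximalIdeal R) →ₗ[R] Y)
    have : IsSimpleModule R (R ⧸ maximalIdeal R) :=
      isSimpleModule_iff_isCoatom.mpr (maximalIdeal.isMaximal R).1
    exact ⟨Y, _, _, ‹_›, φ, (LinearMap.injective_or_eq_zero φ).resolve_right hφ, hB⟩
  | succ t ih =>
    obtain ⟨x, hx, hreg⟩ := IsSMulRegular.subsingleton_linearMap_iff.mp
      (extVan_zero_iff.mp (hlt 0 t.succ_pos))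
    have hs : IsSES (LinearMap.lsmul R Y x) (LinearMap.range (LinearMap.lsmul R Y x)).mkQ :=
      IsSES.of_range hreg
    obtain ⟨Y', i1, i2, i3, φ, hφ, h⟩ := ih (j + 1) (Y ⧸ LinearMap.range (LinearMap.lsmul R Y x))
      (fun i hi => hs.ext_quot_right (hlt i (by omega)) (hlt (i + 1) (by omega)))
      (fun h => ht (hs.ext_of_smul (Module.mem_annihilator.mp hx) h))
      (fun i hi => by
        obtain ⟨i, rfl⟩ := Nat.exists_eq_succ_of_ne_zero (by omega : i ≠ 0)
        exact hs.ext_quot_left (hB i (by omega)) (hB (i + 1) (by omega)))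
    exact ⟨Y', i1, i2, i3, φ, hφ, fun i hi => h i (by omega)⟩

/-- Over a noetherian local ring of finite self-injective dimension, `Ext^n(X, R)` vanishes for
finitely generated `X` and `n` greater than the depth. -/
theorem extVan_self_of_depth_lt {N d : ℕ} (hN : idLE R N R)
    (hlt : ∀ i < d, ExtVan R i (R ⧸ maximalIdeal R) R)
    (hd : ¬ ExtVan R d (R ⧸ maximalIdeal R) R) {n : ℕ} (hn : d < n)
    (X : Type u) [AddCommGroup X] [Module R X] [Module.Finite R X] : ExtVan R n X R := by
  obtain ⟨Y', _, _, _, φ, hφ, hY'⟩ := exists_residue_embedding (B := R) d 0 R hlt hd (by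
    intro i hi
    obtain ⟨i, rfl⟩ := Nat.exists_eq_succ_of_ne_zero (by omega : i ≠ 0)
    exact extVan_of_projective i)
  suffices H : ∀ s n, d < n → N < n + s → ∀ (X : Type u) [AddCommGroup X] [Module R X]
      [Module.Finite R X], ExtVan R n X R from H (N + 1) n hn (by omega) X
  intro s
  induction s with
  | zero =>
    intro n _ hNn X _ _ _
    obtain ⟨i, rfl⟩ := Nat.exists_eq_add_of_lt (by omega : N < n)
    exact hN.extVan i X
  | succ s ih =>
    intro n hn hNn X _ _ hX
    have ih' := ih (n + 1) (by omega) (by omega)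
    have hk : ExtVan R n (R ⧸ maximalIdeal R) R :=
      (IsSES.of_range hφ).ext_sub_left (hY' n (by omega)) (ih' _)
    induction hX using IsNoetherianRing.induction_on_isQuotientEquivQuotientPrime R with
    | subsingleton N => exact ExtVan.of_subsingleton_left n
    | quotient N p e =>
      refine ExtVan.congr_left e.symm ?_
      by_cases hp : maximalIdeal R ≤ p.1
      · rwa [← (maximalIdeal.isMaximal R).eq_of_le p.2.ne_top hp]
      · obtain ⟨x, hxm, hxp⟩ := SetLike.not_le_iff_exists.mp hp
        have hinj : Function.Injective (LinearMap.lsmul R (R ⧸ p.1) x) := by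
          rw [injective_iff_map_eq_zero]
          intro a ha
          obtain ⟨a, rfl⟩ := Ideal.Quotient.mk_surjective a
          have : x * a ∈ p.1 := Ideal.Quotient.eq_zero_iff_mem.mp ha
          exact Ideal.Quotient.eq_zero_iff_mem.mpr ((p.2.mem_or_mem this).resolve_left hxp)
        exact (IsSES.of_range hinj).ext_eq_zero_of_smul hxm (ih' _)
    | exact N₁ N₂ N₃ f g hf hg hfg h₁ h₃ =>
      exact IsSES.ext_mid_left ⟨hf, hg, hfg⟩ h₁ h₃

end Bass

section TorsionInjective

variable {S : Type u} [CommRing S] [IsNoetherianRing S]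

theorem IsPowTorsion.exists_injective_isSES {J : Ideal S} {Z : Type u} [AddCommGroup Z]
    [Module S Z] (hZ : IsPowTorsion J Z) :
    ∃ (T C : Type u) (_ : AddCommGroup T) (_ : Module S T) (_ : AddCommGroup C) (_ : Module S C)
      (f : Z →ₗ[S] T) (g : T →ₗ[S] C), Module.Injective S T ∧ IsPowTorsion J C ∧ IsSES f g := by
  obtain ⟨T, C, _, _, _, _, f, g, _, h⟩ := _root_.exists_injective_isSES S Z
  let f' : Z →ₗ[S] powTorsion J T := f.codRestrict _ fun z => by
    obtain ⟨k, hk⟩ := hZ z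
    exact ⟨k, fun r hr => by rw [← map_smul, hk r hr, map_zero]⟩
  have hf' : Function.Injective f' := fun a b hab => h.inj (congrArg Subtype.val hab)
  exact ⟨_, _, _, _, _, _, f', _, powTorsion_injective J,
    (isPowTorsion_powTorsion J T).of_surjective (Submodule.mkQ_surjective _), IsSES.of_range hf'⟩

/-- The injective dimension of a torsion module is detected by torsion cyclic modules. -/
theorem IsPowTorsion.extVan_of_quotient {J : Ideal S} (d : ℕ) {Z : Type u} [AddCommGroup Z]
    [Module S Z] (hZ : IsPowTorsion J Z)
    (H : ∀ (b : Ideal S) (k : ℕ), J ^ k ≤ b → ∀ i, ExtVan S (d + i + 1) (S ⧸ b) Z) (i : ℕ)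
    (X : Type u) [AddCommGroup X] [Module S X] : ExtVan S (d + i + 1) X Z := by
  induction d generalizing Z with
  | zero =>
    have := hZ.injective_of_ext fun b k hb => H b k hb 0
    exact extVan_of_injective _
  | succ d ih =>
    obtain ⟨T, C, _, _, _, _, f, g, _, hC, h⟩ := hZ.exists_injective_isSES
    have h1 := ih hC fun b k hb i => h.ext_quot_right (extVan_of_injective _) (by
      have := H b k hb i
      rwa [show d + 1 + i + 1 = d + i + 1 + 1 by ring] at this)
    rw [show d + 1 + i + 1 = d + i + 1 + 1 by ring]
    exact h.ext_sub_right h1 (extVan_of_injective _)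

end TorsionInjective

section BaseChange

variable {R S : Type u} [CommRing R] [CommRing S] [Algebra R S]

theorem IsSES.baseChange [Module.Flat R S] {X Y Z : Type*} [AddCommGroup X] [Module R X]
    [AddCommGroup Y] [Module R Y] [AddCommGroup Z] [Module R Z] {f : X →ₗ[R] Y} {g : Y →ₗ[R] Z}
    (h : IsSES f g) : IsSES (f.baseChange S) (g.baseChange S) :=
  ⟨Module.Flat.lTensor_preserves_injective_linearMap f h.inj, LinearMap.lTensor_surjective S h.surj,
    Module.Flat.lTensor_exact S h.exact⟩

/-- Flat base change of the first argument of `Ext`. -/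
theorem ExtVan.baseChange [Module.Flat R S] {Y : Type u} [AddCommGroup Y] [Module R Y]
    [Module S Y] [IsScalarTower R S Y] (i : ℕ) {X : Type u} [AddCommGroup X] [Module R X]
    (hX : ExtVan R (i + 1) X Y) : ExtVan S (i + 1) (S ⊗[R] X) Y := by
  induction i generalizing X with
  | zero =>
    obtain ⟨F, K, _, _, _, _, f, g, _, h⟩ := exists_free_isSES R X
    refine (h.baseChange (S := S)).ext_one_of_extend (extVan_of_projective 0) fun φ => ?_
    obtain ⟨ψ, hψ⟩ := h.exists_extend hX (φ.restrictScalars R ∘ₗ TensorProduct.mk R S K 1)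
    refine ⟨TensorProduct.AlgebraTensorModule.lift
      (LinearMap.toSpanSingleton S (F →ₗ[R] Y) ψ), ?_⟩
    ext x
    have := LinearMap.congr_fun hψ x
    simpa using this
  | succ i ih =>
    obtain ⟨F, K, _, _, _, _, f, g, _, h⟩ := exists_free_isSES R X
    exact (h.baseChange (S := S)).ext_quot_left
      (ih (h.ext_sub_left (extVan_of_projective i) hX)) (extVan_of_projective _)

end BaseChange

section Quotient

variable {S : Type u} [CommRing S] {I : Ideal S}

/-- If the `I`-torsion of `W` is `S/I` and free `S/I`-modules are acyclic for `Hom_S(-, W)`,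
then `Ext_{S/I}(-, S/I)` controls `Ext_S(-, W)`. -/
theorem ExtVan.of_quotient {W : Type u} [AddCommGroup W] [Module S W] {l : (S ⧸ I) →ₗ[S] W}
    (hl : Function.Injective l) (hr : killedBy I W ≤ LinearMap.range l)
    (hF : ∀ (i : ℕ) (F : Type u) [AddCommGroup F] [Module S F] [Module (S ⧸ I) F]
      [IsScalarTower S (S ⧸ I) F] [Module.Free (S ⧸ I) F], ExtVan S (i + 1) F W)
    (i : ℕ) {N : Type u} [AddCommGroup N] [Module S N] [Module (S ⧸ I) N]
    [IsScalarTower S (S ⧸ I) N] (hN : ExtVan (S ⧸ I) (i + 1) N (S ⧸ I)) :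
    ExtVan S (i + 1) N W := by
  induction i generalizing N with
  | zero =>
    obtain ⟨F, K, _, _, _, _, f, g, _, h⟩ := exists_free_isSES (S ⧸ I) N
    let _ := Module.compHom F (algebraMap S (S ⧸ I))
    let _ := Module.compHom K (algebraMap S (S ⧸ I))
    have : IsScalarTower S (S ⧸ I) F := .of_algebraMap_smul fun _ _ => rfl
    have : IsScalarTower S (S ⧸ I) K := .of_algebraMap_smul fun _ _ => rfl
    have h' : IsSES (f.restrictScalars S) (g.restrictScalars S) := ⟨h.inj, h.surj, h.exact⟩
    refine h'.ext_one_of_extend (hF 0 F) fun φ => ?_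
    have hφ : ∀ x, φ x ∈ LinearMap.range l := fun x => hr fun s hs => by
      rw [← map_smul, ← algebraMap_smul (S ⧸ I) s x, Ideal.Quotient.algebraMap_eq,
        Ideal.Quotient.eq_zero_iff_mem.mpr hs, zero_smul, map_zero]
    let φ' : K →ₗ[S] (S ⧸ I) := (LinearEquiv.ofInjective l hl).symm.toLinearMap ∘ₗ
      φ.codRestrict _ hφ
    have hφ' : ∀ x, l (φ' x) = φ x := fun x =>
      congrArg Subtype.val ((LinearEquiv.ofInjective l hl).apply_symm_apply ⟨φ x, hφ x⟩)
    obtain ⟨ψ, hψ⟩ := h.exists_extend hN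
      (φ'.extendScalarsOfSurjective Ideal.Quotient.mk_surjective)
    refine ⟨l ∘ₗ ψ.restrictScalars S, ?_⟩
    ext x
    rw [← hφ' x]
    exact congrArg l (LinearMap.congr_fun hψ x)
  | succ i ih =>
    obtain ⟨F, K, _, _, _, _, f, g, _, h⟩ := exists_free_isSES (S ⧸ I) N
    let _ := Module.compHom F (algebraMap S (S ⧸ I))
    let _ := Module.compHom K (algebraMap S (S ⧸ I))
    have : IsScalarTower S (S ⧸ I) F := .of_algebraMap_smul fun _ _ => rfl
    have : IsScalarTower S (S ⧸ I) K := .of_algebraMap_smul fun _ _ => rfl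
    have h' : IsSES (f.restrictScalars S) (g.restrictScalars S) := ⟨h.inj, h.surj, h.exact⟩
    exact h'.ext_quot_left (ih (h.ext_sub_left (extVan_of_projective i) hN)) (hF _ F)

/-- Dévissage from `S/I`-modules to `I`-power torsion modules. -/
theorem ExtVan.of_pow_smul_eq_zero [IsNoetherianRing S] {W : Type u} [AddCommGroup W]
    [Module S W] {n : ℕ}
    (H : ∀ (N : Type u) [AddCommGroup N] [Module S N] [Module (S ⧸ I) N]
      [IsScalarTower S (S ⧸ I) N] [Module.Finite (S ⧸ I) N], ExtVan S n N W)
    (k : ℕ) (X : Type u) [AddCommGroup X] [Module S X] [Module.Finite S X]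
    (hX : ∀ s ∈ I ^ k, ∀ x : X, s • x = 0) : ExtVan S n X W := by
  induction k generalizing X with
  | zero =>
    have : Subsingleton X :=
      subsingleton_of_forall_eq 0 fun x => by simpa using hX 1 (by simp) x
    exact ExtVan.of_subsingleton_left n
  | succ k ih =>
    have hs : IsSES (I • (⊤ : Submodule S X)).subtype (I • (⊤ : Submodule S X)).mkQ :=
      ⟨Subtype.val_injective, Submodule.mkQ_surjective _, LinearMap.exact_subtype_mkQ _⟩
    refine hs.ext_mid_left (ih _ fun s hs x => ?_) ?_
    · obtain ⟨x, hx⟩ := x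
      refine Subtype.ext ?_
      change s • x = 0
      refine Submodule.smul_induction_on (p := fun x => s • x = 0) hx (fun r hr y _ => ?_)
        fun x y hx hy => by rw [smul_add, hx, hy, add_zero]
      rw [smul_smul]
      exact hX _ (by rw [pow_succ]; exact Ideal.mul_mem_mul hs hr) y
    · have : Module.Finite (S ⧸ I) (X ⧸ I • (⊤ : Submodule S X)) :=
        Module.Finite.of_restrictScalars_finite S _ _
      exact H _

end Quotient

section Fibre

variable {R S : Type u} [CommRing R] [CommRing S] [Algebra R S] {E : Type u} [AddCommGroup E]
  [Module R E]

theorem IsPowTorsion.baseChange {J : Ideal R} (hE : IsPowTorsion J E) :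
    IsPowTorsion (J.map (algebraMap R S)) (S ⊗[R] E) := by
  intro x
  change x ∈ powTorsion (J.map (algebraMap R S)) (S ⊗[R] E)
  induction x with
  | zero => exact zero_mem _
  | add x y hx hy => exact add_mem hx hy
  | tmul s e =>
    obtain ⟨k, hk⟩ := hE e
    refine ⟨k, fun r hr => ?_⟩
    rw [← Ideal.map_pow] at hr
    refine Submodule.span_induction (p := fun r _ => r • s ⊗ₜ[R] e = 0) ?_ (zero_smul _ _)
      (fun a b _ _ ha hb => by rw [add_smul, ha, hb, add_zero])
      (fun a b _ hb => by rw [smul_eq_mul, mul_smul, hb, smul_zero]) hr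
    rintro _ ⟨r, hr, rfl⟩
    rw [algebraMap_smul, ← TensorProduct.tmul_smul, hk r hr, TensorProduct.tmul_zero]

/-- The injective dimension of `S ⊗ E` over `S` is bounded by that of the closed fibre. -/
theorem IsMatlis.extVan_baseChange [IsLocalRing R] [IsNoetherianRing R] [IsNoetherianRing S]
    [Module.Flat R S] (hE : IsMatlis R E) {d : ℕ}
    (H : ∀ (N : Type u) [AddCommGroup N] [Module (S ⧸ (maximalIdeal R).map (algebraMap R S)) N]
      [Module.Finite (S ⧸ (maximalIdeal R).map (algebraMap R S)) N] (i : ℕ),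
      ExtVan (S ⧸ (maximalIdeal R).map (algebraMap R S)) (d + i + 1) N
        (S ⧸ (maximalIdeal R).map (algebraMap R S)))
    (i : ℕ) (X : Type u) [AddCommGroup X] [Module S X] :
    ExtVan S (d + i + 1) X (S ⊗[R] E) := by
  have := hE.injective
  obtain ⟨e₀, he₀, he⟩ := hE.socle
  let ι : (R ⧸ maximalIdeal R) →ₗ[R] E := Submodule.liftQ _ (LinearMap.toSpanSingleton R E e₀)
    fun r hr => (he₀ r).mpr hr
  have hι : Function.Injective ι := by
    rw [← LinearMap.ker_eq_bot]
    exact Submodule.ker_liftQ_eq_bot _ _ _ fun r hr => (he₀ r).mp hr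
  let l : (S ⧸ (maximalIdeal R).map (algebraMap R S)) →ₗ[S] S ⊗[R] E :=
    ι.baseChange S ∘ₗ
      (Algebra.TensorProduct.quotIdealMapEquivTensorQuot S (maximalIdeal R)).toLinearMap
  have hl : Function.Injective l :=
    (Module.Flat.lTensor_preserves_injective_linearMap ι hι).comp (AlgEquiv.injective _)
  have hr : killedBy ((maximalIdeal R).map (algebraMap R S)) (S ⊗[R] E) ≤ LinearMap.range l := by
    intro w hw
    obtain ⟨s, rfl⟩ := IsMatlis.exists_eq_tmul_of_socle he w fun r hr => by
      rw [← algebraMap_smul S]; exact hw _ (Ideal.mem_map_of_mem _ hr)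
    exact ⟨Ideal.Quotient.mk _ s, congrArg (s ⊗ₜ[R] ·) (one_smul R e₀)⟩
  have hF : ∀ (i : ℕ) (F : Type u) [AddCommGroup F] [Module S F]
      [Module (S ⧸ (maximalIdeal R).map (algebraMap R S)) F]
      [IsScalarTower S (S ⧸ (maximalIdeal R).map (algebraMap R S)) F]
      [Module.Free (S ⧸ (maximalIdeal R).map (algebraMap R S)) F],
      ExtVan S (i + 1) F (S ⊗[R] E) := by
    intro i F _ _ _ _ _
    have := injective_flat_tensor (R := R) (F := S) (E := E)
    let b := Module.Free.chooseBasis (S ⧸ (maximalIdeal R).map (algebraMap R S)) F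
    refine ExtVan.congr_left ?_ (ExtVan.baseChange (R := R) i (extVan_of_injective i)
      (X := Module.Free.ChooseBasisIndex (S ⧸ (maximalIdeal R).map (algebraMap R S)) F →₀
        (R ⧸ maximalIdeal R)))
    exact TensorProduct.finsuppRight R S S (R ⧸ maximalIdeal R) _ ≪≫ₗ
      Finsupp.mapRange.linearEquiv
        (Algebra.TensorProduct.quotIdealMapEquivTensorQuot S (maximalIdeal R)).symm.toLinearEquiv
      ≪≫ₗ (b.repr.restrictScalars S).symm
  refine hE.torsion.baseChange.extVan_of_quotient d (fun b k hb i => ?_) i X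
  refine ExtVan.of_pow_smul_eq_zero (I := (maximalIdeal R).map (algebraMap R S))
    (fun N _ _ _ _ _ => ExtVan.of_quotient hl hr hF (d + i) (H N i)) k _ fun s hs x => ?_
  obtain ⟨x, rfl⟩ := Ideal.Quotient.mk_surjective x
  exact Ideal.Quotient.eq_zero_iff_mem.mpr (b.mul_mem_right _ (hb hs))

end Fibre

section TensorDual

variable {R S : Type*} [CommRing R] [CommRing S] [Algebra R S] {E X X' P : Type*}
  [AddCommGroup E] [Module R E] [AddCommGroup X] [Module R X] [Module S X] [IsScalarTower R S X]
  [AddCommGroup X'] [Module R X'] [Module S X'] [IsScalarTower R S X']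
  [AddCommGroup P] [Module R P] [Module S P] [IsScalarTower R S P]

open TensorProduct.AlgebraTensorModule (rTensor)

variable (R S E X) in
/-- The natural map `X ⊗ E → Hom_S(Hom_S(X, S), S ⊗ E)`. -/
noncomputable def tensorDual : X ⊗[R] E →ₗ[S] Module.Dual S X →ₗ[S] S ⊗[R] E :=
  LinearMap.flip
    { toFun := fun h => rTensor R E h
      map_add' := fun h k => map_add _ h k
      map_smul' := fun s h => by ext; simp [TensorProduct.smul_tmul'] }

@[simp]
theorem tensorDual_tmul (x : X) (e : E) (h : Module.Dual S X) :
    tensorDual R S E X (x ⊗ₜ e) h = h x ⊗ₜ e := rfl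

theorem tensorDual_rTensor (f : X' →ₗ[S] X) (w : X' ⊗[R] E) :
    tensorDual R S E X (rTensor R E f w) = tensorDual R S E X' w ∘ₗ f.dualMap := by
  ext h
  induction w with
  | zero => simp
  | add w v hw hv => simpa using congrArg₂ (· + ·) hw hv
  | tmul x e => simp

theorem tensorDual_bijective [Module.Finite S P] [Module.Free S P] :
    Function.Bijective (tensorDual R S E P) := by
  classical
  let b := Module.Free.chooseBasis S P
  let T := fun i => rTensor R E (LinearMap.toSpanSingleton S P (b i))
  have hT : ∀ i w h, tensorDual R S E P (T i w) h = h (b i) • w := by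
    intro i w h
    induction w with
    | zero => simp
    | add w v hw hv => simp [hw, hv]
    | tmul s e => simp [T, TensorProduct.smul_tmul', mul_comm]
  refine Function.bijective_iff_has_inverse.mpr ⟨fun φ => ∑ i, T i (φ (b.coord i)), ?_, ?_⟩
  · intro w
    induction w with
    | zero => simp
    | add w v hw hv => simp only [map_add, LinearMap.add_apply, Finset.sum_add_distrib, hw, hv]
    | tmul p e =>
      simp only [tensorDual_tmul, T, TensorProduct.AlgebraTensorModule.rTensor_tmul,
        LinearMap.toSpanSingleton_apply, ← TensorProduct.sum_tmul, Module.Basis.coord_apply,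
        b.sum_repr]
  · intro φ
    ext h
    have : h = ∑ i, h (b i) • b.coord i := by
      refine b.ext fun j => ?_
      simp
    conv_rhs => rw [this, map_sum]
    simp [hT]

variable {f : X' →ₗ[S] P} {g : P →ₗ[S] X}

theorem tensorDual_surjective [Module.Finite S P] [Module.Free S P]
    (H : ∀ φ : Module.Dual S X →ₗ[S] S ⊗[R] E, ∃ ψ : Module.Dual S P →ₗ[S] S ⊗[R] E,
      ψ ∘ₗ g.dualMap = φ) : Function.Surjective (tensorDual R S E X) := by
  intro φ
  obtain ⟨ψ, rfl⟩ := H φ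
  obtain ⟨w, rfl⟩ := tensorDual_bijective.2 ψ
  exact ⟨rTensor R E g w, tensorDual_rTensor g w⟩

theorem tensorDual_injective [Module.Finite S P] [Module.Free S P] (hs : IsSES f g)
    (hX' : Function.Surjective (tensorDual R S E X'))
    (H : ∀ ψ : Module.Dual S P →ₗ[S] S ⊗[R] E, ψ ∘ₗ g.dualMap = 0 →
      ∃ χ : Module.Dual S X' →ₗ[S] S ⊗[R] E, ψ = χ ∘ₗ f.dualMap) :
    Function.Injective (tensorDual R S E X) := by
  rw [injective_iff_map_eq_zero]
  intro w hw
  obtain ⟨v, rfl⟩ : ∃ v, rTensor R E g v = w := LinearMap.rTensor_surjective E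
    (g := g.restrictScalars R) hs.surj w
  rw [tensorDual_rTensor] at hw
  obtain ⟨χ, hχ⟩ := H _ hw
  obtain ⟨y, rfl⟩ := hX' χ
  rw [← tensorDual_rTensor] at hχ
  rw [tensorDual_bijective.1 hχ]
  exact (rTensor_exact E (f := f.restrictScalars R) (g := g.restrictScalars R) hs.exact
    hs.surj).apply_apply_eq_zero y

end TensorDual

section DualSequence

variable {S : Type u} [CommRing S] {X' P X : Type u} [AddCommGroup X'] [Module S X']
  [AddCommGroup P] [Module S P] [AddCommGroup X] [Module S X] {f : X' →ₗ[S] P} {g : P →ₗ[S] X}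

theorem IsSES.exact_dualMap (hs : IsSES f g) : Function.Exact g.dualMap f.dualMap :=
  LinearMap.exact_lcomp_of_exact_of_surjective S hs.exact hs.surj

theorem IsSES.dual (hs : IsSES f g) (hX : ExtVan S 1 X S) : IsSES g.dualMap f.dualMap :=
  ⟨LinearMap.dualMap_injective_of_surjective hs.surj, hs.exists_extend hX, hs.exact_dualMap⟩

end DualSequence

section InjectiveTensor

variable {S : Type u} [CommRing S] [IsNoetherianRing S] {J : Type u} [AddCommGroup J] [Module S J]
  [Module.Injective S J]

theorem tensorDual_surjective_of_injective (X : Type u) [AddCommGroup X] [Module S X]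
    [Module.Finite S X] : Function.Surjective (tensorDual S S J X) := by
  obtain ⟨P, X', _, _, _, _, f, g, _, _, h⟩ := exists_finite_free_isSES S X
  have := injective_flat_tensor (R := S) (F := S) (E := J)
  exact tensorDual_surjective (g := g) fun φ => by
    obtain ⟨ψ, hψ⟩ := Module.Injective.out g.dualMap
      (LinearMap.dualMap_injective_of_surjective h.surj) φ
    exact ⟨ψ, LinearMap.ext hψ⟩

theorem tensorDual_injective_of_injective (X : Type u) [AddCommGroup X] [Module S X]
    [Module.Finite S X] : Function.Injective (tensorDual S S J X) := by
  obtain ⟨P, X', _, _, _, _, f, g, _, _, h⟩ := exists_finite_free_isSES S X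
  have := injective_flat_tensor (R := S) (F := S) (E := J)
  have : Module.Finite S X' := Module.Finite.of_injective f h.inj
  refine tensorDual_injective h (tensorDual_surjective_of_injective X') fun ψ hψ => ?_
  have hker : LinearMap.ker f.dualMap ≤ LinearMap.ker ψ := fun a ha => by
    obtain ⟨b, rfl⟩ := (h.exact_dualMap a).mp ha
    exact LinearMap.congr_fun hψ b
  obtain ⟨χ, hχ⟩ := Module.Injective.out ((LinearMap.ker f.dualMap).liftQ f.dualMap le_rfl)
    (LinearMap.ker_eq_bot.mp (Submodule.ker_liftQ_eq_bot _ _ _ le_rfl))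
    ((LinearMap.ker f.dualMap).liftQ ψ hker)
  exact ⟨χ, LinearMap.ext fun a => (hχ (Submodule.Quotient.mk a)).symm⟩

theorem lTensor_injective_of_dualMap_surjective {X P : Type u} [AddCommGroup X] [Module S X]
    [AddCommGroup P] [Module S P] [Module.Finite S X] (f : X →ₗ[S] P)
    (hf : Function.Surjective f.dualMap) : Function.Injective (f.lTensor J) := by
  rw [LinearMap.lTensor_inj_iff_rTensor_inj, injective_iff_map_eq_zero]
  intro w hw
  refine (injective_iff_map_eq_zero _).mp (tensorDual_injective_of_injective (J := J) X) w ?_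
  ext h
  obtain ⟨k, rfl⟩ := hf h
  have := tensorDual_rTensor f w
  rw [show TensorProduct.AlgebraTensorModule.rTensor S J f w = 0 from hw, map_zero] at this
  exact (LinearMap.congr_fun this k).symm

end InjectiveTensor

section TotallyReflexive

variable (S : Type u) [CommRing S]

/-- Total reflexivity, phrased through `ExtVan`. -/
structure TotallyReflexive (X : Type u) [AddCommGroup X] [Module S X] : Prop where
  finite : Module.Finite S X
  reflexive : Module.IsReflexive S X
  ext : ∀ i, ExtVan S (i + 1) X S
  ext_dual : ∀ i, ExtVan S (i + 1) (Module.Dual S X) S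

variable {S} {X X' P : Type u} [AddCommGroup X] [Module S X] [AddCommGroup X'] [Module S X']
  [AddCommGroup P] [Module S P] {f : X' →ₗ[S] P} {g : P →ₗ[S] X}

theorem TotallyReflexive.dual [IsNoetherianRing S] (h : TotallyReflexive S X) :
    TotallyReflexive S (Module.Dual S X) := by
  have := h.finite
  have := h.reflexive
  exact ⟨inferInstance, inferInstance, h.ext_dual,
    fun i => (h.ext i).congr_left (Module.evalEquiv S X)⟩

theorem TotallyReflexive.syzygy [IsNoetherianRing S] (h : TotallyReflexive S X)
    [Module.Finite S P] [Module.Free S P] (hs : IsSES f g) : TotallyReflexive S X' := by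
  have := h.reflexive
  have hd := hs.dual (h.ext 0)
  refine ⟨Module.Finite.of_injective f hs.inj, ⟨?_, ?_⟩,
    fun i => hs.ext_sub_left (extVan_of_projective i) (h.ext (i + 1)), fun i => ?_⟩
  · rw [injective_iff_map_eq_zero]
    intro x hx
    refine hs.inj ((Module.bijective_dual_eval S P).1 ?_)
    rw [map_zero, map_zero]
    ext k
    exact LinearMap.congr_fun hx (f.dualMap k)
  · intro x
    obtain ⟨p, hp⟩ := (Module.bijective_dual_eval S P).2 (x ∘ₗ f.dualMap)
    have hgp : g p = 0 := (Module.bijective_dual_eval S X).1 (by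
      rw [map_zero]
      ext k
      have := LinearMap.congr_fun hp (g.dualMap k)
      simp only [LinearMap.comp_apply, hd.apply_apply, map_zero] at this
      exact this)
    obtain ⟨y, rfl⟩ := (hs.exact p).mp hgp
    refine ⟨y, ?_⟩
    ext k
    obtain ⟨k, rfl⟩ := hd.surj k
    exact LinearMap.congr_fun hp k
  · cases i with
    | zero =>
      refine hd.ext_one_of_extend (extVan_of_projective 0) fun φ => ?_
      obtain ⟨x, rfl⟩ := (Module.bijective_dual_eval S X).2 φ
      obtain ⟨p, rfl⟩ := hs.surj x
      exact ⟨Module.Dual.eval S P p, rfl⟩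
    | succ i => exact hd.ext_quot_left (h.ext_dual i) (extVan_of_projective _)

theorem TotallyReflexive.exists_cosyzygy [IsNoetherianRing S] (h : TotallyReflexive S X) :
    ∃ (P Y : Type u) (_ : AddCommGroup P) (_ : Module S P) (_ : AddCommGroup Y) (_ : Module S Y)
      (f : X →ₗ[S] P) (g : P →ₗ[S] Y), Module.Finite S P ∧ Module.Free S P ∧ IsSES f g ∧
        TotallyReflexive S Y := by
  have := h.finite
  have := h.reflexive
  obtain ⟨L, K, _, _, _, _, a, b, _, _, hab⟩ := exists_finite_free_isSES S (Module.Dual S X)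
  have hd := hab.dual (h.ext_dual 0)
  have he := Module.bijective_dual_eval S X
  exact ⟨_, _, _, _, _, _, b.dualMap ∘ₗ Module.Dual.eval S X, a.dualMap, inferInstance,
    inferInstance, ⟨hd.inj.comp he.1, hd.surj,
      (Function.Surjective.comp_exact_iff_exact (p := Module.Dual.eval S X) he.2).mpr hd.exact⟩,
    (h.dual.syzygy hab).dual⟩

variable (S) in
/-- A bundled totally reflexive module. -/
structure TotallyReflexiveModule where
  carrier : Type u
  [instAdd : AddCommGroup carrier]
  [instMod : Module S carrier]
  prop : TotallyReflexive S carrier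

attribute [local instance] TotallyReflexiveModule.instAdd TotallyReflexiveModule.instMod

/-- A short exact sequence `0 → X → P → Y → 0` with `P` finite free. -/
structure FreeStep (X Y : TotallyReflexiveModule S) where
  P : Type u
  [instAdd : AddCommGroup P]
  [instMod : Module S P]
  f : X.carrier →ₗ[S] P
  g : P →ₗ[S] Y.carrier
  finite : Module.Finite S P
  free : Module.Free S P
  isSES : IsSES f g

attribute [local instance] FreeStep.instAdd FreeStep.instMod

theorem exists_freeStep_right [IsNoetherianRing S] (X : TotallyReflexiveModule S) :
    ∃ Y, Nonempty (FreeStep X Y) := by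
  obtain ⟨P, Y, _, _, _, _, f, g, hP, hP', h, hY⟩ := X.prop.exists_cosyzygy
  exact ⟨⟨Y, hY⟩, ⟨⟨P, f, g, hP, hP', h⟩⟩⟩

theorem exists_freeStep_left [IsNoetherianRing S] (Y : TotallyReflexiveModule S) :
    ∃ X, Nonempty (FreeStep X Y) := by
  have := Y.prop.finite
  obtain ⟨P, X, _, _, _, _, f, g, hP', hP, h⟩ := exists_finite_free_isSES S Y.carrier
  exact ⟨⟨X, Y.prop.syzygy h⟩, ⟨⟨P, f, g, hP, hP', h⟩⟩⟩

/-- A totally reflexive module is a syzygy in a doubly infinite sequence of totally reflexive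
modules. -/
theorem exists_freeStep_chain [IsNoetherianRing S] (X : TotallyReflexiveModule S) :
    ∃ z : ℤ → TotallyReflexiveModule S, z 1 = X ∧ ∀ i, Nonempty (FreeStep (z (i + 1)) (z i)) := by
  choose right hright using exists_freeStep_right (S := S)
  choose left hleft using exists_freeStep_left (S := S)
  refine ⟨fun
    | Int.ofNat 0 => right X
    | Int.ofNat (n + 1) => left^[n] X
    | Int.negSucc n => right^[n + 2] X, rfl, ?_⟩
  rintro ((_ | n) | (_ | n))
  · exact hright X
  · change Nonempty (FreeStep (left^[n + 1] X) (left^[n] X))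
    rw [Function.iterate_succ_apply']
    exact hleft _
  · exact hright (right X)
  · change Nonempty (FreeStep (right^[n + 2] X) (right^[n + 3] X))
    rw [Function.iterate_succ_apply' right (n + 2)]
    exact hright _

theorem TotallyReflexive.isGorensteinFlat [IsNoetherianRing S] (h : TotallyReflexive S X) :
    IsGorensteinFlat S X := by
  obtain ⟨z, hz, hstep⟩ := exists_freeStep_chain (⟨X, h⟩ : TotallyReflexiveModule S)
  let c := fun i => (hstep i).some
  suffices IsGorensteinFlat S (z 1).carrier by rwa [hz] at this
  have hexact : ∀ i, Function.Exact (c (i + 1)).f (c (i + 1)).g := fun i => (c (i + 1)).isSES.exact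
  refine ⟨{
    F := fun i => (c i).P
    d := fun i => (c i).f ∘ₗ (c (i + 1)).g
    flat := fun i => by
      have := (c i).free
      infer_instance
    exact := fun i => ?_
    exact_tensor := fun I _ _ _ i => ?_
    iso := ?_ }⟩
  · rw [Function.Surjective.comp_exact_iff_exact (c _).isSES.surj]
    exact (hexact i).comp_injective _ (c i).isSES.inj (map_zero (c i).f)
  · rw [LinearMap.lTensor_comp, LinearMap.lTensor_comp,
      Function.Surjective.comp_exact_iff_exact (LinearMap.lTensor_surjective I (c _).isSES.surj)]
    have := (z (i + 1)).prop.finite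
    exact (lTensor_exact I (hexact i) (c (i + 1)).isSES.surj).comp_injective _
      (lTensor_injective_of_dualMap_surjective (c i).f
        ((c i).isSES.dual ((z i).prop.ext 0)).surj) (map_zero _)
  · rw [LinearMap.range_comp_of_range_eq_top _ (LinearMap.range_eq_top.mpr (c _).isSES.surj)]
    exact ⟨LinearEquiv.ofInjective _ (c 0).isSES.inj⟩

theorem isGorensteinFlat_of_free [IsNoetherianRing S] [Module.Finite S X] [Module.Free S X] :
    IsGorensteinFlat S X :=
  TotallyReflexive.isGorensteinFlat ⟨inferInstance, inferInstance, extVan_of_projective,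
    extVan_of_projective⟩

end TotallyReflexive

section HomSequence

variable {R S : Type u} [CommRing R] [CommRing S] [Algebra R S] {E : Type u} [AddCommGroup E]
  [Module R E] {X' P X : Type u} [AddCommGroup X'] [Module S X'] [AddCommGroup P] [Module S P]
  [AddCommGroup X] [Module S X] {f : X' →ₗ[S] P} {g : P →ₗ[S] X}

variable (R S X) in
theorem exists_finite_free_isSES_tower [IsNoetherianRing S] [Module.Finite S X] :
    ∃ (P K : Type u) (_ : AddCommGroup P) (_ : Module R P) (_ : Module S P)
      (_ : IsScalarTower R S P) (_ : AddCommGroup K) (_ : Module R K) (_ : Module S K)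
      (_ : IsScalarTower R S K) (f : K →ₗ[S] P) (g : P →ₗ[S] X),
      Module.Free S P ∧ Module.Finite S P ∧ IsSES f g := by
  obtain ⟨P, K, _, _, _, _, f, g, hP, hP', h⟩ := exists_finite_free_isSES S X
  let _ : Module R P := Module.compHom P (algebraMap R S)
  let _ : Module R K := Module.compHom K (algebraMap R S)
  exact ⟨P, K, _, _, _, IsScalarTower.of_algebraMap_smul fun _ _ => rfl, _, _, _,
    IsScalarTower.of_algebraMap_smul fun _ _ => rfl, f, g, hP, hP', h⟩

theorem exists_eq_tmul (hmk : Function.Bijective (TensorProduct.mk R S E))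
    (B : X →ₗ[S] E →ₗ[R] S ⊗[R] E) : ∃ h : X →ₗ[S] S, ∀ x e, B x e = h x ⊗ₜ e := by
  let e := LinearEquiv.ofBijective (TensorProduct.AlgebraTensorModule.mk R S S E) hmk
  exact ⟨e.symm ∘ₗ B, fun x y => (LinearMap.congr_fun (e.apply_symm_apply (B x)) y).symm⟩

theorem ext_of_tmul (hmk : Function.Bijective (TensorProduct.mk R S E)) {h k : X →ₗ[S] S}
    (H : ∀ x (e : E), h x ⊗ₜ[R] e = k x ⊗ₜ e) : h = k :=
  LinearMap.ext fun x => hmk.1 (LinearMap.ext (H x))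

theorem IsSES.hom (hs : IsSES f g) (hX : ExtVan S 1 X (S ⊗[R] E)) :
    IsSES (X := X →ₗ[S] S ⊗[R] E) (Y := P →ₗ[S] S ⊗[R] E) (Z := X' →ₗ[S] S ⊗[R] E)
      (g.lcomp R (S ⊗[R] E)) (f.lcomp R (S ⊗[R] E)) :=
  ⟨fun φ ψ h => LinearMap.ext fun x => by
      obtain ⟨p, rfl⟩ := hs.surj x
      exact LinearMap.congr_fun h p,
    hs.exists_extend hX,
    LinearMap.exact_lcomp_of_exact_of_surjective (S ⊗[R] E) hs.exact hs.surj⟩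

theorem extVan_hom_of_free [IsNoetherianRing R] [Module.Flat R S] [Module.Injective R E]
    [Module.Free S P] [Module.Finite S P] {A : Type u} [AddCommGroup A] [Module R A] (j : ℕ) :
    ExtVan R (j + 1) A (P →ₗ[S] S ⊗[R] E) := by
  have : Module.Flat R (Module.Dual S P) := Module.Flat.trans R S _
  have := injective_flat_tensor (R := R) (F := Module.Dual S P) (E := E)
  let e := LinearEquiv.ofBijective (tensorDual R S E (Module.Dual S P)) tensorDual_bijective
  exact ExtVan.congr_right (X := Module.Dual S P ⊗[R] E) (Y := P →ₗ[S] S ⊗[R] E)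
    (e.restrictScalars R ≪≫ₗ LinearEquiv.congrLeft (S ⊗[R] E) R (Module.evalEquiv S P).symm)
    (extVan_of_injective j)

variable (R S E) in
/-- Finite `S`-modules `X` with `Extⁱ(X, S ⊗ E) = 0` and `Extⁱ(E, Hom(X, S ⊗ E)) = 0` for
all `i ≥ 1`. -/
structure HomAcyclic (X : Type u) [AddCommGroup X] [Module S X] : Prop where
  finite : Module.Finite S X
  ext : ∀ j, ExtVan S (j + 1) X (S ⊗[R] E)
  hom : ∀ j, ExtVan R (j + 1) E (X →ₗ[S] S ⊗[R] E)

variable [IsNoetherianRing R] [IsNoetherianRing S] [Module.Flat R S] [Module.Injective R E]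

theorem HomAcyclic.syzygy (h : HomAcyclic R S E X) [Module.Free S P] [Module.Finite S P]
    (hs : IsSES f g) : HomAcyclic R S E X' :=
  ⟨Module.Finite.of_injective f hs.inj,
    fun j => hs.ext_sub_left (extVan_of_projective j) (h.ext (j + 1)),
    fun j => (hs.hom (h.ext 0)).ext_quot_right (extVan_hom_of_free j) (h.hom (j + 1))⟩

theorem HomAcyclic.extVan_self (hmk : Function.Bijective (TensorProduct.mk R S E))
    (h : HomAcyclic R S E X) (j : ℕ) : ExtVan S (j + 1) X S := by
  induction j generalizing X with
  | zero =>
    have := h.finite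
    obtain ⟨P, X', _, _, _, _, f, g, _, _, hs⟩ := exists_finite_free_isSES S X
    refine hs.ext_one_of_extend (extVan_of_projective 0) fun φ => ?_
    obtain ⟨ψ, hψ⟩ := (hs.hom (h.ext 0)).exists_lift (h.hom 0)
      (TensorProduct.AlgebraTensorModule.mk R S S E ∘ₗ φ).flip
    obtain ⟨k, hk⟩ := exists_eq_tmul hmk ψ.flip
    refine ⟨k, ext_of_tmul hmk fun x e => ?_⟩
    exact (hk (f x) e).symm.trans (LinearMap.congr_fun (LinearMap.congr_fun hψ e) x)
  | succ j ih =>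
    have := h.finite
    obtain ⟨P, X', _, _, _, _, f, g, _, _, hs⟩ := exists_finite_free_isSES S X
    exact hs.ext_quot_left (ih (h.syzygy hs)) (extVan_of_projective _)

end HomSequence

section ScalarExtension

variable {R S : Type u} [CommRing R] [CommRing S] [Algebra R S] {E : Type u} [AddCommGroup E]
  [Module R E] {X' P X : Type u} [AddCommGroup X'] [Module R X'] [Module S X']
  [IsScalarTower R S X'] [AddCommGroup P] [Module R P] [Module S P] [IsScalarTower R S P]
  [AddCommGroup X] [Module R X] [Module S X] [IsScalarTower R S X]
  {f : X' →ₗ[S] P} {g : P →ₗ[S] X}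

theorem IsSES.restrictScalars (hs : IsSES f g) :
    IsSES (f.restrictScalars R) (g.restrictScalars R) :=
  ⟨hs.inj, hs.surj, hs.exact⟩

theorem IsSES.algebraRTensor (hs : IsSES f g) (hX : ExtVan R 1 X (CharacterModule E)) :
    IsSES (TensorProduct.AlgebraTensorModule.rTensor R E f)
      (TensorProduct.AlgebraTensorModule.rTensor R E g) :=
  have h := IsSES.rTensor (E := E) (hs.restrictScalars (R := R))
    ((hs.restrictScalars (R := R)).rTensor_injective_of_ext hX)
  ⟨h.inj, h.surj, h.exact⟩

theorem extVan_tensor_of_free [IsNoetherianRing R] [Module.Flat R S] [Module.Injective R E]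
    [Module.Free S P] [Module.Finite S P] (j : ℕ) : ExtVan S (j + 1) (P ⊗[R] E) (S ⊗[R] E) := by
  classical
  have := injective_flat_tensor (R := R) (F := S) (E := E)
  let b := Module.Free.chooseBasis S P
  let e : S ⊗[R] ((Module.Free.ChooseBasisIndex S P →₀ R) ⊗[R] E) ≃ₗ[S] P ⊗[R] E :=
    (TensorProduct.AlgebraTensorModule.assoc R R S S _ E).symm ≪≫ₗ
      TensorProduct.AlgebraTensorModule.congr
        (TensorProduct.finsuppScalarRight R S S _ ≪≫ₗ b.repr.symm) (LinearEquiv.refl R E)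
  have h : ExtVan R (j + 1) ((Module.Free.ChooseBasisIndex S P →₀ R) ⊗[R] E) (S ⊗[R] E) :=
    extVan_of_injective j
  exact (h.baseChange j).congr_left e

variable (R S E) in
/-- Finite `S`-modules `X`, acyclic over `R`, with `Extⁱ(X ⊗ E, S ⊗ E) = 0` for all `i ≥ 1`. -/
structure FiberAcyclic (X : Type u) [AddCommGroup X] [Module R X] [Module S X]
    [IsScalarTower R S X] : Prop where
  finite : Module.Finite S X
  acyclic : EventuallyAcyclic R E 0 X
  ext : ∀ j, ExtVan S (j + 1) (X ⊗[R] E) (S ⊗[R] E)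

variable [IsNoetherianRing R] [IsNoetherianRing S] [Module.Flat R S] [Module.Injective R E]

theorem FiberAcyclic.syzygy (h : FiberAcyclic R S E X) [Module.Free S P] [Module.Finite S P]
    (hs : IsSES f g) : FiberAcyclic R S E X' := by
  have : Module.Flat R P := Module.Flat.trans R S P
  exact ⟨Module.Finite.of_injective f hs.inj, h.acyclic.syzygy_zero hs.restrictScalars, fun j =>
    (hs.algebraRTensor (h.acyclic.tensorAcyclic.tor 0)).ext_sub_left (extVan_tensor_of_free j)
      (h.ext (j + 1))⟩

theorem FiberAcyclic.extVan_self (hmk : Function.Bijective (TensorProduct.mk R S E))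
    (h : FiberAcyclic R S E X) (j : ℕ) : ExtVan S (j + 1) X S := by
  induction j generalizing X with
  | zero =>
    have := h.finite
    obtain ⟨P, X', _, _, _, _, _, _, _, _, f, g, _, _, hs⟩ := exists_finite_free_isSES_tower R S X
    refine hs.ext_one_of_extend (extVan_of_projective 0) fun φ => ?_
    obtain ⟨ψ, hψ⟩ := (hs.algebraRTensor (h.acyclic.tensorAcyclic.tor 0)).exists_extend (h.ext 0)
      (TensorProduct.AlgebraTensorModule.rTensor R E φ)
    obtain ⟨k, hk⟩ := exists_eq_tmul hmk (TensorProduct.AlgebraTensorModule.curry ψ)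
    refine ⟨k, ext_of_tmul hmk fun x e => ?_⟩
    exact (hk (f x) e).symm.trans (LinearMap.congr_fun hψ (x ⊗ₜ e))
  | succ j ih =>
    have := h.finite
    obtain ⟨P, X', _, _, _, _, _, _, _, _, f, g, _, _, hs⟩ := exists_finite_free_isSES_tower R S X
    exact hs.ext_quot_left (ih (h.syzygy hs)) (extVan_of_projective _)

theorem FiberAcyclic.extVan_dual (hmk : Function.Bijective (TensorProduct.mk R S E)) {d : ℕ}
    (hW : ∀ (X : Type u) [AddCommGroup X] [Module S X] (i : ℕ), ExtVan S (d + i + 1) X (S ⊗[R] E))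
    (h : FiberAcyclic R S E X) (j : ℕ) : ExtVan S (j + 1) (Module.Dual S X) (S ⊗[R] E) := by
  suffices ∀ k, ∀ j, d ≤ j + k → ExtVan S (j + 1) (Module.Dual S X) (S ⊗[R] E) from
    this d j (Nat.le_add_left d j)
  intro k
  induction k generalizing X with
  | zero =>
    intro j hj
    obtain ⟨i, rfl⟩ := Nat.exists_eq_add_of_le hj
    exact hW _ i
  | succ k ih =>
    intro j hj
    have := h.finite
    obtain ⟨P, X', _, _, _, _, _, _, _, _, f, g, _, _, hs⟩ := exists_finite_free_isSES_tower R S X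
    exact (hs.dual (h.extVan_self hmk 0)).ext_sub_left (extVan_of_projective j)
      (ih (h.syzygy hs) (j + 1) (by omega))

theorem FiberAcyclic.tensorDual_surjective (hmk : Function.Bijective (TensorProduct.mk R S E))
    {d : ℕ}
    (hW : ∀ (X : Type u) [AddCommGroup X] [Module S X] (i : ℕ), ExtVan S (d + i + 1) X (S ⊗[R] E))
    (h : FiberAcyclic R S E X) : Function.Surjective (tensorDual R S E X) := by
  have := h.finite
  obtain ⟨P, X', _, _, _, _, _, _, _, _, f, g, _, _, hs⟩ := exists_finite_free_isSES_tower R S X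
  exact _root_.tensorDual_surjective (g := g) ((hs.dual (h.extVan_self hmk 0)).exists_extend
    ((h.syzygy hs).extVan_dual hmk hW 0))

theorem FiberAcyclic.tensorDual_bijective (hmk : Function.Bijective (TensorProduct.mk R S E))
    {d : ℕ}
    (hW : ∀ (X : Type u) [AddCommGroup X] [Module S X] (i : ℕ), ExtVan S (d + i + 1) X (S ⊗[R] E))
    (h : FiberAcyclic R S E X) : Function.Bijective (tensorDual R S E X) := by
  refine ⟨?_, h.tensorDual_surjective hmk hW⟩
  have := h.finite
  obtain ⟨P, X', _, _, _, _, _, _, _, _, f, g, _, _, hs⟩ := exists_finite_free_isSES_tower R S X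
  have hd := hs.dual (h.extVan_self hmk 0)
  refine tensorDual_injective hs ((h.syzygy hs).tensorDual_surjective hmk hW) fun ψ hψ => ?_
  obtain ⟨χ, hχ⟩ :=
    (LinearMap.exact_lcomp_of_exact_of_surjective (S ⊗[R] E) hd.exact hd.surj ψ).mp hψ
  exact ⟨χ, hχ.symm⟩

theorem FiberAcyclic.homAcyclic_dual (hmk : Function.Bijective (TensorProduct.mk R S E))
    {d : ℕ}
    (hW : ∀ (X : Type u) [AddCommGroup X] [Module S X] (i : ℕ), ExtVan S (d + i + 1) X (S ⊗[R] E))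
    (h : FiberAcyclic R S E X) : HomAcyclic R S E (Module.Dual S X) := by
  have := h.finite
  let e := LinearEquiv.ofBijective _ (h.tensorDual_bijective hmk hW)
  exact ⟨inferInstance, h.extVan_dual hmk hW, fun j =>
    (h.acyclic.tensorAcyclic.ext j).congr_right (e.restrictScalars R)⟩

theorem FiberAcyclic.eval_surjective (hmk : Function.Bijective (TensorProduct.mk R S E)) {d : ℕ}
    (hW : ∀ (X : Type u) [AddCommGroup X] [Module S X] (i : ℕ), ExtVan S (d + i + 1) X (S ⊗[R] E))
    (h : FiberAcyclic R S E X) : Function.Surjective (Module.Dual.eval S X) := by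
  have := h.finite
  obtain ⟨P, X', _, _, _, _, _, _, _, _, f, g, _, _, hs⟩ := exists_finite_free_isSES_tower R S X
  intro x
  obtain ⟨y, rfl⟩ := (hs.dual (h.extVan_self hmk 0)).exists_extend
    (((h.syzygy hs).homAcyclic_dual hmk hW).extVan_self hmk 0) x
  obtain ⟨p, rfl⟩ := (Module.bijective_dual_eval S P).2 y
  exact ⟨g p, rfl⟩

theorem FiberAcyclic.totallyReflexive (hmk : Function.Bijective (TensorProduct.mk R S E)) {d : ℕ}
    (hW : ∀ (X : Type u) [AddCommGroup X] [Module S X] (i : ℕ), ExtVan S (d + i + 1) X (S ⊗[R] E))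
    (h : FiberAcyclic R S E X) : TotallyReflexive S X := by
  have := h.finite
  obtain ⟨P, X', _, _, _, _, _, _, _, _, f, g, _, _, hs⟩ := exists_finite_free_isSES_tower R S X
  refine ⟨h.finite, ⟨?_, h.eval_surjective hmk hW⟩, h.extVan_self hmk,
    (h.homAcyclic_dual hmk hW).extVan_self hmk⟩
  rw [injective_iff_map_eq_zero]
  intro x hx
  obtain ⟨p, rfl⟩ := hs.surj x
  have hd := hs.dual (h.extVan_self hmk 0)
  obtain ⟨y, hy⟩ := (hd.exact_dualMap (Module.Dual.eval S P p)).mp hx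
  obtain ⟨x', rfl⟩ := (h.syzygy hs).eval_surjective hmk hW y
  rw [← (Module.bijective_dual_eval S P).1 (a₁ := f x') hy]
  exact hs.apply_apply x'

theorem gfdLE_of_ext (hmk : Function.Bijective (TensorProduct.mk R S E)) {d : ℕ}
    (hW : ∀ (X : Type u) [AddCommGroup X] [Module S X] (i : ℕ), ExtVan S (d + i + 1) X (S ⊗[R] E))
    [Module.Finite S X] (hX : EventuallyAcyclic R E 0 X) {t : ℕ}
    (hext : ∀ j, ExtVan S (t + j + 1) (X ⊗[R] E) (S ⊗[R] E)) : gfdLE S t X := by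
  induction t generalizing X with
  | zero =>
    have h : FiberAcyclic R S E X := ⟨‹_›, hX, fun j => by simpa using hext j⟩
    exact (h.totallyReflexive hmk hW).isGorensteinFlat
  | succ t ih =>
    obtain ⟨P, K, _, _, _, _, _, _, _, _, f, g, _, _, hs⟩ := exists_finite_free_isSES_tower R S X
    have hs := IsSES.of_ker hs.surj
    have : Module.Flat R P := Module.Flat.trans R S P
    refine ⟨⟨P, g, isGorensteinFlat_of_free, hs.surj⟩,
      ih (hX.syzygy_zero hs.restrictScalars) fun j =>
        (hs.algebraRTensor (hX.tensorAcyclic.tor 0)).ext_sub_left (extVan_tensor_of_free _) ?_⟩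
    rw [show t + j + 1 + 1 = t + 1 + j + 1 by omega]
    exact hext j

theorem EventuallyAcyclic.gfdLE (hmk : Function.Bijective (TensorProduct.mk R S E)) {d : ℕ}
    (hW : ∀ (X : Type u) [AddCommGroup X] [Module S X] (i : ℕ), ExtVan S (d + i + 1) X (S ⊗[R] E))
    [Module.Finite S X] {n : ℕ} (hX : EventuallyAcyclic R E n X) : gfdLE S (n + d) X := by
  induction n generalizing X with
  | zero =>
    rw [Nat.zero_add]
    exact gfdLE_of_ext hmk hW hX (hW _)
  | succ n ih =>
    obtain ⟨P, K, _, _, _, _, _, _, _, _, f, g, _, _, hs⟩ := exists_finite_free_isSES_tower R S X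
    have hs := IsSES.of_ker hs.surj
    have : Module.Flat R P := Module.Flat.trans R S P
    rw [Nat.succ_add]
    exact ⟨⟨P, g, isGorensteinFlat_of_free, hs.surj⟩,
      ih (hX P _ _ _ inferInstance hs.restrictScalars)⟩

end ScalarExtension

theorem IsAdicComplete.of_le_maximalIdeal {S : Type*} [CommRing S] [IsLocalRing S]
    [IsNoetherianRing S] [IsAdicComplete (maximalIdeal S) S] {I : Ideal S}
    (hI : I ≤ maximalIdeal S) : IsAdicComplete I S where
  toIsHausdorff := IsHausdorff.of_le_jacobson I S (hI.trans (maximalIdeal_le_jacobson _))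
  prec' f hf := by
    obtain ⟨L, hL⟩ := IsPrecomplete.prec (I := maximalIdeal S) inferInstance fun {m n} h =>
      (hf h).mono (Submodule.smul_mono_left (Ideal.pow_right_mono hI m))
    refine ⟨L, fun n => ?_⟩
    simp only [SModEq.sub_mem, smul_eq_mul, Ideal.mul_top] at hf hL ⊢
    rw [← Ideal.Quotient.eq_zero_iff_mem]
    refine IsHausdorff.haus (I := maximalIdeal S) inferInstance _ fun k => ?_
    rw [SModEq.zero]
    have h1 : Ideal.Quotient.mk (I ^ n) (f n - L) =
        (f (max n k) - L) • (1 : S ⧸ I ^ n) := by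
      rw [Algebra.smul_def, mul_one]
      exact Ideal.Quotient.eq.mpr (by simpa using hf (le_max_left n k))
    rw [h1]
    exact Submodule.smul_mem_smul (Ideal.pow_le_pow_right (le_max_right n k) (hL _)) trivial

theorem IsLocalRing.map_quotientMk_maximalIdeal {S : Type*} [CommRing S] [IsLocalRing S]
    {I : Ideal S} [IsLocalRing (S ⧸ I)] :
    (maximalIdeal S).map (Ideal.Quotient.mk I) = maximalIdeal (S ⧸ I) := by
  have := Ideal.comap_isMaximal_of_surjective (Ideal.Quotient.mk I) Ideal.Quotient.mk_surjective
    (K := maximalIdeal (S ⧸ I))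
  rw [← eq_maximalIdeal this, Ideal.map_comap_of_surjective _ Ideal.Quotient.mk_surjective]

theorem ENat.sInf_coe_image_eq_top_or (p : ℕ → Prop) :
    sInf ((↑) '' {n | p n} : Set ℕ∞) = ⊤ ∨ ∃ n, p n ∧ sInf ((↑) '' {n | p n} : Set ℕ∞) = n := by
  rcases Set.eq_empty_or_nonempty {n | p n} with h | h
  · simp [h]
  · obtain ⟨n, hn, h'⟩ := csInf_mem (h.image ((↑) : ℕ → ℕ∞))
    exact Or.inr ⟨n, hn, h'.symm⟩

theorem gfdLE.gfd_le {R M : Type u} [CommRing R] [AddCommGroup M] [Module R M] {n : ℕ}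
    (h : gfdLE R n M) : gfd R M ≤ n :=
  sInf_le ⟨n, h, rfl⟩

theorem gfdLE.scalarExtension {R S : Type u} [CommRing R] [CommRing S] [IsLocalRing R]
    [IsLocalRing S] [IsNoetherianRing R] [IsNoetherianRing S] [Algebra R S]
    [IsLocalHom (algebraMap R S)] [Module.Flat R S] [IsAdicComplete (maximalIdeal S) S]
    (hfib : IsGorensteinLocal (S ⧸ (maximalIdeal R).map (algebraMap R S)))
    {M : Type u} [AddCommGroup M] [Module R M] [Module S M] [IsScalarTower R S M]
    [Module.Finite S M] {g i : ℕ} (hM : gfdLE R g M)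
    (hi : ¬ Subsingleton (extModule (S ⧸ (maximalIdeal R).map (algebraMap R S)) i
      ((S ⧸ (maximalIdeal R).map (algebraMap R S)) ⧸ (maximalIdeal S).map
        (Ideal.Quotient.mk ((maximalIdeal R).map (algebraMap R S))))
      (S ⧸ (maximalIdeal R).map (algebraMap R S)))) : gfd S M ≤ g + i := by
  classical
  obtain ⟨_, _, hid⟩ := hfib
  rcases ENat.sInf_coe_image_eq_top_or
    fun n => idLE (S ⧸ (maximalIdeal R).map (algebraMap R S)) n
      (S ⧸ (maximalIdeal R).map (algebraMap R S)) with h | ⟨N, hN, -⟩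
  · exact absurd h hid.ne
  have hle : (maximalIdeal R).map (algebraMap R S) ≤ maximalIdeal S :=
    map_maximalIdeal_le (algebraMap R S)
  rw [IsLocalRing.map_quotientMk_maximalIdeal] at hi
  have hex : ∃ i, ¬ ExtVan (S ⧸ (maximalIdeal R).map (algebraMap R S)) i
      ((S ⧸ (maximalIdeal R).map (algebraMap R S)) ⧸ maximalIdeal _)
      (S ⧸ (maximalIdeal R).map (algebraMap R S)) := ⟨i, fun h => hi h.subsingleton_extModule⟩
  let d := Nat.find hex
  have hd : d ≤ i := Nat.find_min' hex fun h => hi h.subsingleton_extModule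
  obtain ⟨E, _, _, hE⟩ := exists_isMatlis R
  have := hE.injective
  have : IsAdicComplete (maximalIdeal R) S := by
    rw [← IsAdicComplete.map_algebraMap_iff (S := S)]
    exact .of_le_maximalIdeal hle
  have hW := hE.extVan_baseChange (S := S) (d := d) fun N _ _ _ j =>
    extVan_self_of_depth_lt hN (fun k hk => not_not.mp (Nat.find_min hex hk)) (Nat.find_spec hex)
      (by omega) N
  refine ((hM.eventuallyAcyclic hE).gfdLE hE.bijective_mk fun X _ _ j => hW j X).gfd_le.trans ?_
  exact_mod_cast Nat.add_le_add_left hd g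

/-- If `f : R → S` is a flat local homomorphism of complete noetherian local rings with
Gorenstein closed fiber `S/mS` and `M` is a finitely generated `S`-module, then
`Gfd_S M ≤ Gfd_R M + depth (n/mS, S/mS)`. -/
theorem gfd_le_gfd_add_depth_fiber {R S : Type u} [CommRing R] [CommRing S]
    [IsLocalRing R] [IsLocalRing S] [IsNoetherianRing R] [IsNoetherianRing S]
    (f : R →+* S) (hloc : IsLocalHom f) (hflat : f.Flat)
    (hRc : IsAdicComplete (IsLocalRing.maximalIdeal R) R)
    (hSc : IsAdicComplete (IsLocalRing.maximalIdeal S) S)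
    (hfib : IsGorensteinLocal (S ⧸ (IsLocalRing.maximalIdeal R).map f))
    (M : Type u) [AddCommGroup M] [Module S M] [Module.Finite S M] :
    gfd S M ≤ gfdAlong f M +
      idealDepth (S ⧸ (IsLocalRing.maximalIdeal R).map f)
        ((IsLocalRing.maximalIdeal S).map
          (Ideal.Quotient.mk ((IsLocalRing.maximalIdeal R).map f)))
        (S ⧸ (IsLocalRing.maximalIdeal R).map f) := by
  let _ := f.toAlgebra
  let _ : Module R M := Module.compHom M f
  have : IsScalarTower R S M := IsScalarTower.of_algebraMap_smul fun _ _ => rfl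
  have : IsLocalHom (algebraMap R S) := hloc
  have : Module.Flat R S := hflat
  rcases ENat.sInf_coe_image_eq_top_or fun n => gfdLE R n M with hg | ⟨g, hM, hg⟩
  · rw [show gfdAlong f M = ⊤ from hg, top_add]
    exact le_top
  rcases ENat.sInf_coe_image_eq_top_or fun i => ¬ Subsingleton (extModule
      (S ⧸ (maximalIdeal R).map f) i ((S ⧸ (maximalIdeal R).map f) ⧸
        (maximalIdeal S).map (Ideal.Quotient.mk ((maximalIdeal R).map f)))
      (S ⧸ (maximalIdeal R).map f)) with hd | ⟨i, hi, hd⟩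
  · rw [idealDepth, hd, add_top]
    exact le_top
  rw [show gfdAlong f M = g from hg, idealDepth, hd]
  exact hM.scalarExtension hfib hi
end

section
/- Let (R,m,k) be a noetherian local ring and let M be a non-zero R-module that is either finitely generated or artinian. Let E_R(k) denote the injective envelope of the residue field k, and let type_R(M) = rank_k(Ext_R^{depth_R(m,M)}(k,M)). Then M is an injective R-module if and only if M is isomorphic to E_R(k)^{type_R(M)}, the direct sum of type_R(M) copies of E_R(k). -/
/- ## Preliminary definitions -/

universe u

open IsLocalRing

/- ## The type of a module -/

noncomputable section

/-- The type of a module over a local ring: the dimension over the residue field `k` of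
`Ext_R^{depth M}(k, M)`, defined here as the unique `n` such that this Ext module is
isomorphic to `kⁿ` as an `R`-module. -/
def moduleType (R : Type u) [CommRing R] [IsLocalRing R] (M : Type u) [AddCommGroup M]
    [Module R M] : ℕ :=
  sInf { n : ℕ |
    Nonempty
      ((extModule R ((idealDepth R (IsLocalRing.maximalIdeal R) M).toNat)
          (IsLocalRing.ResidueField R) M) ≃ₗ[R]
        (Fin n → IsLocalRing.ResidueField R)) }

end
section

open IsLocalRing CategoryTheory Limits Submodule

/-- `Ext_R^0(N, M)` is `Hom_R(N, M)`. -/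
noncomputable def extModuleZeroEquiv (R : Type u) [CommRing R] (N M : Type u) [AddCommGroup N]
    [Module R N] [AddCommGroup M] [Module R M] : extModule R 0 N M ≃ₗ[R] (N →ₗ[R] M) := by
  let F := (linearYoneda R (ModuleCat.{u} R)).obj (ModuleCat.of R M)
  have : PreservesLimits (F ⋙ forget (ModuleCat.{u} R)) :=
    inferInstanceAs (PreservesLimits (yoneda.obj (ModuleCat.of R M)))
  have : PreservesLimits F := preservesLimits_of_reflects_of_preserves F (forget _)
  have : PreservesFiniteColimits F.rightOp := preservesFiniteColimits_rightOp F
  exact ((F.rightOp.leftDerivedZeroIsoSelf.app (ModuleCat.of R N)).unop.symm.toLinearEquiv :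
      extModule R 0 N M ≃ₗ[R] (ModuleCat.of R N ⟶ ModuleCat.of R M)) ≪≫ₗ ModuleCat.homLinearEquiv

/-- `Hom_R(R/I, M)` is the submodule of elements of `M` killed by `I`. -/
noncomputable def quotientHomEquivTorsionBySet {R : Type*} [CommRing R] (I : Ideal R) (M : Type*)
    [AddCommGroup M] [Module R M] : ((R ⧸ I) →ₗ[R] M) ≃ₗ[R] torsionBySet R M I where
  toFun f := ⟨f 1, (mem_torsionBySet_iff _ _).2 fun a => by
    rw [← map_smul, Algebra.smul_def, mul_one, Ideal.Quotient.algebraMap_eq,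
      Ideal.Quotient.eq_zero_iff_mem.2 a.2, map_zero]⟩
  map_add' _ _ := rfl
  map_smul' _ _ := rfl
  invFun x := I.liftQ (LinearMap.toSpanSingleton R M x) fun a ha =>
    (mem_torsionBySet_iff _ _).1 x.2 ⟨a, ha⟩
  left_inv f := by
    refine Submodule.linearMap_qext _ (LinearMap.ext_ring ?_)
    exact one_smul R (f 1)
  right_inv x := Subtype.ext (one_smul R (x : M))

/-- If `y` and `y ^ 2` have the same kernel on an injective module `M`, then `yM = y²M`. -/
theorem Module.Injective.exists_smul_eq_sq_smul {R M : Type u} [CommRing R] [AddCommGroup M]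
    [Module R M] [Module.Injective R M] {y : R} (hy : ∀ m : M, y • y • m = 0 → y • m = 0) (m : M) :
    ∃ m' : M, y • m = y • y • m' := by
  let p : R →ₗ[R] R := LinearMap.toSpanSingleton R R (y * y)
  have hker : LinearMap.ker p ≤ LinearMap.ker (LinearMap.toSpanSingleton R M (y • m)) := by
    intro r hr
    simp only [LinearMap.mem_ker, LinearMap.toSpanSingleton_apply, smul_eq_mul, p] at hr ⊢
    rw [smul_comm]
    apply hy
    rw [smul_smul, smul_smul, mul_comm, hr, zero_smul]
  obtain ⟨h, hh⟩ := Module.Injective.extension_property R M _ _ ((LinearMap.ker p).liftQ p le_rfl)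
    (LinearMap.ker_eq_bot.1 (Submodule.ker_liftQ_eq_bot _ _ _ le_rfl))
    ((LinearMap.ker p).liftQ _ hker)
  refine ⟨h 1, ?_⟩
  have := LinearMap.congr_fun hh (Submodule.Quotient.mk 1)
  simp only [LinearMap.comp_apply, liftQ_apply, LinearMap.toSpanSingleton_apply, one_smul, p] at this
  rw [← this, smul_smul, ← map_smul, smul_eq_mul, mul_one]

/-- A finitely generated injective module over a noetherian local ring is killed by a power of
the maximal ideal. -/
theorem Module.Injective.exists_maximalIdeal_pow_le_annihilator {R : Type u} [CommRing R]
    [IsLocalRing R] [IsNoetherianRing R] (M : Type u) [AddCommGroup M] [Module R M]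
    [Module.Finite R M] [Module.Injective R M] :
    ∃ n : ℕ, maximalIdeal R ^ n ≤ Module.annihilator R M := by
  refine Ideal.exists_pow_le_of_le_radical_of_fg (fun x hx => ?_) (IsNoetherian.noetherian _)
  obtain ⟨n, hn⟩ := monotone_stabilizes_iff_noetherian.mpr (inferInstance : IsNoetherian R M)
    (LinearMap.lsmul R M x).iterateKer
  have hpow (k : ℕ) (m : M) : ((LinearMap.lsmul R M x) ^ k) m = x ^ k • m := by
    induction k with
    | zero => simp
    | succ k ih => rw [pow_succ', Module.End.mul_apply, ih, pow_succ', mul_smul]; rfl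
  have hker (k : ℕ) (hk : n ≤ k) (m : M) (h : x ^ k • m = 0) : x ^ n • m = 0 := by
    have h' : m ∈ (LinearMap.lsmul R M x).iterateKer k := by
      exact LinearMap.mem_ker.2 ((hpow k m).trans h)
    rw [← hn k hk] at h'
    exact (hpow n m).symm.trans (LinearMap.mem_ker.1 h')
  set y := x ^ (n + 1) with hy
  have hy2 (m : M) (h : y • y • m = 0) : y • m = 0 := by
    rw [smul_smul, hy, ← pow_add] at h
    rw [hy, pow_succ', mul_smul, hker _ (by omega) m h, smul_zero]
  have hbot : (LinearMap.range (LinearMap.lsmul R M y)) = ⊥ := by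
    refine Submodule.eq_bot_of_le_smul_of_le_jacobson_bot (maximalIdeal R) _
      (IsNoetherian.noetherian _) ?_ (IsLocalRing.maximalIdeal_le_jacobson _)
    rintro _ ⟨m, rfl⟩
    obtain ⟨m', hm'⟩ := Module.Injective.exists_smul_eq_sq_smul hy2 m
    rw [LinearMap.lsmul_apply, hm']
    exact Submodule.smul_mem_smul (Ideal.pow_mem_of_mem _ hx _ n.succ_pos) ⟨m', rfl⟩
  refine ⟨n + 1, Module.mem_annihilator.2 fun m => ?_⟩
  exact (Submodule.mem_bot R).1 (hbot ▸ ⟨m, rfl⟩ : y • m ∈ (⊥ : Submodule R M))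

/-- If a power of `I` kills `M`, the elements killed by `I` form an essential submodule. -/
theorem inf_torsionBySet_ne_bot_of_pow_le_annihilator {R M : Type*} [CommRing R] [AddCommGroup M]
    [Module R M] {I : Ideal R} {n : ℕ} (hn : I ^ n ≤ Module.annihilator R M) {N : Submodule R M}
    (hN : N ≠ ⊥) : N ⊓ torsionBySet R M I ≠ ⊥ := by
  classical
  have hex : ∃ k, I ^ k • N = ⊥ := ⟨n, by
    refine eq_bot_iff.2 (Submodule.smul_le.2 fun r hr m _ => ?_)
    exact Module.mem_annihilator.1 (hn hr) m⟩
  obtain ⟨k, hk⟩ : ∃ k, Nat.find hex = k + 1 := Nat.exists_eq_succ_of_ne_zero fun h0 => hN <| by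
    simpa [h0] using Nat.find_spec hex
  have hne : I ^ k • N ≠ ⊥ := Nat.find_min hex (by omega)
  have hbot : I ^ (k + 1) • N = ⊥ := hk ▸ Nat.find_spec hex
  refine fun h => hne (eq_bot_iff.2 (h ▸ le_inf Submodule.smul_le_right fun m hm => ?_))
  refine (mem_torsionBySet_iff _ _).2 fun a => (Submodule.mem_bot R).1 ?_
  rw [← hbot, pow_succ', Submodule.mul_smul]
  exact Submodule.smul_mem_smul a.2 hm

/-- The socle of an artinian module over a local ring is essential. -/
theorem IsArtinian.inf_torsionBySet_maximalIdeal_ne_bot {R M : Type*} [CommRing R] [IsLocalRing R]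
    [AddCommGroup M] [Module R M] [IsArtinian R M] {N : Submodule R M} (hN : N ≠ ⊥) :
    N ⊓ torsionBySet R M (maximalIdeal R) ≠ ⊥ := by
  have : IsAtomic (Submodule R M) := isAtomic_of_orderBot_wellFounded_lt wellFounded_lt
  obtain ⟨A, hA, hAN⟩ := (eq_bot_or_exists_atom_le N).resolve_left hN
  have : IsSimpleModule R A := isSimpleModule_iff_isAtom.2 hA
  have hmax : Module.annihilator R A = maximalIdeal R :=
    IsLocalRing.eq_maximalIdeal IsSimpleModule.annihilator_isMaximal
  refine fun h => hA.1 (eq_bot_iff.2 (h ▸ le_inf hAN fun m hm => ?_))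
  refine (mem_torsionBySet_iff _ _).2 fun a => ?_
  exact congrArg Subtype.val (Module.mem_annihilator.1 (hmax.ge a.2) (⟨m, hm⟩ : A))

/-- A finite power of an essential submodule is essential. -/
theorem Submodule.inf_pi_ne_bot {R E ι : Type*} [Finite ι] [CommRing R] [AddCommGroup E]
    [Module R E] {K : Submodule R E} (hK : ∀ N : Submodule R E, N ≠ ⊥ → N ⊓ K ≠ ⊥)
    {N : Submodule R (ι → E)} (hN : N ≠ ⊥) : N ⊓ Submodule.pi Set.univ (fun _ => K) ≠ ⊥ := by
  classical
  have := Fintype.ofFinite ι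
  have key (s : Finset ι) : ∃ v ∈ N, v ≠ 0 ∧ ∀ i ∈ s, v i ∈ K := by
    induction s using Finset.induction_on with
    | empty =>
      obtain ⟨v, hv, hv0⟩ := Submodule.exists_mem_ne_zero_of_ne_bot hN
      exact ⟨v, hv, hv0, by simp⟩
    | insert i s _ ih =>
      obtain ⟨v, hv, hv0, hvs⟩ := ih
      by_cases hi : v i = 0
      · exact ⟨v, hv, hv0, fun j hj => (Finset.mem_insert.1 hj).elim
          (fun h => h ▸ hi ▸ K.zero_mem) (hvs j)⟩
      · obtain ⟨w, hw, hw0⟩ := Submodule.exists_mem_ne_zero_of_ne_bot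
          (hK (R ∙ v i) (by simpa using hi))
        obtain ⟨t, rfl⟩ := Submodule.mem_span_singleton.1 hw.1
        refine ⟨t • v, N.smul_mem t hv, fun h => hw0 (congrFun h i), fun j hj => ?_⟩
        exact (Finset.mem_insert.1 hj).elim (fun h => h ▸ hw.2) fun h => K.smul_mem t (hvs j h)
  obtain ⟨v, hv, hv0, hvK⟩ := key Finset.univ
  exact (Submodule.ne_bot_iff _).2 ⟨v, ⟨hv, fun i _ => hvK i (Finset.mem_univ i)⟩, hv0⟩

/-- An injective module with essential submodule `S ≅ kⁿ` is isomorphic to `E(k)ⁿ`. -/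
theorem Module.Injective.nonempty_equiv_pi_injEnv {R : Type u} [CommRing R] [IsLocalRing R]
    {M E : Type u} [AddCommGroup M] [Module R M] [Module.Injective R M] [AddCommGroup E]
    [Module R E] (hE : IsInjEnvResidueField R E) {S : Submodule R M}
    (hS : ∀ N : Submodule R M, N ≠ ⊥ → N ⊓ S ≠ ⊥) {n : ℕ}
    (e : S ≃ₗ[R] (Fin n → ResidueField R)) : Nonempty (M ≃ₗ[R] (Fin n → E)) := by
  obtain ⟨hinj, ι, hι, hess⟩ := hE
  let j : (Fin n → ResidueField R) →ₗ[R] (Fin n → E) := ι.compLeft (Fin n)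
  have hj : Function.Injective j := fun a b h => funext fun i => hι (congrFun h i)
  obtain ⟨f, hf⟩ := Module.Injective.extension_property R (Fin n → E) _ _ S.subtype
    S.subtype_injective (j ∘ₗ e.toLinearMap)
  have hfS (s : S) : f s = j (e s) := LinearMap.congr_fun hf s
  have hfker : LinearMap.ker f = ⊥ := by
    by_contra h
    refine hS _ h (eq_bot_iff.2 ?_)
    rintro x ⟨hx, hxS⟩
    have h0 : j (e ⟨x, hxS⟩) = j 0 := by rw [← hfS, map_zero]; exact hx
    exact congrArg Subtype.val (e.map_eq_zero_iff.1 (hj h0))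
  have hfinj : Function.Injective f := LinearMap.ker_eq_bot.1 hfker
  obtain ⟨g, hg⟩ := Module.Injective.extension_property R M _ _ f hfinj LinearMap.id
  have hgf (m : M) : g (f m) = m := LinearMap.congr_fun hg m
  have hgker : LinearMap.ker g = ⊥ := by
    by_contra h
    refine Submodule.inf_pi_ne_bot hess h (eq_bot_iff.2 ?_)
    rintro v ⟨hv, hvK⟩
    choose a ha using fun i => hvK i (Set.mem_univ i)
    have hfv : f (e.symm a) = v := by
      rw [hfS, e.apply_symm_apply]
      exact funext ha
    have h0 := hgf (e.symm a)
    rw [hfv, LinearMap.mem_ker.1 hv] at h0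
    rw [Submodule.mem_bot, ← hfv, ← h0, map_zero]
  exact ⟨(LinearEquiv.ofBijective g ⟨LinearMap.ker_eq_bot.1 hgker, fun m => ⟨f m, hgf m⟩⟩).symm⟩

/-- The socle of a module over a local ring is a vector space over the residue field. -/
noncomputable instance torsionBySet_maximalIdeal_module {R M : Type*} [CommRing R] [IsLocalRing R]
    [AddCommGroup M] [Module R M] :
    Module (ResidueField R) (torsionBySet R M (maximalIdeal R)) :=
  inferInstanceAs (Module (R ⧸ maximalIdeal R) (torsionBySet R M (maximalIdeal R)))

instance torsionBySet_maximalIdeal_isScalarTower {R M : Type*} [CommRing R] [IsLocalRing R]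
    [AddCommGroup M] [Module R M] :
    IsScalarTower R (ResidueField R) (torsionBySet R M (maximalIdeal R)) :=
  inferInstanceAs (IsScalarTower R (R ⧸ maximalIdeal R) (torsionBySet R M (maximalIdeal R)))

/-- If the socle of `M` is nonzero and finite-dimensional, its dimension is the type of `M`. -/
theorem nonempty_socle_equiv_pi_moduleType {R : Type u} [CommRing R] [IsLocalRing R] (M : Type u)
    [AddCommGroup M] [Module R M] (hS : torsionBySet R M (maximalIdeal R) ≠ ⊥)
    [Module.Finite (ResidueField R) (torsionBySet R M (maximalIdeal R))] :
    Nonempty (torsionBySet R M (maximalIdeal R) ≃ₗ[R]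
      (Fin (moduleType R M) → ResidueField R)) := by
  let e : extModule R 0 (ResidueField R) M ≃ₗ[R] torsionBySet R M (maximalIdeal R) :=
    extModuleZeroEquiv R (ResidueField R) M ≪≫ₗ quotientHomEquivTorsionBySet (maximalIdeal R) M
  have hdepth : idealDepth R (maximalIdeal R) M = 0 := by
    refine le_antisymm (sInf_le ⟨0, fun h => hS ?_, rfl⟩) zero_le
    have : Subsingleton (extModule R 0 (ResidueField R) M) := h
    exact Submodule.subsingleton_iff_eq_bot.1 e.symm.injective.subsingleton
  have hmem : moduleType R M ∈ { n : ℕ | Nonempty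
      ((extModule R ((idealDepth R (maximalIdeal R) M).toNat) (ResidueField R) M) ≃ₗ[R]
        (Fin n → ResidueField R)) } := by
    refine Nat.sInf_mem ⟨Module.finrank (ResidueField R) (torsionBySet R M (maximalIdeal R)), ?_⟩
    rw [Set.mem_ofPred_eq, hdepth]
    exact ⟨e ≪≫ₗ (Module.finBasis (ResidueField R)
      (torsionBySet R M (maximalIdeal R))).equivFun.restrictScalars R⟩
  rw [Set.mem_ofPred_eq, hdepth] at hmem
  exact hmem.map (e.symm ≪≫ₗ ·)

end

/-- If `(R,m,k)` is a noetherian local ring and `M` is a non-zero finitely generated or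
artinian `R`-module, then `M` is injective if and only if `M ≅ E_R(k)^{type M}`, where
`type M = rank_k Ext_R^{depth M}(k, M)` and `E_R(k)` is the injective envelope of `k`. -/
theorem injective_iff_power_of_injEnv {R : Type u} [CommRing R] [IsLocalRing R]
    [IsNoetherianRing R] (M : Type u) [AddCommGroup M] [Module R M] [Nontrivial M]
    (hM : Module.Finite R M ∨ IsArtinian R M)
    (E : Type u) [AddCommGroup E] [Module R E] (hE : IsInjEnvResidueField R E) :
    Module.Injective R M ↔ Nonempty (M ≃ₗ[R] (Fin (moduleType R M) → E)) := by
  constructor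
  · intro hinj
    have hS : (∀ N : Submodule R M, N ≠ ⊥ → N ⊓ Submodule.torsionBySet R M (maximalIdeal R) ≠ ⊥) ∧
        Module.Finite (ResidueField R) (Submodule.torsionBySet R M (maximalIdeal R)) := by
      rcases hM with hfin | hart
      · obtain ⟨n, hn⟩ := Module.Injective.exists_maximalIdeal_pow_le_annihilator (R := R) M
        exact ⟨fun N => inf_torsionBySet_ne_bot_of_pow_le_annihilator hn,
          Module.Finite.of_restrictScalars_finite R _ _⟩
      · have : IsArtinian (ResidueField R) (Submodule.torsionBySet R M (maximalIdeal R)) :=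
          isArtinian_of_tower R inferInstance
        have := IsSemiprimaryRing.isNoetherian_iff_isArtinian.2 this
        exact ⟨fun N => IsArtinian.inf_torsionBySet_maximalIdeal_ne_bot, inferInstance⟩
    obtain ⟨hess, hfin⟩ := hS
    have hne : Submodule.torsionBySet R M (maximalIdeal R) ≠ ⊥ := by
      simpa using hess ⊤ top_ne_bot
    obtain ⟨e⟩ := nonempty_socle_equiv_pi_moduleType M hne
    exact Module.Injective.nonempty_equiv_pi_injEnv hE hess e
  · rintro ⟨e⟩
    have := hE.1
    exact Module.Baer.injective
      (Module.Baer.of_equiv e.symm (Module.Baer.of_injective inferInstance))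
end
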